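/- Fix β > 0 and λ₁ > 2, let ρ₀ be the unique solution of ρ₀ tan ρ₀ = β in (0, π/2), and set σ := 4 sin(ρ₀)(3 − sin²ρ₀)/(3(2ρ₀ + sin 2ρ₀)). Then there exist ε₀ > 0 and C > 0 such that for every ε ∈ (0, ε₀) there is a function u = u^ε, twice continuously differentiable on Ω̄ = ℝ × [0,1] and bounded together with its derivatives up to order two, satisfying Δu + λ₁ε·u_x + u(ρ₀² + ε² − u) = 0 in Ω, u_y(x,0) = 0 and u_y(x,1) + βu(x,1) = 0 for all x ∈ ℝ, and such that: (i) sup_{Ω̄} |u| ≤ Cε²; (ii) u(x,y) → 0 uniformly in y as x → +∞; (iii) there exists u⁻ : [0,1] → ℝ with u(x,·) → u⁻ uniformly as x → −∞ and sup_y |u⁻(y) − (ε²/σ)cos(ρ₀y)| ≤ Cε³. In particular u⁻ ≢ 0, so u^ε is a front-type (heteroclinic) solution moving with the slow speed λ₁ε. -/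

import Mathlib

open Real Set Filter

/-- Partial derivative in the first (axial) variable. -/
noncomputable def pdx (u : ℝ × ℝ → ℝ) (p : ℝ × ℝ) : ℝ :=
  deriv (fun t => u (t, p.2)) p.1

/-- Partial derivative in the second (transversal) variable. -/
noncomputable def pdy (u : ℝ × ℝ → ℝ) (p : ℝ × ℝ) : ℝ :=
  deriv (fun t => u (p.1, t)) p.2

section

open Real Set Filter Topology MeasureTheory

namespace FK

/-- continuous and bounded -/
def CB (f : ℝ → ℝ) : Prop := Continuous f ∧ ∃ M, ∀ x, |f x| ≤ M

/-- one-sided exponential average -/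
noncomputable def J (p : ℝ) (f : ℝ → ℝ) (X : ℝ) : ℝ := ∫ t in Ioi (0:ℝ), exp (-p * t) * f (X - t)

lemma J_int {p : ℝ} (hp : 0 < p) {f : ℝ → ℝ} (hf : CB f) (X : ℝ) :
    IntegrableOn (fun t => exp (-p * t) * f (X - t)) (Ioi 0) := by
  obtain ⟨hc, M, hM⟩ := hf
  have h1 : IntegrableOn (fun t => exp (-p * t)) (Ioi 0) := exp_neg_integrableOn_Ioi 0 hp
  refine (h1.const_mul M).mono' (by fun_prop) ?_
  refine Eventually.of_forall fun t => ?_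
  rw [norm_mul, norm_eq_abs, norm_eq_abs, abs_of_pos (exp_pos _), mul_comm]
  exact mul_le_mul_of_nonneg_right (hM _) (exp_pos _).le

lemma exp_int {a : ℝ} (ha : 0 < a) : ∫ t in Ioi (0:ℝ), exp (-a * t) = 1 / a := by
  have := integral_exp_mul_Ioi (a := -a) (by linarith) 0
  rw [this]; simp

lemma J_le_exp {p κ : ℝ} (hp : 0 < p) (hk : κ < p) {f : ℝ → ℝ} (hf : CB f) {M : ℝ}
    (hM : ∀ x, |f x| ≤ M * exp (-κ * x)) (X : ℝ) : |J p f X| ≤ M * exp (-κ * X) / (p - κ) := by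
  have hint : IntegrableOn (fun t => exp (-(p - κ) * t)) (Ioi 0) :=
    exp_neg_integrableOn_Ioi 0 (by linarith)
  have hb : ∀ t, |exp (-p * t) * f (X - t)| ≤ M * exp (-κ * X) * exp (-(p-κ) * t) := by
    intro t
    rw [abs_mul, abs_of_pos (exp_pos _)]
    calc exp (-p * t) * |f (X - t)| ≤ exp (-p * t) * (M * exp (-κ * (X - t))) :=
          mul_le_mul_of_nonneg_left (hM _) (exp_pos _).le
      _ = M * (exp (-p * t) * exp (-κ * (X - t))) := by ring
      _ = M * (exp (-κ * X) * exp (-(p-κ) * t)) := by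
          rw [← Real.exp_add, ← Real.exp_add]; congr 2; ring
      _ = _ := by ring
  unfold J
  calc |∫ t in Ioi (0:ℝ), exp (-p * t) * f (X - t)|
      ≤ ∫ t in Ioi (0:ℝ), M * exp (-κ * X) * exp (-(p-κ) * t) := by
        rw [← norm_eq_abs]
        exact norm_integral_le_of_norm_le (hint.const_mul _) (Eventually.of_forall hb)
    _ = _ := by
        rw [integral_const_mul, exp_int (by linarith)]; ring

lemma J_le {p : ℝ} (hp : 0 < p) {f : ℝ → ℝ} (hf : CB f) {M : ℝ}
    (hM : ∀ x, |f x| ≤ M) (X : ℝ) : |J p f X| ≤ M / p := by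
  have := J_le_exp (κ := 0) hp hp hf (M := M) (by simpa using hM) X
  simpa using this

lemma J_mono {p : ℝ} (hp : 0 < p) {f g : ℝ → ℝ} (hf : CB f) (hg : CB g) (h : ∀ x, f x ≤ g x)
    (X : ℝ) : J p f X ≤ J p g X :=
  integral_mono (J_int hp hf X) (J_int hp hg X)
    (fun t => mul_le_mul_of_nonneg_left (h _) (exp_pos _).le)

lemma J_sub {p : ℝ} (hp : 0 < p) {f g : ℝ → ℝ} (hf : CB f) (hg : CB g) (X : ℝ) :
    J p (fun x => f x - g x) X = J p f X - J p g X := by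
  unfold J
  rw [← integral_sub (J_int hp hf X) (J_int hp hg X)]
  congr 1; ext t; ring

lemma J_deriv {p : ℝ} (hp : 0 < p) {f : ℝ → ℝ} (hf : CB f) (X : ℝ) :
    HasDerivAt (J p f) (f X - p * J p f X) X := by
  set F : ℝ → ℝ := fun x => ∫ s in (0:ℝ)..x, exp (p * s) * f s with hF
  have hcf := hf.1
  have hc : Continuous (fun s => exp (p * s) * f s) := by fun_prop
  have hFd : ∀ x, HasDerivAt F (exp (p * x) * f x) x := fun x =>
    intervalIntegral.integral_hasDerivAt_right (hc.intervalIntegrable _ _)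
      (hc.stronglyMeasurableAtFilter _ _) hc.continuousAt
  have hfin : ∀ X T, ∫ t in (0:ℝ)..T, exp (-p * t) * f (X - t)
      = exp (-p * X) * (F X - F (X - T)) := by
    intro X T
    have hd : ∀ t ∈ uIcc 0 T, HasDerivAt (fun t => - (exp (-p * X) * F (X - t)))
        (exp (-p * t) * f (X - t)) t := by
      intro t _
      have h1 : HasDerivAt (fun t => X - t) (-1) t := by
        simpa using (hasDerivAt_id t).const_sub X
      have h2 := (((hFd (X - t)).comp t h1).const_mul (exp (-p * X))).neg
      refine h2.congr_deriv ?_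
      have : exp (-p * t) = exp (-p * X) * exp (p * (X - t)) := by
        rw [← Real.exp_add]; congr 1; ring
      rw [this]; ring
    have hc2 : Continuous (fun t => exp (-p * t) * f (X - t)) := by fun_prop
    rw [intervalIntegral.integral_eq_sub_of_hasDerivAt hd (hc2.intervalIntegrable _ _)]
    simp; ring
  have hlim : ∀ X, Tendsto (fun T => F (X - T)) atTop (𝓝 (F X - exp (p * X) * J p f X)) := by
    intro X
    have h1 := intervalIntegral_tendsto_integral_Ioi 0 (J_int hp hf X) tendsto_id
    simp only [id, hfin X] at h1
    have h2 := (h1.const_mul (exp (p * X))).const_sub (F X)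
    refine (h2.congr fun T => ?_)
    rw [← mul_assoc, ← Real.exp_add]
    simp
  have key : ∀ X, F X - exp (p * X) * J p f X = - J p f 0 := by
    intro X
    have h0 := hlim 0
    have h0' : Tendsto (fun T => F (X - T)) atTop (𝓝 (F 0 - exp (p * 0) * J p f 0)) := by
      have := h0.comp (tendsto_atTop_add_const_right atTop (-X) tendsto_id)
      refine this.congr fun T => ?_
      simp [sub_eq_add_neg, add_comm]
    have := tendsto_nhds_unique (hlim X) h0'
    rw [this]; simp [hF]
  have hJ : J p f = fun X => exp (-p * X) * (F X + J p f 0) := by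
    ext X
    have h1 := key X
    have h2 : F X + J p f 0 = exp (p * X) * J p f X := by linarith
    rw [h2, ← mul_assoc, ← Real.exp_add]; simp
  have hE : HasDerivAt (fun X => exp (-p * X)) (exp (-p * X) * (-p)) X := by
    have : HasDerivAt (fun X => -p * X) (-p) X := by simpa using (hasDerivAt_id X).const_mul (-p)
    exact this.exp
  have h3 := hE.mul ((hFd X).add_const (J p f 0))
  have h4 : J p f X = exp (-p * X) * (F X + J p f 0) := congrFun hJ X
  rw [hJ]
  refine h3.congr_deriv ?_
  beta_reduce
  rw [← h4]
  have : exp (-p * X) * (exp (p * X) * f X) = f X := by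
    rw [← mul_assoc, ← Real.exp_add]; simp
  rw [this, h4]; simp; ring

lemma J_CB {p : ℝ} (hp : 0 < p) {f : ℝ → ℝ} (hf : CB f) : CB (J p f) := by
  refine ⟨continuous_iff_continuousAt.2 fun X => (J_deriv hp hf X).continuousAt, ?_⟩
  obtain ⟨hc, M, hM⟩ := hf
  exact ⟨M / p, J_le hp ⟨hc, M, hM⟩ hM⟩

lemma J_tendsto {p : ℝ} (hp : 0 < p) {f : ℝ → ℝ} (hf : CB f) {l : Filter ℝ} [l.IsCountablyGenerated]
    (hl : ∀ t, Tendsto (fun X => X - t) l l) {a : ℝ} (ha : Tendsto f l (𝓝 a)) :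
    Tendsto (J p f) l (𝓝 (a / p)) := by
  obtain ⟨hc, M, hM⟩ := hf
  have h1 : IntegrableOn (fun t => exp (-p * t)) (Ioi 0) := exp_neg_integrableOn_Ioi 0 hp
  have : a / p = ∫ t in Ioi (0:ℝ), exp (-p * t) * a := by
    rw [integral_mul_const, exp_int hp]; ring
  rw [this]
  refine tendsto_integral_filter_of_dominated_convergence (fun t => M * exp (-p * t)) ?_ ?_
    (h1.const_mul M) ?_
  · exact Eventually.of_forall fun X => by fun_prop
  · refine Eventually.of_forall fun X => Eventually.of_forall fun t => ?_
    rw [norm_mul, norm_eq_abs, norm_eq_abs, abs_of_pos (exp_pos _), mul_comm]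
    exact mul_le_mul_of_nonneg_right (hM _) (exp_pos _).le
  · refine Eventually.of_forall fun t => ?_
    exact (ha.comp (hl t)).const_mul _

lemma J_repr {p : ℝ} (hp : 0 < p) {w w' : ℝ → ℝ} (hw : CB w) (hw' : CB w')
    (hd : ∀ x, HasDerivAt w (w' x) x) (X : ℝ) : J p (fun x => w' x + p * w x) X = w X := by
  have hcb : CB (fun x => w' x + p * w x) := by
    obtain ⟨hc, M, hM⟩ := hw
    obtain ⟨hc', M', hM'⟩ := hw'
    refine ⟨by fun_prop, M' + p * M, fun x => ?_⟩
    calc |w' x + p * w x| ≤ |w' x| + |p * w x| := abs_add_le _ _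
      _ ≤ M' + p * M := by
        rw [abs_mul, abs_of_pos hp]
        exact add_le_add (hM' _) (mul_le_mul_of_nonneg_left (hM _) hp.le)
  have hder : ∀ t ∈ Ici (0:ℝ), HasDerivAt (fun t => - (exp (-p * t) * w (X - t)))
      (exp (-p * t) * (w' (X - t) + p * w (X - t))) t := by
    intro t _
    have h1 : HasDerivAt (fun t => X - t) (-1) t := by
      simpa using (hasDerivAt_id t).const_sub X
    have hE : HasDerivAt (fun X => exp (-p * X)) (exp (-p * t) * (-p)) t := by
      have : HasDerivAt (fun X => -p * X) (-p) t := by simpa using (hasDerivAt_id t).const_mul (-p)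
      exact this.exp
    have h2 := (hE.mul ((hd (X - t)).comp t h1)).neg
    refine h2.congr_deriv ?_
    simp; ring
  have hlim : Tendsto (fun t => - (exp (-p * t) * w (X - t))) atTop (𝓝 0) := by
    obtain ⟨hc, M, hM⟩ := hw
    have h0 : Tendsto (fun t => M * exp (-p * t)) atTop (𝓝 0) := by
      have : Tendsto (fun t => exp (-p * t)) atTop (𝓝 0) := by
        apply tendsto_exp_atBot.comp
        exact tendsto_id.const_mul_atTop_of_neg (by linarith)
      simpa using this.const_mul M
    refine squeeze_zero_norm (fun t => ?_) h0
    rw [norm_neg, norm_mul, norm_eq_abs, norm_eq_abs, abs_of_pos (exp_pos _), mul_comm]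
    exact mul_le_mul_of_nonneg_right (hM _) (exp_pos _).le
  have := integral_Ioi_of_hasDerivAt_of_tendsto' hder (J_int hp hcb X) hlim
  unfold J
  rw [this]; simp

lemma CB_neg {f : ℝ → ℝ} (hf : CB f) : CB (fun x => f (-x)) := by
  obtain ⟨hc, M, hM⟩ := hf
  exact ⟨by fun_prop, M, fun x => hM _⟩

/-- Green operator of `-v'' - (p-q) v' + p q v = f` -/
noncomputable def G (p q : ℝ) (f : ℝ → ℝ) (X : ℝ) : ℝ := J q (fun s => J p f (-s)) (-X)

section
variable {p q : ℝ} (hp : 0 < p) (hq : 0 < q)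

lemma G_le_exp (hp : 0 < p) (hq : 0 < q) {κ : ℝ} (hk : κ < p) (hk' : 0 ≤ κ) {f : ℝ → ℝ}
    (hf : CB f) {M : ℝ} (hM : ∀ x, |f x| ≤ M * exp (-κ * x)) (X : ℝ) :
    |G p q f X| ≤ M * exp (-κ * X) / ((p - κ) * (q + κ)) := by
  have h1 := J_le_exp (p := q) (κ := -κ) hq (by linarith) (CB_neg (J_CB hp hf))
    (M := M / (p - κ)) (fun x => by
      have := J_le_exp hp hk hf hM (-x)
      refine this.trans (le_of_eq ?_)
      rw [show -κ * -x = - -κ * x by ring]; ring) (-X)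
  refine h1.trans (le_of_eq ?_)
  rw [show - -κ * -X = -κ * X by ring, show q - -κ = q + κ by ring]
  field_simp

lemma G_le (hp : 0 < p) (hq : 0 < q) {f : ℝ → ℝ} (hf : CB f) {M : ℝ}
    (hM : ∀ x, |f x| ≤ M) (X : ℝ) : |G p q f X| ≤ M / (p * q) := by
  have := G_le_exp (κ := 0) hp hq hp le_rfl hf (M := M) (by simpa using hM) X
  simpa using this

lemma G_mono (hp : 0 < p) (hq : 0 < q) {f g : ℝ → ℝ} (hf : CB f) (hg : CB g)
    (h : ∀ x, f x ≤ g x) (X : ℝ) : G p q f X ≤ G p q g X :=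
  J_mono hq (CB_neg (J_CB hp hf)) (CB_neg (J_CB hp hg)) (fun x => J_mono hp hf hg h _) _

lemma G_sub (hp : 0 < p) (hq : 0 < q) {f g : ℝ → ℝ} (hf : CB f) (hg : CB g) (X : ℝ) :
    G p q (fun x => f x - g x) X = G p q f X - G p q g X := by
  unfold G
  rw [← J_sub hq (CB_neg (J_CB hp hf)) (CB_neg (J_CB hp hg))]
  congr 1; ext s; exact J_sub hp hf hg _

lemma G_deriv (hp : 0 < p) (hq : 0 < q) {f : ℝ → ℝ} (hf : CB f) (X : ℝ) :
    HasDerivAt (G p q f) (q * G p q f X - J p f X) X := by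
  have h1 := (J_deriv hq (CB_neg (J_CB hp hf)) (-X)).comp X (hasDerivAt_neg X)
  refine h1.congr_deriv ?_
  unfold G
  simp

lemma G_deriv2 (hp : 0 < p) (hq : 0 < q) {f : ℝ → ℝ} (hf : CB f) (X : ℝ) :
    HasDerivAt (fun X => q * G p q f X - J p f X)
      (p * q * G p q f X - (p - q) * (q * G p q f X - J p f X) - f X) X := by
  have h1 := ((G_deriv hp hq hf X).const_mul q).sub (J_deriv hp hf X)
  refine h1.congr_deriv ?_
  ring

lemma G_CB (hp : 0 < p) (hq : 0 < q) {f : ℝ → ℝ} (hf : CB f) : CB (G p q f) := by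
  have := CB_neg (J_CB hq (CB_neg (J_CB hp hf)))
  exact this

lemma G_tendsto (hp : 0 < p) (hq : 0 < q) {f : ℝ → ℝ} (hf : CB f) {a : ℝ}
    (ha : Tendsto f atBot (𝓝 a)) : Tendsto (G p q f) atBot (𝓝 (a / p / q)) := by
  have h1 : Tendsto (J p f) atBot (𝓝 (a / p)) :=
    J_tendsto hp hf (fun t => tendsto_atBot_add_const_right _ (-t) tendsto_id) ha
  have h2 : Tendsto (J q (fun s => J p f (-s))) atTop (𝓝 (a / p / q)) :=
    J_tendsto hq (CB_neg (J_CB hp hf)) (fun t => tendsto_atTop_add_const_right _ (-t) tendsto_id)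
      (h1.comp tendsto_neg_atTop_atBot)
  exact h2.comp tendsto_neg_atBot_atTop

lemma G_repr (hp : 0 < p) (hq : 0 < q) {w w' w'' : ℝ → ℝ} (hw : CB w) (hw' : CB w') (hw'' : CB w'')
    (hd : ∀ x, HasDerivAt w (w' x) x) (hd' : ∀ x, HasDerivAt w' (w'' x) x) (X : ℝ) :
    G p q (fun x => - w'' x - (p - q) * w' x + p * q * w x) X = w X := by
  obtain ⟨hc, M, hM⟩ := hw
  obtain ⟨hc', M', hM'⟩ := hw'
  obtain ⟨hc'', M'', hM''⟩ := hw''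
  have h1 : ∀ X, J p (fun x => - w'' x - (p - q) * w' x + p * q * w x) X = - w' X + q * w X := by
    intro X
    have := J_repr hp (w := fun x => - w' x + q * w x) (w' := fun x => - w'' x + q * w' x)
      ⟨by fun_prop, M' + q * M, fun x => by
        calc |- w' x + q * w x| ≤ |- w' x| + |q * w x| := abs_add_le _ _
          _ ≤ M' + q * M := by
            rw [abs_mul, abs_of_pos hq, abs_neg]
            exact add_le_add (hM' _) (mul_le_mul_of_nonneg_left (hM _) hq.le)⟩
      ⟨by fun_prop, M'' + q * M', fun x => by
        calc |- w'' x + q * w' x| ≤ |- w'' x| + |q * w' x| := abs_add_le _ _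
          _ ≤ M'' + q * M' := by
            rw [abs_mul, abs_of_pos hq, abs_neg]
            exact add_le_add (hM'' _) (mul_le_mul_of_nonneg_left (hM' _) hq.le)⟩
      (fun x => (hd' x).neg.add ((hd x).const_mul q)) X
    rw [← this]
    congr 1; ext x; ring
  unfold G
  simp only [h1]
  have := J_repr hq (w := fun x => w (-x)) (w' := fun x => - w' (-x))
    ⟨by fun_prop, M, fun x => hM _⟩ ⟨by fun_prop, M', fun x => by simpa using hM' (-x)⟩
    (fun x => ((hd (-x)).comp x (hasDerivAt_neg x)).congr_deriv (by ring)) (-X)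
  simpa using this

end

end FK

end

section

open Real Set Filter Topology MeasureTheory BoundedContinuousFunction

namespace FK

lemma q_nonneg {g : ℝ} (h0 : 0 ≤ g) (h1 : g ≤ 1) : 0 ≤ 2 * g - g ^ 2 := by nlinarith
lemma q_le_one (g : ℝ) : 2 * g - g ^ 2 ≤ 1 := by nlinarith [sq_nonneg (g - 1)]

/-- the weight -/
noncomputable def Ph (κ X : ℝ) : ℝ := min 1 (exp (-κ * X))

lemma Ph_pos (κ X : ℝ) : 0 < Ph κ X := lt_min one_pos (exp_pos _)
lemma Ph_le_one (κ X : ℝ) : Ph κ X ≤ 1 := min_le_left _ _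
lemma Ph_le_exp (κ X : ℝ) : Ph κ X ≤ exp (-κ * X) := min_le_right _ _
lemma Ph_cont (κ : ℝ) : Continuous (Ph κ) := by unfold Ph; fun_prop

lemma exists_pq {lam m : ℝ} (hl : 0 < lam) (hm : 0 < m) :
    ∃ p q : ℝ, 0 < p ∧ 0 < q ∧ p - q = lam ∧ p * q = m := by
  have h0 : 0 ≤ lam ^ 2 + 4 * m := by positivity
  have h1 := Real.sq_sqrt h0
  have h2 : lam < √(lam ^ 2 + 4 * m) := Real.lt_sqrt_of_sq_lt (by linarith)
  refine ⟨(√(lam ^ 2 + 4 * m) + lam) / 2, (√(lam ^ 2 + 4 * m) - lam) / 2, by linarith, by linarith,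
    by ring, by nlinarith⟩

lemma G_weight {p q κ : ℝ} (hp : 0 < p) (hq : 0 < q) (hk : κ < p) (hk0 : 0 ≤ κ)
    {f : ℝ → ℝ} (hf : CB f) {M₁ M₂ c : ℝ} (h1 : ∀ x, |f x| ≤ M₁)
    (h2 : ∀ x, |f x| ≤ M₂ * exp (-κ * x)) (hc1 : M₁ / (p * q) ≤ c)
    (hc2 : M₂ / ((p - κ) * (q + κ)) ≤ c) (X : ℝ) : |G p q f X| ≤ c * Ph κ X := by
  unfold Ph
  rcases min_choice 1 (exp (-κ * X)) with h | h <;> rw [h]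
  · simpa using (G_le hp hq hf h1 X).trans hc1
  · refine (G_le_exp hp hq hk hk0 hf h2 X).trans ?_
    rw [mul_div_right_comm]
    exact mul_le_mul_of_nonneg_right hc2 (exp_pos _).le

lemma G_Ph {p q κ : ℝ} (hp : 0 < p) (hq : 0 < q) (hk : κ < p) (hk0 : 0 ≤ κ)
    (hk1 : 0 ≤ (p - q) * κ - κ ^ 2)
    {f : ℝ → ℝ} (hf : CB f) {M : ℝ} (hM : 0 ≤ M) (h : ∀ x, |f x| ≤ M * Ph κ x) (X : ℝ) :
    |G p q f X| ≤ M / (p * q) * Ph κ X := by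
  refine G_weight hp hq hk hk0 hf (M₁ := M) (M₂ := M) ?_ ?_ le_rfl ?_ X
  · exact fun x => (h x).trans (by nlinarith [Ph_le_one κ x])
  · exact fun x => (h x).trans (mul_le_mul_of_nonneg_left (Ph_le_exp _ _) hM)
  · apply div_le_div_of_nonneg_left hM (by positivity)
    nlinarith

/-- contraction rate -/
noncomputable def th (lam κ : ℝ) : ℝ := max (1/2) (2 / (1 + lam * κ - κ ^ 2))

lemma th_lt {lam κ : ℝ} (h : 1 < lam * κ - κ ^ 2) : th lam κ < 1 := by
  unfold th
  refine max_lt (by norm_num) ?_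
  rw [div_lt_one (by linarith)]; linarith

lemma th_pos {lam κ : ℝ} : 0 < th lam κ := lt_of_lt_of_le (by norm_num) (le_max_left _ _)

lemma G_contr {p q lam κ : ℝ} (hp : 0 < p) (hq : 0 < q) (hpq : p - q = lam) (hpq1 : p * q = 1)
    (hk : κ < p) (hk0 : 0 ≤ κ) (hk1 : 1 < lam * κ - κ ^ 2)
    {a f : ℝ → ℝ} (hf : CB f) (ha0 : ∀ x, 0 ≤ a x) (ha : ∀ x, (2 - 2 * a x) * Ph κ x ≤ 1/2)
    {c : ℝ} (hc : 0 ≤ c) (h : ∀ x, |f x| ≤ c * ((2 - 2 * a x) * Ph κ x)) (X : ℝ) :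
    |G p q f X| ≤ th lam κ * c * Ph κ X := by
  have e : (p - κ) * (q + κ) = 1 + lam * κ - κ ^ 2 := by rw [← hpq]; nlinarith
  refine G_weight hp hq hk hk0 hf (M₁ := c * (1/2)) (M₂ := c * 2) ?_ ?_ ?_ ?_ X
  · exact fun x => (h x).trans (mul_le_mul_of_nonneg_left (ha x) hc)
  · intro x
    refine (h x).trans ?_
    rw [mul_assoc]
    refine mul_le_mul_of_nonneg_left ?_ hc
    calc (2 - 2 * a x) * Ph κ x ≤ 2 * Ph κ x :=
          mul_le_mul_of_nonneg_right (by linarith [ha0 x]) (Ph_pos _ _).le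
      _ ≤ _ := mul_le_mul_of_nonneg_left (Ph_le_exp _ _) (by norm_num)
  · rw [hpq1, div_one, mul_comm]
    exact mul_le_mul_of_nonneg_right (le_max_left _ _) hc
  · rw [e, mul_div_assoc, mul_comm]
    exact mul_le_mul_of_nonneg_right (le_max_right _ _) hc

/-- abstract step: fixed point between sub- and supersolution -/
lemma front_aux {p q lam κ M : ℝ} (hp : 0 < p) (hq : 0 < q) (hpq : p - q = lam) (hpq1 : p * q = 1)
    (hk : κ < p) (hk0 : 0 ≤ κ) (hk1 : 1 < lam * κ - κ ^ 2) (hM : 0 ≤ M)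
    {lo hi : ℝ → ℝ} (hlo : Continuous lo) (hhi : Continuous hi) (hlo0 : ∀ x, 0 ≤ lo x)
    (hle : ∀ x, lo x ≤ hi x) (hhi1 : ∀ x, hi x ≤ 1) (hd : ∀ x, hi x - lo x ≤ M * Ph κ x)
    (ha : ∀ x, (2 - 2 * lo x) * Ph κ x ≤ 1/2)
    (hsub : ∀ X, lo X ≤ G p q (fun x => 2 * lo x - lo x ^ 2) X)
    (hsup : ∀ X, G p q (fun x => 2 * hi x - hi x ^ 2) X ≤ hi X) :
    ∃ a : ℝ → ℝ, Continuous a ∧ (∀ x, lo x ≤ a x) ∧ (∀ x, a x ≤ hi x) ∧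
      ∀ X, G p q (fun x => 2 * a x - a x ^ 2) X = a X := by
  -- clamped profile
  set A : (ℝ →ᵇ ℝ) → ℝ → ℝ := fun Z x => max (lo x) (min (hi x) (lo x + Ph κ x * Z x)) with hA
  have hPc := Ph_cont κ
  have hAc : ∀ Z, Continuous (A Z) := fun Z => by
    have := Z.continuous
    simp only [hA]; fun_prop
  have hAlo : ∀ Z x, lo x ≤ A Z x := fun Z x => le_max_left _ _
  have hAhi : ∀ Z x, A Z x ≤ hi x := fun Z x => max_le (hle x) (min_le_left _ _)
  have hcb : ∀ b : ℝ → ℝ, Continuous b → (∀ x, lo x ≤ b x) → (∀ x, b x ≤ hi x) →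
      CB (fun x => 2 * b x - b x ^ 2) := by
    intro b hb h1 h2
    refine ⟨by fun_prop, 1, fun x => ?_⟩
    have := hlo0 x; have := h1 x; have := h2 x; have := hhi1 x
    rw [abs_le]; constructor <;> nlinarith
  have hmono : ∀ b c : ℝ → ℝ, (∀ x, lo x ≤ b x) → (∀ x, b x ≤ c x) → (∀ x, c x ≤ hi x) →
      ∀ x, 2 * b x - b x ^ 2 ≤ 2 * c x - c x ^ 2 := by
    intro b c h1 h2 h3 x
    have := hlo0 x; have := h1 x; have := h2 x; have := h3 x; have := hhi1 x
    nlinarith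
  have hTlo : ∀ Z X, lo X ≤ G p q (fun x => 2 * A Z x - A Z x ^ 2) X := fun Z X =>
    (hsub X).trans (G_mono hp hq (hcb _ hlo (fun _ => le_rfl) hle)
      (hcb _ (hAc Z) (hAlo Z) (hAhi Z)) (hmono _ _ (fun _ => le_rfl) (hAlo Z) (hAhi Z)) X)
  have hThi : ∀ Z X, G p q (fun x => 2 * A Z x - A Z x ^ 2) X ≤ hi X := fun Z X =>
    (G_mono hp hq (hcb _ (hAc Z) (hAlo Z) (hAhi Z)) (hcb _ hhi hle (fun _ => le_rfl))
       (hmono _ _ (hAlo Z) (hAhi Z) (fun _ => le_rfl)) X).trans (hsup X)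
  let T : (ℝ →ᵇ ℝ) → (ℝ →ᵇ ℝ) := fun Z => BoundedContinuousFunction.ofNormedAddCommGroup
    (fun X => (G p q (fun x => 2 * A Z x - A Z x ^ 2) X - lo X) / Ph κ X)
    (by
      have := (G_CB hp hq (hcb _ (hAc Z) (hAlo Z) (hAhi Z))).1
      exact (this.sub hlo).div₀ hPc (fun x => (Ph_pos κ x).ne'))
    M (fun X => by
      have h1 := hTlo Z X
      have h2 := hThi Z X
      rw [norm_eq_abs, abs_div, abs_of_pos (Ph_pos κ X), div_le_iff₀ (Ph_pos κ X),
        abs_of_nonneg (by linarith)]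
      linarith [hd X])
  have hT : ∀ Z X, T Z X = (G p q (fun x => 2 * A Z x - A Z x ^ 2) X - lo X) / Ph κ X :=
    fun Z X => rfl
  have hAdiff : ∀ Z Z' x, |A Z x - A Z' x| ≤ dist Z Z' * Ph κ x := by
    intro Z Z' x
    calc |A Z x - A Z' x| ≤ |min (hi x) (lo x + Ph κ x * Z x) - min (hi x) (lo x + Ph κ x * Z' x)| :=
by
          have := abs_max_sub_max_le_max (lo x) (min (hi x) (lo x + Ph κ x * Z x)) (lo x)
            (min (hi x) (lo x + Ph κ x * Z' x))
          simpa using this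
      _ ≤ |(lo x + Ph κ x * Z x) - (lo x + Ph κ x * Z' x)| := by
          have := abs_min_sub_min_le_max (hi x) (lo x + Ph κ x * Z x) (hi x) (lo x + Ph κ x * Z' x)
          simpa using this
      _ = |Z x - Z' x| * Ph κ x := by
          rw [show (lo x + Ph κ x * Z x) - (lo x + Ph κ x * Z' x) = (Z x - Z' x) * Ph κ x by ring,
            abs_mul, abs_of_pos (Ph_pos κ x)]
      _ ≤ _ := mul_le_mul_of_nonneg_right (by
          have := BoundedContinuousFunction.dist_coe_le_dist (f := Z) (g := Z') x
          rwa [Real.dist_eq] at this) (Ph_pos κ x).le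
  have hcontr : ContractingWith (Real.toNNReal (th lam κ)) T := by
    refine ⟨by rw [← NNReal.coe_lt_coe, Real.coe_toNNReal _ th_pos.le]; exact th_lt hk1, ?_⟩
    refine LipschitzWith.of_dist_le_mul fun Z Z' => ?_
    rw [Real.coe_toNNReal _ th_pos.le]
    refine (BoundedContinuousFunction.dist_le (mul_nonneg th_pos.le dist_nonneg)).2 fun X => ?_
    rw [hT, hT, Real.dist_eq, ← sub_div, abs_div, abs_of_pos (Ph_pos κ X), div_le_iff₀ (Ph_pos κ X)]
    have hc1 := hcb _ (hAc Z) (hAlo Z) (hAhi Z)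
    have hc2 := hcb _ (hAc Z') (hAlo Z') (hAhi Z')
    rw [show ∀ a b c : ℝ, a - c - (b - c) = a - b by intros; ring, ← G_sub hp hq hc1 hc2]
    have hc3 : CB (fun x => (2 * A Z x - A Z x ^ 2) - (2 * A Z' x - A Z' x ^ 2)) := by
      obtain ⟨h1, M1, hM1⟩ := hc1
      obtain ⟨h2, M2, hM2⟩ := hc2
      exact ⟨h1.sub h2, M1 + M2, fun x => (abs_sub _ _).trans (add_le_add (hM1 x) (hM2 x))⟩
    refine G_contr hp hq hpq hpq1 hk hk0 hk1 hc3 hlo0 ha dist_nonneg (fun x => ?_) X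
    have e : (2 * A Z x - A Z x ^ 2) - (2 * A Z' x - A Z' x ^ 2)
        = (2 - A Z x - A Z' x) * (A Z x - A Z' x) := by ring
    have hn : 0 ≤ 2 - A Z x - A Z' x := by linarith [hAhi Z x, hAhi Z' x, hhi1 x]
    rw [e, abs_mul, abs_of_nonneg hn]
    calc (2 - A Z x - A Z' x) * |A Z x - A Z' x|
        ≤ (2 - A Z x - A Z' x) * (dist Z Z' * Ph κ x) :=
          mul_le_mul_of_nonneg_left (hAdiff Z Z' x) hn
      _ ≤ (2 - 2 * lo x) * (dist Z Z' * Ph κ x) :=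
          mul_le_mul_of_nonneg_right (by linarith [hAlo Z x, hAlo Z' x])
            (mul_nonneg dist_nonneg (Ph_pos κ x).le)
      _ = _ := by ring
  set Z := ContractingWith.fixedPoint T hcontr
  have hfix : T Z = Z := hcontr.fixedPoint_isFixedPt
  have hlZ : ∀ X, lo X + Ph κ X * Z X = G p q (fun x => 2 * A Z x - A Z x ^ 2) X := by
    intro X
    conv_lhs => rw [← hfix]
    rw [hT, mul_div_cancel₀ _ (Ph_pos κ X).ne']; ring
  have hAZ : ∀ X, A Z X = G p q (fun x => 2 * A Z x - A Z x ^ 2) X := by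
    intro X
    conv_lhs => simp only [hA]
    rw [hlZ, min_eq_right (hThi Z X), max_eq_right (hTlo Z X)]
  exact ⟨A Z, hAc Z, hAlo Z, hAhi Z, fun X => (hAZ X).symm⟩

end FK
open Real Set Filter Topology MeasureTheory BoundedContinuousFunction

namespace FK

set_option maxHeartbeats 2000000 in
theorem front (lam : ℝ) (hlam : 2 < lam) : ∃ (κ M p q : ℝ) (a : ℝ → ℝ),
    0 < p ∧ 0 < q ∧ p - q = lam ∧ p * q = 1 ∧ 0 < κ ∧ κ < lam ∧ 1 < lam * κ - κ ^ 2 ∧ 0 ≤ M ∧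
    Continuous a ∧ (∀ x, 0 ≤ a x) ∧ (∀ x, a x ≤ 1) ∧ Tendsto a atBot (𝓝 1) ∧
    Tendsto a atTop (𝓝 0) ∧ (∀ x, a x ^ 2 ≤ M * Ph κ x) ∧
    (∀ x, (2 - 2 * a x) * Ph κ x ≤ 1/2) ∧
    ∀ X, G p q (fun x => 2 * a x - a x ^ 2) X = a X := by
  obtain ⟨p, q, hp, hq, hpq, hpq1⟩ := exists_pq (lam := lam) (m := 1) (by linarith) one_pos
  -- the slow root
  obtain ⟨ν, hν0, hν1, hν⟩ : ∃ ν : ℝ, 0 < ν ∧ ν < 1 ∧ ν ^ 2 + 1 = lam * ν := by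
    have h0 : 0 < lam ^ 2 - 4 := by nlinarith
    have h1 := Real.sq_sqrt h0.le
    have h2 : √(lam ^ 2 - 4) < lam := (Real.sqrt_lt' (by linarith)).2 (by linarith)
    have h3 : lam - 2 < √(lam ^ 2 - 4) := Real.lt_sqrt_of_sq_lt (by nlinarith)
    refine ⟨(lam - √(lam ^ 2 - 4)) / 2, by linarith, by linarith, by nlinarith⟩
  obtain ⟨m, hm2, hm⟩ : ∃ m : ℕ, 2 ≤ m ∧ ν ^ 2 * (1 + 1 / (m:ℝ)) < 1 := by
    have h1 : Tendsto (fun m : ℕ => ν ^ 2 * (1 + 1 / (m:ℝ))) atTop (𝓝 (ν ^ 2 * (1 + 0))) :=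
      (tendsto_one_div_atTop_nhds_zero_nat.const_add 1).const_mul _
    have h2 : ν ^ 2 * (1 + 0) < 1 := by nlinarith
    obtain ⟨m, h3, h4⟩ := ((h1.eventually (gt_mem_nhds h2)).and (eventually_ge_atTop 2)).exists
    exact ⟨m, h4, h3⟩
  have hm0 : (0:ℝ) < m := by positivity
  have hm1 : (2:ℝ) ≤ m := by exact_mod_cast hm2
  set δ := ν / m with hδ
  have hδ0 : 0 < δ := by positivity
  have hδm : m * δ = ν := by rw [hδ]; field_simp
  set κ := ν + δ with hκ
  have hνδ : ν ^ 2 + ν * δ < 1 := by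
    have : ν * δ = ν ^ 2 * (1 / m) := by rw [hδ]; ring
    rw [this]; linarith
  have hκ0 : 0 < κ := by positivity
  have hκν : κ * ν < 1 := by rw [hκ]; nlinarith
  have hδν : δ ≤ ν := by rw [hδ]; exact div_le_self hν0.le (by linarith)
  have hk1 : 1 < lam * κ - κ ^ 2 := by
    have : ν * (lam * κ - κ ^ 2 - 1) = δ * (1 - κ * ν) := by
      have : ν * (lam * κ) = (ν ^ 2 + 1) * κ := by rw [hν]; ring
      rw [mul_sub, mul_sub, this, hκ]; ring
    have h2 : 0 < ν * (lam * κ - κ ^ 2 - 1) := by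
      rw [this]; exact mul_pos hδ0 (by linarith)
    have := pos_of_mul_pos_right h2 hν0.le
    linarith
  have hklam : κ < lam := by nlinarith
  have hkp : κ < p := by linarith
  -- the shift
  obtain ⟨D, hD⟩ : ∃ D : ℝ, exp (-κ * D) = 1/4 := ⟨-log (1/4) / κ, by
    rw [show -κ * (-log (1/4) / κ) = log (1/4) by field_simp, Real.exp_log (by norm_num)]⟩
  obtain ⟨s, hs⟩ : ∃ s : ℝ, 3/4 ≤ (1 / (1 + exp (δ * (D - s)))) ^ m := by
    have h1 : Tendsto (fun s => exp (δ * (D - s))) atTop (𝓝 0) := by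
      apply tendsto_exp_atBot.comp
      apply Tendsto.const_mul_atBot hδ0
      exact tendsto_atBot_add_const_left _ D tendsto_neg_atTop_atBot
    have h2 : Tendsto (fun s => (1 / (1 + exp (δ * (D - s)))) ^ m) atTop (𝓝 ((1 / (1 + 0)) ^ m)) :=
      ((tendsto_const_nhds).div (h1.const_add 1) (by norm_num)).pow m
    have h3 : (3/4 : ℝ) < (1 / (1 + 0)) ^ m := by norm_num
    obtain ⟨s, hs⟩ := (h2.eventually (lt_mem_nhds h3)).exists
    exact ⟨s, hs.le⟩
  set t : ℝ → ℝ := fun X => 1 / (1 + exp (δ * (X - s))) with ht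
  have ht0 : ∀ x, 0 < t x := fun x => by simp only [ht]; positivity
  have ht1 : ∀ x, t x < 1 := fun x => by
    simp only [ht]; rw [div_lt_one (by positivity)]; linarith [exp_pos (δ * (x - s))]
  have htc : Continuous t := by
    simp only [ht]
    exact continuous_const.div (by fun_prop) (fun x => by positivity)
  have htd : ∀ x, HasDerivAt t (-δ * (t x * (1 - t x))) x := by
    intro x
    have h1 : HasDerivAt (fun X => δ * (X - s)) δ x := by
      simpa using ((hasDerivAt_id x).sub_const s).const_mul δ
    have h2 := ((h1.exp.const_add 1).inv (by positivity))
    have h3 : t = fun X => (1 + exp (δ * (X - s)))⁻¹ := by ext X; simp [ht]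
    rw [h3]
    refine h2.congr_deriv ?_
    have : (0:ℝ) < 1 + exp (δ * (x - s)) := by positivity
    field_simp
    ring
  have htpow : ∀ x, HasDerivAt (fun x => t x ^ m) (-ν * (t x ^ m * (1 - t x))) x := by
    intro x
    refine ((htd x).pow m).congr_deriv ?_
    have : t x ^ m = t x ^ (m - 1) * t x := by rw [← pow_succ]; congr 1; omega
    rw [this, ← hδm]; ring
  have htpow2 : ∀ x, HasDerivAt (fun x => -ν * (t x ^ m * (1 - t x)))
      (ν ^ 2 * (t x ^ m * (1 - t x) ^ 2) - ν * δ * (t x ^ m * t x * (1 - t x))) x := by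
    intro x
    refine (((htpow x).mul ((htd x).const_sub 1)).const_mul (-ν)).congr_deriv ?_
    ring
  have htm1 : ∀ x, t x ^ m ≤ 1 := fun x => pow_le_one₀ (ht0 x).le (ht1 x).le
  have htm0 : ∀ x, 0 ≤ t x ^ m := fun x => pow_nonneg (ht0 x).le _
  set E : ℝ → ℝ := fun X => exp (-ν * (X - s)) with hE
  set z : ℝ → ℝ := fun X => exp (-δ * (X - s)) with hz
  have hz0 : ∀ x, 0 < z x := fun x => exp_pos _
  have hzt : ∀ x, t x = z x * (1 - z x / (1 + z x)) := by
    intro x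
    have h1 : exp (δ * (x - s)) = (z x)⁻¹ := by
      simp only [hz]; rw [← Real.exp_neg]; congr 1; ring
    have := hz0 x
    simp only [ht, h1]; field_simp; ring
  have hzE : ∀ x, z x ^ m = E x := by
    intro x; simp only [hz, hE]; rw [← Real.exp_nat_mul]; congr 1; rw [← hδm]; ring
  have htz : ∀ x, t x ≤ z x := by
    intro x
    rw [hzt]
    have := hz0 x
    have : 0 ≤ z x / (1 + z x) := by positivity
    nlinarith
  have hloE : ∀ x, t x ^ m ≤ E x := fun x => by
    rw [← hzE]; exact pow_le_pow_left₀ (ht0 x).le (htz x) m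
  have hE0 : ∀ x, 0 < E x := fun x => exp_pos _
  have hEexp : ∀ x, E x = exp (ν * s) * exp (-ν * x) := fun x => by
    simp only [hE]; rw [← Real.exp_add]; congr 1; ring
  -- difference of super and sub solution
  have hdiff : ∀ x, E x - t x ^ m ≤ m * (exp (κ * s) * exp (-κ * x)) := by
    intro x
    have h0 := hz0 x
    have h1 : z x / (1 + z x) ≤ z x := div_le_self h0.le (by linarith)
    have h1' : z x / (1 + z x) ≤ 1 := by rw [div_le_one (by positivity)]; linarith
    have h2 := one_add_mul_le_pow (a := -(z x / (1 + z x))) (by linarith) m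
    have h3 : (1 - z x / (1 + z x)) ^ m = (1 + -(z x / (1 + z x))) ^ m := by ring
    have h4 : z x ^ m * z x = exp (κ * s) * exp (-κ * x) := by
      rw [hzE]; simp only [hE, hz]; rw [← Real.exp_add, ← Real.exp_add, hκ]; congr 1; ring
    rw [hzt, mul_pow, ← hzE, ← h4, h3]
    have h5 : 1 - m * z x ≤ (1 + -(z x / (1 + z x))) ^ m := by
      refine le_trans ?_ h2
      nlinarith
    have h6 : 0 < z x ^ m := by positivity
    nlinarith
  have hEc : Continuous E := by simp only [hE]; fun_prop
  set M := max 1 (m * exp (κ * s)) with hM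
  have hM0 : 0 ≤ M := le_trans zero_le_one (le_max_left _ _)
  have key : ∀ c x, c ≤ 1 → c ≤ m * (exp (κ * s) * exp (-κ * x)) → c ≤ M * Ph κ x := by
    intro c x h1 h2
    unfold Ph
    rcases min_choice 1 (exp (-κ * x)) with h | h <;> rw [h]
    · rw [mul_one]; exact h1.trans (le_max_left _ _)
    · rw [← mul_assoc] at h2
      exact h2.trans (mul_le_mul_of_nonneg_right (le_max_right _ _) (exp_pos _).le)
  have hlowt : ∀ x, (2 - 2 * t x ^ m) * Ph κ x ≤ 1/2 := by
    intro x
    have hP := Ph_pos κ x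
    have hP1 := Ph_le_one κ x
    have hP2 := Ph_le_exp κ x
    rcases le_total x D with h | h
    · have : t D ≤ t x := by
        simp only [ht]
        apply one_div_le_one_div_of_le (by positivity)
        have : exp (δ * (x - s)) ≤ exp (δ * (D - s)) := by gcongr
        linarith
      have h2 : 3/4 ≤ t x ^ m := hs.trans (pow_le_pow_left₀ (ht0 D).le this m)
      have h3 := htm1 x
      have h4 : (2 - 2 * t x ^ m) * Ph κ x ≤ (2 - 2 * t x ^ m) * 1 :=
        mul_le_mul_of_nonneg_left hP1 (by linarith)
      linarith
    · have : exp (-κ * x) ≤ exp (-κ * D) := Real.exp_le_exp.2 (by linarith [mul_le_mul_of_nonneg_left h hκ0.le])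
      have h3 := htm0 x
      have h4 : (2 - 2 * t x ^ m) * Ph κ x ≤ 2 * Ph κ x :=
        mul_le_mul_of_nonneg_right (by linarith) hP.le
      linarith
  have hcbpow : ∀ g : ℝ → ℝ, Continuous g → (∀ x, 0 ≤ g x) → (∀ x, g x ≤ 1) →
      CB (fun x => 2 * g x - g x ^ 2) := by
    intro g hg h0 h1
    refine ⟨by fun_prop, 1, fun x => ?_⟩
    have := h0 x; have := h1 x
    rw [abs_le]; exact ⟨by linarith [q_nonneg (h0 x) (h1 x)], q_le_one _⟩
  have hsub : ∀ X, t X ^ m ≤ G p q (fun x => 2 * t x ^ m - (t x ^ m) ^ 2) X := by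
    intro X
    have hb : ∀ x, |t x| ≤ 1 ∧ |1 - t x| ≤ 1 ∧ |t x ^ m| ≤ 1 := fun x =>
      ⟨by rw [abs_le]; constructor <;> linarith [ht0 x, ht1 x],
       by rw [abs_le]; constructor <;> linarith [ht0 x, ht1 x],
       by rw [abs_le]; constructor <;> linarith [htm0 x, htm1 x]⟩
    have c0 : CB (fun x => t x ^ m) := ⟨by fun_prop, 1, fun x => (hb x).2.2⟩
    have c1 : CB (fun x => -ν * (t x ^ m * (1 - t x))) := by
      refine ⟨by fun_prop, ν, fun x => ?_⟩
      obtain ⟨h1, h2, h3⟩ := hb x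
      rw [abs_mul, abs_mul, abs_neg, abs_of_pos hν0]
      have := mul_le_one₀ h3 (abs_nonneg _) h2
      exact mul_le_of_le_one_right hν0.le this
    have c2 : CB (fun x => ν ^ 2 * (t x ^ m * (1 - t x) ^ 2) - ν * δ * (t x ^ m * t x * (1 - t x))) := by
      refine ⟨by fun_prop, ν ^ 2 + ν * δ, fun x => ?_⟩
      obtain ⟨h1, h2, h3⟩ := hb x
      refine (abs_sub _ _).trans (add_le_add ?_ ?_)
      · rw [abs_mul, abs_mul, abs_of_pos (by positivity : 0 < ν ^ 2), abs_pow (1 - t x)]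
        have := mul_le_one₀ h3 (by positivity) (pow_le_one₀ (abs_nonneg _) h2 (n := 2))
        exact mul_le_of_le_one_right (by positivity) this
      · rw [abs_mul (ν * δ), abs_mul (t x ^ m * t x), abs_mul (t x ^ m), abs_of_pos (by positivity : 0 < ν * δ)]
        have := mul_le_one₀ (mul_le_one₀ h3 (abs_nonneg _) h1) (abs_nonneg _) h2
        exact mul_le_of_le_one_right (by positivity) this
    have hr := G_repr hp hq c0 c1 c2 htpow htpow2 X
    rw [← hr]
    refine G_mono hp hq ?_ (hcbpow _ (by fun_prop) htm0 htm1) ?_ X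
    · obtain ⟨a0, M0, b0⟩ := c0
      obtain ⟨a1, M1, b1⟩ := c1
      obtain ⟨a2, M2, b2⟩ := c2
      refine ⟨(a2.neg.sub (a1.const_mul (p - q))).add (a0.const_mul (p * q)),
        M2 + |p - q| * M1 + |p * q| * M0, fun x => ?_⟩
      refine (abs_add_le _ _).trans (add_le_add ((abs_sub _ _).trans (add_le_add ?_ ?_)) ?_)
      · rw [abs_neg]; exact b2 x
      · rw [abs_mul]; exact mul_le_mul_of_nonneg_left (b1 x) (abs_nonneg _)
      · rw [abs_mul]; exact mul_le_mul_of_nonneg_left (b0 x) (abs_nonneg _)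
    · intro x
      rw [hpq, hpq1]
      have h1 := ht0 x
      have h2 := ht1 x
      have h3 : t x ^ m ≤ t x ^ 2 := pow_le_pow_of_le_one h1.le h2.le hm2
      have h4 := htm0 x
      have e : 2 * t x ^ m - (t x ^ m) ^ 2 - (-(ν ^ 2 * (t x ^ m * (1 - t x) ^ 2) - ν * δ * (t x ^ m * t x * (1 - t x)))
         - lam * (-ν * (t x ^ m * (1 - t x))) + 1 * t x ^ m)
         = t x ^ m * (t x - t x ^ m - (ν ^ 2 + ν * δ) * (t x * (1 - t x))) := by
        have : lam * (-ν * (t x ^ m * (1 - t x))) = -(ν ^ 2 + 1) * (t x ^ m * (1 - t x)) := by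
          rw [hν]; ring
        rw [this]; ring
      have h5 : 0 ≤ t x - t x ^ m - (ν ^ 2 + ν * δ) * (t x * (1 - t x)) := by
        have : 0 ≤ t x * (1 - t x) := mul_nonneg h1.le (by linarith)
        nlinarith
      have := mul_nonneg h4 h5
      linarith
  have hhi0 : ∀ x, 0 ≤ min 1 (E x) := fun x => le_min zero_le_one (hE0 x).le
  have hsup : ∀ X, G p q (fun x => 2 * (min 1 (E x)) - (min 1 (E x)) ^ 2) X ≤ min 1 (E X) := by
    intro X
    have hcb := hcbpow (fun x => min 1 (E x)) (by fun_prop) hhi0 (fun x => min_le_left _ _)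
    have hnn : ∀ x, 0 ≤ 2 * (min 1 (E x)) - (min 1 (E x)) ^ 2 := fun x => by
      have h1 := hhi0 x
      have h2 : min 1 (E x) ≤ 1 := min_le_left _ _
      exact q_nonneg h1 h2
    refine le_min ?_ ?_
    · have := G_le hp hq hcb (M := 1) (fun x => by
        rw [abs_of_nonneg (hnn x)]; exact q_le_one _) X
      rw [hpq1] at this
      linarith [le_abs_self (G p q (fun x => 2 * (min 1 (E x)) - (min 1 (E x)) ^ 2) X)]
    · have := G_le_exp (κ := ν) hp hq (by linarith) hν0.le hcb (M := 2 * exp (ν * s)) (fun x => by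
        rw [abs_of_nonneg (hnn x), mul_assoc, ← hEexp]
        have h2 : min 1 (E x) ≤ E x := min_le_right _ _
        linarith [sq_nonneg (min 1 (E x))]) X
      have e : (p - ν) * (q + ν) = 2 := by nlinarith
      rw [e, mul_assoc, ← hEexp] at this
      linarith [le_abs_self (G p q (fun x => 2 * (min 1 (E x)) - (min 1 (E x)) ^ 2) X)]
  obtain ⟨a, hac, halo, hahi, haG⟩ := front_aux hp hq hpq hpq1 hkp hκ0.le hk1 hM0
    (lo := fun x => t x ^ m) (hi := fun x => min 1 (E x)) (by fun_prop) (by fun_prop) htm0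
    (fun x => le_min (htm1 x) (hloE x)) (fun x => min_le_left _ _)
    (fun x => key _ x (by linarith [min_le_left 1 (E x), htm0 x])
      (le_trans (by linarith [min_le_right 1 (E x)]) (hdiff x))) hlowt hsub hsup
  have ha0 : ∀ x, 0 ≤ a x := fun x => (htm0 x).trans (halo x)
  have ha1 : ∀ x, a x ≤ 1 := fun x => (hahi x).trans (min_le_left _ _)
  have haE : ∀ x, a x ≤ E x := fun x => (hahi x).trans (min_le_right _ _)
  refine ⟨κ, exp (2 * ν * s) + 1, p, q, a, hp, hq, hpq, hpq1, hκ0, hklam, hk1, by positivity, hac, ha0, ha1,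
    ?_, ?_, ?_, ?_, haG⟩
  · have h1 : Tendsto (fun x => exp (δ * (x - s))) atBot (𝓝 0) := by
      apply tendsto_exp_atBot.comp
      apply Tendsto.const_mul_atBot hδ0
      exact tendsto_atBot_add_const_right _ (-s) tendsto_id
    have h2 : Tendsto (fun x => t x ^ m) atBot (𝓝 ((1 / (1 + 0)) ^ m)) :=
      ((tendsto_const_nhds).div (h1.const_add 1) (by norm_num)).pow m
    simp only [add_zero, div_one, one_pow] at h2
    exact tendsto_of_tendsto_of_tendsto_of_le_of_le h2 tendsto_const_nhds halo ha1
  · have h1 : Tendsto E atTop (𝓝 0) := by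
      apply tendsto_exp_atBot.comp
      apply Tendsto.const_mul_atTop_of_neg (by linarith)
      exact tendsto_atTop_add_const_right _ (-s) tendsto_id
    exact tendsto_of_tendsto_of_tendsto_of_le_of_le tendsto_const_nhds h1 ha0 haE
  · intro x
    have hsq : a x ^ 2 ≤ exp (2 * ν * s) * exp (-(2 * ν) * x) := by
      have : E x ^ 2 = exp (2 * ν * s) * exp (-(2 * ν) * x) := by
        simp only [hE]; rw [← Real.exp_add, ← Real.exp_nat_mul]; congr 1; push_cast; ring
      rw [← this]
      exact pow_le_pow_left₀ (ha0 x) (haE x) 2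
    have hsq1 : a x ^ 2 ≤ 1 := pow_le_one₀ (ha0 x) (ha1 x)
    have hpos := exp_pos (2 * ν * s)
    rcases le_total x 0 with h | h
    · have : Ph κ x = 1 := min_eq_left (Real.one_le_exp (by linarith [mul_nonpos_of_nonneg_of_nonpos hκ0.le h]))
      rw [this]; linarith
    · have : Ph κ x = exp (-κ * x) := min_eq_right (Real.exp_le_one_iff.2 (by linarith [mul_nonneg hκ0.le h]))
      rw [this]
      have h2 : exp (-(2 * ν) * x) ≤ exp (-κ * x) := Real.exp_le_exp.2 (by linarith [mul_le_mul_of_nonneg_right (by linarith : κ ≤ 2 * ν) h])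
      nlinarith [exp_pos (-κ * x)]
  · intro x
    refine le_trans (mul_le_mul_of_nonneg_right ?_ (Ph_pos κ x).le) (hlowt x)
    linarith [halo x]

end FK

end

section

open Real Set Filter Topology MeasureTheory

namespace FK

lemma root_ex (β : ℝ) (hβ : 0 < β) (k : ℕ) :
    ∃ t, 0 < t ∧ t < π / 2 ∧ (k * π + t) * sin t = β * cos t := by
  have hpi := Real.pi_pos
  have hc : ContinuousOn (fun t : ℝ => (k * π + t) * sin t - β * cos t) (Icc 0 (π/2)) := by fun_prop
  have h := intermediate_value_Ioo (by linarith : (0:ℝ) ≤ π/2) hc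
  have h0 : (0:ℝ) ∈ Ioo ((k * π + 0) * sin 0 - β * cos 0) ((k * π + π/2) * sin (π/2) - β * cos (π/2)) := by
    constructor
    · simp [hβ]
    · simp; positivity
  obtain ⟨t, ht, h1⟩ := h h0
  exact ⟨t, ht.1, ht.2, by simpa [sub_eq_zero] using h1⟩

lemma root_uniq {β : ℝ} (hβ : 0 < β) (k : ℕ) {t s : ℝ} (ht : 0 ≤ t) (hts : t < s) (hs : s < π / 2)
    (h1 : (k * π + t) * sin t = β * cos t) (h2 : (k * π + s) * sin s = β * cos s) : False := by
  have hpi := Real.pi_pos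
  have a1 : sin t < sin s := Real.sin_lt_sin_of_lt_of_le_pi_div_two (by linarith) hs.le hts
  have a2 : cos s < cos t := Real.cos_lt_cos_of_nonneg_of_le_pi_div_two ht hs.le hts
  have a3 : 0 ≤ sin t := Real.sin_nonneg_of_nonneg_of_le_pi ht (by linarith)
  have a4 : (k * π + t) * sin t ≤ (k * π + s) * sin s := by
    have : 0 ≤ k * π + t := by positivity
    exact mul_le_mul (by linarith) a1.le a3 (by linarith)
  have a5 := mul_lt_mul_of_pos_left a2 hβ
  linarith

/-- spectrum -/
noncomputable def rt (β : ℝ) (hβ : 0 < β) (k : ℕ) : ℝ := k * π + (root_ex β hβ k).choose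

lemma rt_gt {β : ℝ} (hβ : 0 < β) (k : ℕ) : k * π < rt β hβ k := by
  have := (root_ex β hβ k).choose_spec.1
  unfold rt; linarith
lemma rt_lt {β : ℝ} (hβ : 0 < β) (k : ℕ) : rt β hβ k < k * π + π / 2 := by
  have := (root_ex β hβ k).choose_spec.2.1
  unfold rt; linarith

lemma neg_one_sq_pow (k : ℕ) : ((-1:ℝ)^k)^2 = 1 := by
  rw [← pow_mul, mul_comm, pow_mul]; norm_num

lemma trig_eq {β : ℝ} (k : ℕ) (t : ℝ) :
    (k * π + t) * sin (k * π + t) = β * cos (k * π + t) ↔ (k * π + t) * sin t = β * cos t := by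
  have h1 : sin (k * π + t) = (-1)^k * sin t := by rw [add_comm, Real.sin_add_nat_mul_pi]
  have h2 : cos (k * π + t) = (-1)^k * cos t := by rw [add_comm, Real.cos_add_nat_mul_pi]
  rw [h1, h2]
  have h3 := neg_one_sq_pow k
  constructor
  · intro h
    linear_combination (-1)^k * h - ((k * π + t) * sin t - β * cos t) * h3
  · intro h
    rw [show (k * π + t) * ((-1)^k * sin t) = (-1:ℝ)^k * ((k * π + t) * sin t) by ring, h]; ring

lemma rt_eq {β : ℝ} (hβ : 0 < β) (k : ℕ) : rt β hβ k * sin (rt β hβ k) = β * cos (rt β hβ k) := by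
  have := (root_ex β hβ k).choose_spec.2.2
  unfold rt
  rwa [trig_eq]

lemma rt_pos {β : ℝ} (hβ : 0 < β) (k : ℕ) : 0 < rt β hβ k := by
  have := rt_gt hβ k
  have : 0 ≤ k * π := by positivity
  linarith

lemma rt_all {β : ℝ} (hβ : 0 < β) {w : ℝ} (hw : 0 < w) (h : w * sin w = β * cos w) :
    ∃ k, w = rt β hβ k := by
  have hpi := Real.pi_pos
  set k := ⌊w / π⌋₊ with hk
  have h1 : (k:ℝ) ≤ w / π := Nat.floor_le (by positivity)
  have h2 : w / π < k + 1 := Nat.lt_floor_add_one _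
  rw [le_div_iff₀ hpi] at h1
  rw [div_lt_iff₀ hpi] at h2
  refine ⟨k, ?_⟩
  clear_value k
  obtain ⟨t, rfl⟩ : ∃ t, w = k * π + t := ⟨w - k * π, by ring⟩
  rw [trig_eq] at h
  have ht : 0 ≤ t := by linarith
  have ht2 : t < π / 2 := by
    by_contra hc
    push Not at hc
    have : cos t ≤ 0 := Real.cos_nonpos_of_pi_div_two_le_of_le hc (by linarith)
    have : 0 < sin t := Real.sin_pos_of_pos_of_lt_pi (by linarith) (by linarith)
    have : 0 < (k * π + t) * sin t := by positivity
    nlinarith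
  have hh := (root_ex β hβ k).choose_spec
  unfold rt
  generalize (root_ex β hβ k).choose = s at hh
  rcases lt_trichotomy t s with hl | rfl | hl
  · exact (root_uniq hβ k ht hl hh.2.1 h hh.2.2).elim
  · rfl
  · exact (root_uniq hβ k hh.1.le hl ht2 hh.2.2 h).elim

lemma rt_inj {β : ℝ} (hβ : 0 < β) {k n : ℕ} (h : k < n) : rt β hβ k < rt β hβ n := by
  have h1 := rt_lt hβ k
  have h2 := rt_gt hβ n
  have : (k:ℝ) + 1 ≤ n := by exact_mod_cast h
  nlinarith [Real.pi_pos]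

/-- characteristic function -/
noncomputable def DD (β : ℝ) (z : ℂ) : ℂ := z * Complex.sin z - β * Complex.cos z

lemma DD_zero_real {β : ℝ} (hβ : 0 < β) {z : ℂ} (h : DD β z = 0) : z.im = 0 := by
  obtain ⟨a, b⟩ := z
  have e : (⟨a, b⟩ : ℂ) = a + b * Complex.I := by apply Complex.ext <;> simp
  rw [DD, e, Complex.sin_add_mul_I, Complex.cos_add_mul_I] at h
  simp only [← Complex.ofReal_sin, ← Complex.ofReal_cos, ← Complex.ofReal_sinh, ← Complex.ofReal_cosh] at h
  have hr := congrArg Complex.re h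
  have hi := congrArg Complex.im h
  simp [-Complex.ofReal_sin, -Complex.ofReal_cos, -Complex.ofReal_sinh, -Complex.ofReal_cosh] at hr hi
  have key : (a^2+b^2) * (sinh b * cosh b) * (cos a ^ 2 + sin a ^ 2)
      = - β * b * ((cos a * cosh b)^2 + (sin a * sinh b)^2) := by
    linear_combination (a*cos a*cosh b + b*sin a*sinh b)*hi + (a*sin a*sinh b - b*cos a*cosh b)*hr
  rw [Real.cos_sq_add_sin_sq, mul_one] at key
  show b = 0
  have hc := Real.cosh_pos b
  have hQ : 0 ≤ (cos a * cosh b)^2 + (sin a * sinh b)^2 := by positivity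
  rcases lt_trichotomy b 0 with hb | hb | hb
  · have h1 : sinh b < 0 := Real.sinh_neg_iff.2 hb
    have h2 : 0 < a^2 + b^2 := by nlinarith
    have h3 : (a^2+b^2) * (sinh b * cosh b) < 0 := mul_neg_of_pos_of_neg h2 (mul_neg_of_neg_of_pos h1 hc)
    have h4 : 0 ≤ - β * b * ((cos a * cosh b)^2 + (sin a * sinh b)^2) :=
      mul_nonneg (by nlinarith) hQ
    linarith
  · exact hb
  · have h1 : 0 < sinh b := Real.sinh_pos_iff.2 hb
    have h3 : 0 < (a^2+b^2) * (sinh b * cosh b) := by positivity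
    have h4 : 0 ≤ β * b * ((cos a * cosh b)^2 + (sin a * sinh b)^2) := by positivity
    linarith

/-- cosine transform -/
noncomputable def FF (h : ℝ → ℝ) (z : ℂ) : ℂ := ∫ y in (0:ℝ)..1, (h y : ℂ) * Complex.cos (z * y)

lemma norm_cos_le (z : ℂ) : ‖Complex.cos z‖ ≤ cosh z.im := by
  rw [Complex.cos]
  rw [norm_div]
  have h1 : ‖Complex.exp (z * Complex.I)‖ = exp (-z.im) := by
    rw [Complex.norm_exp]; simp
  have h2 : ‖Complex.exp (-z * Complex.I)‖ = exp (z.im) := by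
    rw [Complex.norm_exp]; simp
  have := norm_add_le (Complex.exp (z * Complex.I)) (Complex.exp (-z * Complex.I))
  rw [h1, h2] at this
  rw [Real.cosh_eq]
  simp only [Complex.norm_ofNat]
  linarith

lemma norm_sin_le (z : ℂ) : ‖Complex.sin z‖ ≤ cosh z.im := by
  have := norm_cos_le (π/2 - z)
  rw [Complex.cos_pi_div_two_sub] at this
  simpa using this

lemma FF_diff {h : ℝ → ℝ} (hh : Continuous h) : Differentiable ℂ (FF h) := by
  intro z0
  obtain ⟨M, hM⟩ := (isCompact_Icc (a := (0:ℝ)) (b := 1)).exists_bound_of_continuousOn hh.continuousOn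
  have key := intervalIntegral.hasDerivAt_integral_of_dominated_loc_of_deriv_le (𝕜 := ℂ) (μ := volume) (a := (0:ℝ)) (b := 1)
    (F := fun (z:ℂ) (y:ℝ) => (h y : ℂ) * Complex.cos (z * y))
    (F' := fun (z:ℂ) (y:ℝ) => (h y : ℂ) * (-Complex.sin (z * y) * y))
    (x₀ := z0) (s := Metric.ball z0 1) (bound := fun _ => M * cosh (|z0.im| + 1))
    (Metric.ball_mem_nhds z0 one_pos)
    (Eventually.of_forall fun z => by
      apply Continuous.aestronglyMeasurable; fun_prop)
    (by apply Continuous.intervalIntegrable; fun_prop)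
    (by apply Continuous.aestronglyMeasurable; fun_prop)
    (Eventually.of_forall fun y hy z hz => by
      rw [uIoc_of_le zero_le_one] at hy
      have b1 := hM y ⟨hy.1.le, hy.2⟩
      have b2 := norm_sin_le (z * y)
      have b3 : |(z * y).im| ≤ |z0.im| + 1 := by
        have e1 : (z * (y:ℂ)).im = z.im * y := by simp
        have e2 : |z.im - z0.im| ≤ 1 := by
          have := Complex.abs_im_le_norm (z - z0)
          rw [Complex.sub_im] at this
          exact this.trans (by rw [← dist_eq_norm]; exact (Metric.mem_ball.1 hz).le)
        rw [e1, abs_mul, abs_of_pos hy.1]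
        have e3 : |z.im| ≤ |z0.im| + 1 := by
          have := abs_sub_abs_le_abs_sub z.im z0.im
          linarith
        nlinarith [abs_nonneg z.im, hy.1, hy.2]
      have b4 : cosh (z*y).im ≤ cosh (|z0.im| + 1) := by
        rw [Real.cosh_le_cosh, abs_of_nonneg (by positivity : 0 ≤ |z0.im|+1)]; exact b3
      rw [norm_mul, norm_mul, norm_neg]
      have b5 : ‖(y:ℂ)‖ ≤ 1 := by
        rw [Complex.norm_real, norm_eq_abs, abs_of_pos hy.1]; exact hy.2
      have b6 : ‖(h y:ℂ)‖ ≤ M := by rw [Complex.norm_real]; exact b1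
      have b7 : ‖Complex.sin (z*y)‖ * ‖(y:ℂ)‖ ≤ cosh (|z0.im| + 1) := by
        calc _ ≤ ‖Complex.sin (z*y)‖ * 1 := by gcongr
          _ ≤ _ := by linarith
      exact mul_le_mul b6 b7 (by positivity) ((norm_nonneg _).trans b6))
    (by apply Continuous.intervalIntegrable; fun_prop)
    (Eventually.of_forall fun y hy z hz => by
      have := ((hasDerivAt_id z).mul_const (y:ℂ)).ccos
      have := this.const_mul (h y : ℂ)
      refine this.congr_deriv ?_
      simp)
  exact key.2.differentiableAt

lemma FF_bound {h : ℝ → ℝ} (hh : Continuous h) : ∃ M, 0 ≤ M ∧ ∀ z, ‖FF h z‖ ≤ M * cosh z.im := by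
  obtain ⟨M, hM⟩ := (isCompact_Icc (a := (0:ℝ)) (b := 1)).exists_bound_of_continuousOn hh.continuousOn
  refine ⟨M, (norm_nonneg _).trans (hM 0 (by simp)), fun z => ?_⟩
  have := intervalIntegral.norm_integral_le_of_norm_le_const (a := (0:ℝ)) (b := 1) (C := M * cosh z.im)
    (f := fun y : ℝ => (h y : ℂ) * Complex.cos (z * y)) ?_
  · simpa [FF] using this
  · intro y hy
    rw [uIoc_of_le zero_le_one] at hy
    have b1 := hM y ⟨hy.1.le, hy.2⟩
    rw [norm_mul, Complex.norm_real]
    refine mul_le_mul b1 ((norm_cos_le _).trans ?_) (norm_nonneg _) ((norm_nonneg _).trans b1)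
    rw [Real.cosh_le_cosh]
    have e1 : (z * (y:ℂ)).im = z.im * y := by simp
    rw [e1, abs_mul, abs_of_pos hy.1]
    nlinarith [abs_nonneg z.im, hy.1, hy.2]


lemma DD_diff (β : ℝ) : Differentiable ℂ (DD β) := by unfold DD; fun_prop

lemma DD_deriv (β : ℝ) (z : ℂ) : deriv (DD β) z = Complex.sin z + z * Complex.cos z + β * Complex.sin z := by
  have h := ((hasDerivAt_id z).mul (Complex.hasDerivAt_sin z)).sub ((Complex.hasDerivAt_cos z).const_mul (β:ℂ))
  have h2 : HasDerivAt (DD β) (Complex.sin z + z * Complex.cos z + β * Complex.sin z) z :=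
    h.congr_deriv (by simp)
  exact h2.deriv

lemma DD_simple {β : ℝ} (hβ : 0 < β) {z : ℂ} (h : DD β z = 0) : deriv (DD β) z ≠ 0 := by
  intro hd
  have him := DD_zero_real hβ h
  obtain ⟨w, rfl⟩ : ∃ w : ℝ, z = w := ⟨z.re, by apply Complex.ext <;> simp [him]⟩
  rw [DD_deriv] at hd
  rw [DD] at h
  have h1 : w * sin w - β * cos w = 0 := by exact_mod_cast h
  have h2 : sin w + w * cos w + β * sin w = 0 := by exact_mod_cast hd
  have h3 : ((1+β)*β + w^2) * cos w = 0 := by linear_combination w * h2 - (1+β) * h1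
  have h4 : cos w = 0 := by
    rcases mul_eq_zero.1 h3 with h | h
    · nlinarith [sq_nonneg w]
    · exact h
  have h5 : (1 + β) * sin w = 0 := by rw [h4] at h2; linarith
  have h6 : sin w = 0 := by
    rcases mul_eq_zero.1 h5 with h | h
    · linarith
    · exact h
  have := Real.sin_sq_add_cos_sq w
  rw [h4, h6] at this; norm_num at this

open Classical in
/-- the entire quotient -/
noncomputable def QQ (β : ℝ) (F : ℂ → ℂ) (z : ℂ) : ℂ :=
  if DD β z = 0 then deriv F z / deriv (DD β) z else F z / DD β z

lemma QQ_diff {β : ℝ} (hβ : 0 < β) {F : ℂ → ℂ} (hF : Differentiable ℂ F)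
    (h0 : ∀ z, DD β z = 0 → F z = 0) : Differentiable ℂ (QQ β F) := by
  intro w
  by_cases hw : DD β w = 0
  · have d1 : DifferentiableAt ℂ (dslope F w) w :=
      ((Complex.differentiableOn_dslope (s := univ) (c := w) Filter.univ_mem).2 hF.differentiableOn).differentiableAt
        Filter.univ_mem
    have d2 : DifferentiableAt ℂ (dslope (DD β) w) w :=
      ((Complex.differentiableOn_dslope (s := univ) (c := w) Filter.univ_mem).2
        (DD_diff β).differentiableOn).differentiableAt Filter.univ_mem
    have hne : dslope (DD β) w w ≠ 0 := by rw [dslope_same]; exact DD_simple hβ hw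
    have hev := d2.continuousAt.eventually_ne hne
    refine (d1.div d2 hne).congr_of_eventuallyEq ?_
    filter_upwards [hev] with z hz
    by_cases hzw : z = w
    · subst hzw
      simp [QQ, hw]
    · have e1 := sub_smul_dslope F w z
      have e2 := sub_smul_dslope (DD β) w z
      rw [hw, sub_zero, smul_eq_mul] at e2
      rw [h0 w hw, sub_zero, smul_eq_mul] at e1
      have hzw' : z - w ≠ 0 := sub_ne_zero.2 hzw
      have hD : DD β z ≠ 0 := by rw [← e2]; exact mul_ne_zero hzw' hz
      simp only [QQ, hD, if_false, Pi.div_apply]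
      rw [← e1, ← e2, mul_div_mul_left _ _ hzw']
  · have hev := (DD_diff β).continuous.continuousAt.eventually_ne hw
    refine ((hF w).div (DD_diff β w) hw).congr_of_eventuallyEq ?_
    filter_upwards [hev] with z hz
    simp [QQ, hz]

lemma norm_sin_sq (a b : ℝ) : ‖Complex.sin (a + b * Complex.I)‖^2 = sin a ^2 + sinh b ^2 := by
  rw [Complex.sin_add_mul_I]
  simp only [← Complex.ofReal_sin, ← Complex.ofReal_cos, ← Complex.ofReal_sinh, ← Complex.ofReal_cosh,
    ← Complex.ofReal_mul]
  rw [← Complex.normSq_eq_norm_sq, Complex.normSq_add_mul_I]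
  have := Real.cosh_sq b
  have h2 := Real.sin_sq_add_cos_sq a
  linear_combination sin a ^2 * this + sinh b ^2 * h2

lemma DD_ge {β : ℝ} (hβ : 0 < β) (N : ℕ) {z : ℂ} {R : ℝ} (hR : R = N * π + π / 2)
    (hz : (|z.re| = R) ∨ (|z.im| = R)) :
    (R / 2 - β) * cosh z.im ≤ ‖DD β z‖ := by
  have hpi := Real.pi_gt_three
  have hN : (0:ℝ) ≤ N := Nat.cast_nonneg N
  have hR1 : 1 ≤ R := by rw [hR]; nlinarith
  have hnz : R ≤ ‖z‖ := by
    rcases hz with h | h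
    · rw [← h]; exact Complex.abs_re_le_norm z
    · rw [← h]; exact Complex.abs_im_le_norm z
  have hs : cosh z.im / 2 ≤ ‖Complex.sin z‖ := by
    have e := norm_sin_sq z.re z.im
    rw [Complex.re_add_im] at e
    have hc := Real.cosh_sq z.im
    have hcp := Real.cosh_pos z.im
    refine abs_le_of_sq_le_sq' ?_ (norm_nonneg _) |>.2
    rw [e]
    rcases hz with h | h
    · have : sin z.re ^ 2 = 1 := by
        have : cos z.re = 0 := by
          rw [← Real.cos_abs, h, hR, add_comm, Real.cos_add_nat_mul_pi, Real.cos_pi_div_two, mul_zero]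
        have h2 := Real.sin_sq_add_cos_sq z.re
        rw [this] at h2; linarith
      nlinarith
    · have h1 : 1 ≤ sinh z.im ^ 2 := by
        have h2 : R ≤ sinh R := Real.self_le_sinh_iff.2 (by linarith)
        rw [← sq_abs, Real.abs_sinh, h]
        nlinarith
      nlinarith [sq_nonneg (sin z.re)]
  have hcp := Real.cosh_pos z.im
  have h1 : ‖z * Complex.sin z‖ - ‖(β:ℂ) * Complex.cos z‖ ≤ ‖DD β z‖ := norm_sub_norm_le _ _
  rw [norm_mul, norm_mul, Complex.norm_real, norm_eq_abs, abs_of_pos hβ] at h1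
  have h2 := mul_le_mul hnz hs (by positivity) (norm_nonneg _)
  have h3 := mul_le_mul_of_nonneg_left (norm_cos_le z) hβ.le
  nlinarith

lemma FF_zero {β : ℝ} (hβ : 0 < β) {h : ℝ → ℝ} (hh : Continuous h)
    (h0 : ∀ z, DD β z = 0 → FF h z = 0) (z : ℂ) : FF h z = 0 := by
  have hq := QQ_diff hβ (FF_diff hh) h0
  obtain ⟨M, hM0, hM⟩ := FF_bound hh
  have key : QQ β (FF h) z = 0 := by
    rw [← norm_le_zero_iff]
    have hR : Tendsto (fun N : ℕ => (N:ℝ) * π + π / 2) atTop atTop :=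
      tendsto_atTop_add_const_right _ _ (tendsto_natCast_atTop_atTop.atTop_mul_const Real.pi_pos)
    have hlim : Tendsto (fun N : ℕ => M / (((N:ℝ) * π + π / 2) / 2 - β)) atTop (𝓝 0) := by
      refine Tendsto.div_atTop tendsto_const_nhds ?_
      exact tendsto_atTop_add_const_right _ _ (hR.atTop_div_const two_pos)
    refine ge_of_tendsto hlim ?_
    filter_upwards [hR.eventually_gt_atTop (2*β), hR.eventually_gt_atTop ‖z‖] with N hN1 hN2
    set R := (N:ℝ) * π + π / 2 with hRdef
    have hRpos : 0 < R := (norm_nonneg z).trans_lt hN2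
    have hden : 0 < R / 2 - β := by linarith
    have hzre := (Complex.abs_re_le_norm z).trans_lt hN2
    have hzim := (Complex.abs_im_le_norm z).trans_lt hN2
    rw [abs_lt] at hzre hzim
    refine Complex.norm_le_of_forall_mem_frontier_norm_le (U := Ioo (-R) R ×ℂ Ioo (-R) R)
      ((Metric.isBounded_Ioo _ _).reProdIm (Metric.isBounded_Ioo _ _)) hq.diffContOnCl ?_
      (subset_closure ⟨hzre, hzim⟩)
    intro w hw
    rw [Complex.frontier_reProdIm] at hw
    have hw' : |w.re| = R ∨ |w.im| = R := by
      rw [frontier_Ioo (by linarith)] at hw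
      rcases hw with ⟨_, hw⟩ | ⟨hw, _⟩
      · right
        rcases hw with hw | hw
        · rw [hw, abs_neg, abs_of_pos hRpos]
        · rw [mem_singleton_iff.1 hw, abs_of_pos hRpos]
      · left
        rcases hw with hw | hw
        · rw [hw, abs_neg, abs_of_pos hRpos]
        · rw [mem_singleton_iff.1 hw, abs_of_pos hRpos]
    have hge := DD_ge hβ N hRdef hw'
    have hcp := Real.cosh_pos w.im
    have hD : 0 < ‖DD β w‖ := lt_of_lt_of_le (by positivity) hge
    have hD' : DD β w ≠ 0 := norm_pos_iff.1 hD
    simp only [QQ, hD', if_false, norm_div]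
    rw [div_le_div_iff₀ hD hden]
    calc ‖FF h w‖ * (R/2 - β) ≤ M * cosh w.im * (R/2-β) := by gcongr; exact hM w
      _ = M * ((R/2-β) * cosh w.im) := by ring
      _ ≤ _ := by gcongr
  by_cases hz : DD β z = 0
  · exact h0 z hz
  · simp only [QQ, hz, if_false] at key
    rcases div_eq_zero_iff.1 key with h | h
    · exact h
    · exact absurd h hz

lemma FF_real (h : ℝ → ℝ) (w : ℝ) : FF h w = ((∫ y in (0:ℝ)..1, h y * cos (w * y) : ℝ) : ℂ) := by
  rw [FF, ← intervalIntegral.integral_ofReal]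
  congr 1; ext y; push_cast; rfl

open FourierTransform in
lemma cos_inj {h : ℝ → ℝ} (hh : Continuous h)
    (h0 : ∀ w : ℝ, ∫ y in (0:ℝ)..1, h y * cos (w * y) = 0) : ∀ y ∈ Icc (0:ℝ) 1, h y = 0 := by
  set f : ℝ → ℂ := (Ioc (-1) 1).indicator (fun v : ℝ => (h |v| : ℂ)) with hf
  have hcont : Continuous (fun v : ℝ => (h |v| : ℂ)) := by fun_prop
  have hint : Integrable f := by
    rw [hf, integrable_indicator_iff measurableSet_Ioc]
    exact (hcont.integrableOn_Icc).mono_set Ioc_subset_Icc_self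
  have hF : 𝓕 f = 0 := by
    ext w
    rw [Real.fourier_eq']
    have e1 : (fun v : ℝ => Complex.exp (↑(-2 * π * inner ℝ v w) * Complex.I) • f v)
        = (Ioc (-1) 1).indicator (fun v : ℝ => Complex.exp (↑(-2 * π * (v*w)) * Complex.I) * (h |v| : ℂ)) := by
      ext v
      by_cases hv : v ∈ Ioc (-1:ℝ) 1
      · simp [hf, hv, mul_comm]
      · simp [hf, hv]
    rw [e1, integral_indicator measurableSet_Ioc, ← intervalIntegral.integral_of_le (by norm_num)]
    set g : ℝ → ℂ := fun v : ℝ => Complex.exp (↑(-2 * π * (v*w)) * Complex.I) * (h |v| : ℂ) with hg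
    have gc : Continuous g := by fun_prop
    rw [← intervalIntegral.integral_add_adjacent_intervals (b := 0) (gc.intervalIntegrable _ _)
      (gc.intervalIntegrable _ _)]
    have e2 : ∫ v in (-1:ℝ)..0, g v = ∫ v in (0:ℝ)..1, g (-v) := by
      rw [intervalIntegral.integral_comp_neg]; simp
    rw [e2, ← intervalIntegral.integral_add (Continuous.intervalIntegrable (by fun_prop) _ _)
      (gc.intervalIntegrable _ _)]
    have e3 : ∫ v in (0:ℝ)..1, (g (-v) + g v) = ∫ v in (0:ℝ)..1, ((2 * (h v * cos (2 * π * w * v)) : ℝ) : ℂ) := by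
      refine intervalIntegral.integral_congr fun v hv => ?_
      rw [uIcc_of_le zero_le_one] at hv
      simp only [hg, abs_neg, abs_of_nonneg hv.1]
      push_cast
      rw [Complex.cos]
      have a1 : (-2 * (π:ℂ) * (-v * w) * Complex.I) = 2 * π * w * v * Complex.I := by ring
      have a2 : (-2 * (π:ℂ) * (v * w) * Complex.I) = -(2 * π * w * v) * Complex.I := by ring
      rw [a1, a2]; ring
    rw [e3, intervalIntegral.integral_ofReal, intervalIntegral.integral_const_mul, h0]
    simp
  have hz : ∀ y ∈ Ioo (0:ℝ) 1, h y = 0 := by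
    intro y hy
    have hev : f =ᶠ[𝓝 y] (fun v : ℝ => (h |v| : ℂ)) := by
      filter_upwards [Ioo_mem_nhds hy.1 hy.2] with v hv
      rw [hf, indicator_of_mem]
      exact ⟨by linarith [hv.1], hv.2.le⟩
    have hca : ContinuousAt f y := hcont.continuousAt.congr hev.symm
    have hI : Integrable (𝓕 f) := by rw [hF]; exact integrable_zero _ _ _
    have := hint.fourierInv_fourier_eq hI hca
    rw [hF, hev.eq_of_nhds, abs_of_pos hy.1] at this
    rw [Real.fourierInv_eq] at this
    simp at this
    exact_mod_cast this.symm
  have hcl : IsClosed {y | h y = 0} := isClosed_eq hh continuous_const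
  have : closure (Ioo (0:ℝ) 1) ⊆ {y | h y = 0} := hcl.closure_subset_iff.2 hz
  rw [closure_Ioo (by norm_num)] at this
  exact this

lemma completeness {β : ℝ} (hβ : 0 < β) {h : ℝ → ℝ} (hh : Continuous h)
    (h0 : ∀ k, ∫ y in (0:ℝ)..1, h y * cos (rt β hβ k * y) = 0) : ∀ y ∈ Icc (0:ℝ) 1, h y = 0 := by
  refine cos_inj hh fun w => ?_
  have := FF_zero hβ hh ?_ w
  · rw [FF_real] at this; exact_mod_cast this
  · intro z hz
    have him := DD_zero_real hβ hz
    obtain ⟨w, rfl⟩ : ∃ w : ℝ, z = w := ⟨z.re, by apply Complex.ext <;> simp [him]⟩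
    rw [FF_real]
    rw [DD] at hz
    have h1 : w * sin w = β * cos w := by rw [← sub_eq_zero]; exact_mod_cast hz
    rcases lt_trichotomy w 0 with hw | rfl | hw
    · obtain ⟨k, hk⟩ := rt_all hβ (w := -w) (by linarith) (by simpa using h1)
      have := h0 k
      rw [← hk] at this
      simp only [neg_mul, Real.cos_neg] at this
      rw [this]; simp
    · simp at h1; linarith
    · obtain ⟨k, hk⟩ := rt_all hβ hw h1
      rw [hk, h0 k]; simp


lemma green {β : ℝ} (hβ : 0 < β) (k : ℕ) {g g' g'' : ℝ → ℝ} (h1 : ∀ y, HasDerivAt g (g' y) y)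
    (h2 : ∀ y, HasDerivAt g' (g'' y) y) (h3 : Continuous g'') :
    (∫ y in (0:ℝ)..1, g'' y * cos (rt β hβ k * y)) + rt β hβ k ^ 2 * (∫ y in (0:ℝ)..1, g y * cos (rt β hβ k * y))
      = (g' 1 + β * g 1) * cos (rt β hβ k) - g' 0 := by
  have hr := rt_eq hβ k
  set r := rt β hβ k
  have c1 : Continuous g := continuous_iff_continuousAt.2 fun y => (h1 y).continuousAt
  have c2 : Continuous g' := continuous_iff_continuousAt.2 fun y => (h2 y).continuousAt
  have hd : ∀ y ∈ uIcc (0:ℝ) 1, HasDerivAt (fun y => g' y * cos (r * y) + r * (g y * sin (r * y)))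
      (g'' y * cos (r * y) + r^2 * (g y * cos (r * y))) y := by
    intro y _
    have hc : HasDerivAt (fun y => cos (r * y)) (-sin (r * y) * r) y := by
      simpa using ((hasDerivAt_id y).const_mul r).cos
    have hs : HasDerivAt (fun y => sin (r * y)) (cos (r * y) * r) y := by
      simpa using ((hasDerivAt_id y).const_mul r).sin
    refine (((h2 y).mul hc).add (((h1 y).mul hs).const_mul r)).congr_deriv ?_
    ring
  have := intervalIntegral.integral_eq_sub_of_hasDerivAt hd (Continuous.intervalIntegrable (by fun_prop) _ _)
  rw [intervalIntegral.integral_add (Continuous.intervalIntegrable (by fun_prop) _ _)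
    (Continuous.intervalIntegrable (by fun_prop) _ _), intervalIntegral.integral_const_mul] at this
  rw [this]
  simp
  linear_combination g 1 * hr

lemma cos_d (r y : ℝ) : HasDerivAt (fun y => cos (r * y)) (-(r * sin (r * y))) y := by
  have : HasDerivAt (fun y => cos (r * y)) (-sin (r * y) * r) y := by
    simpa using ((hasDerivAt_id y).const_mul r).cos
  exact this.congr_deriv (by ring)

lemma sin_d (r y : ℝ) : HasDerivAt (fun y => sin (r * y)) (r * cos (r * y)) y := by
  have : HasDerivAt (fun y => sin (r * y)) (cos (r * y) * r) y := by
    simpa using ((hasDerivAt_id y).const_mul r).sin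
  exact this.congr_deriv (by ring)

lemma orth {β : ℝ} (hβ : 0 < β) {k n : ℕ} (hkn : k ≠ n) :
    ∫ y in (0:ℝ)..1, cos (rt β hβ n * y) * cos (rt β hβ k * y) = 0 := by
  have h := green hβ k (cos_d (rt β hβ n))
    (g'' := fun y => - rt β hβ n ^ 2 * cos (rt β hβ n * y))
    (fun y => (((sin_d (rt β hβ n) y).const_mul (rt β hβ n)).neg).congr_deriv (by ring)) (by fun_prop)
  have hr := rt_eq hβ n
  simp only [mul_assoc, intervalIntegral.integral_const_mul] at h
  simp at h
  rw [hr] at h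
  simp at h
  have h4 : (rt β hβ k ^ 2 - rt β hβ n ^ 2) * (∫ y in (0:ℝ)..1, cos (rt β hβ n * y) * cos (rt β hβ k * y)) = 0 := by
    linear_combination h
  rcases mul_eq_zero.1 h4 with h5 | h5
  · exfalso
    have p1 := rt_pos hβ k
    have p2 := rt_pos hβ n
    have : rt β hβ k = rt β hβ n := by
      rw [sub_eq_zero] at h5
      exact (pow_left_inj₀ p1.le p2.le two_ne_zero).1 h5
    rcases lt_or_gt_of_ne hkn with hl | hl
    · exact absurd this (rt_inj hβ hl).ne
    · exact absurd this (rt_inj hβ hl).ne'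
  · exact h5

/-- normalisation -/
noncomputable def NN (β : ℝ) (hβ : 0 < β) (k : ℕ) : ℝ :=
  ∫ y in (0:ℝ)..1, cos (rt β hβ k * y) * cos (rt β hβ k * y)

lemma int_cos_sq {r : ℝ} (hr : 0 < r) : ∫ y in (0:ℝ)..1, cos (r * y) * cos (r * y) = 1/2 + sin r * cos r / (2 * r) := by
  have hd : ∀ y ∈ uIcc (0:ℝ) 1, HasDerivAt (fun y => y / 2 + sin (r*y) * cos (r*y) / (2*r)) (cos (r * y) * cos (r * y)) y := by
    intro y _
    refine (((hasDerivAt_id y).div_const 2).add (((sin_d r y).mul (cos_d r y)).div_const (2*r))).congr_deriv ?_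
    field_simp
    linear_combination - Real.sin_sq_add_cos_sq (r*y)
  rw [intervalIntegral.integral_eq_sub_of_hasDerivAt hd (Continuous.intervalIntegrable (by fun_prop) _ _)]
  simp

lemma int_cos_cube {r : ℝ} (hr : 0 < r) : ∫ y in (0:ℝ)..1, cos (r * y) * cos (r * y) * cos (r * y)
    = (sin r - sin r ^ 3 / 3) / r := by
  have hd : ∀ y ∈ uIcc (0:ℝ) 1, HasDerivAt (fun y => (sin (r*y) - sin (r*y)^3 / 3)/r) (cos (r * y) * cos (r * y) * cos (r * y)) y := by
    intro y _
    refine (((sin_d r y).sub (((sin_d r y).pow 3).div_const 3)).div_const r).congr_deriv ?_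
    field_simp
    push_cast
    linear_combination (-3 * cos (r*y)) * Real.sin_sq_add_cos_sq (r*y)
  rw [intervalIntegral.integral_eq_sub_of_hasDerivAt hd (Continuous.intervalIntegrable (by fun_prop) _ _)]
  simp

lemma NN_ge {β : ℝ} (hβ : 0 < β) (k : ℕ) : 1/2 ≤ NN β hβ k := by
  have hp := rt_pos hβ k
  have he := rt_eq hβ k
  rw [NN, int_cos_sq hp]
  have : 0 ≤ sin (rt β hβ k) * cos (rt β hβ k) := by
    have h1 : 0 ≤ rt β hβ k * (sin (rt β hβ k) * cos (rt β hβ k)) := by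
      rw [← mul_assoc, he]; nlinarith [sq_nonneg (cos (rt β hβ k))]
    exact nonneg_of_mul_nonneg_right h1 hp
  have : 0 ≤ sin (rt β hβ k) * cos (rt β hβ k) / (2 * rt β hβ k) := by positivity
  linarith

/-- coefficients -/
noncomputable def cf (β : ℝ) (hβ : 0 < β) (k n m : ℕ) : ℝ :=
  (∫ y in (0:ℝ)..1, cos (rt β hβ n * y) * cos (rt β hβ m * y) * cos (rt β hβ k * y)) / NN β hβ k

lemma rt_le {β : ℝ} (hβ : 0 < β) (k : ℕ) : rt β hβ k ≤ π * (k + 1) := by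
  have := rt_lt hβ k
  nlinarith [Real.pi_pos]

lemma rt_ge {β : ℝ} (hβ : 0 < β) (k : ℕ) : rt β hβ 0 * (k + 1) ≤ rt β hβ k := by
  rcases Nat.eq_zero_or_pos k with rfl | hk
  · simp
  · have h0 := rt_lt hβ 0
    have h1 := rt_gt hβ k
    have : (1:ℝ) ≤ k := by exact_mod_cast hk
    simp at h0
    nlinarith [Real.pi_pos]

lemma rt_gap {β : ℝ} (hβ : 0 < β) {k : ℕ} (hk : 1 ≤ k) :
    ((k:ℝ)+1)^2 ≤ rt β hβ k ^ 2 - rt β hβ 0 ^ 2 := by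
  have h0 := rt_lt hβ 0
  have h00 := rt_pos hβ 0
  have h1 := rt_gt hβ k
  have hk1 : (1:ℝ) ≤ k := by exact_mod_cast hk
  have hpi := Real.pi_gt_three
  simp at h0
  have a1 : (k*π)^2 ≤ rt β hβ k ^ 2 := by gcongr
  have a2 : rt β hβ 0 ^ 2 ≤ (π/2)^2 := by gcongr
  have a3 : (9:ℝ) ≤ π^2 := by nlinarith
  have a4 : ((k:ℝ)+1)^2 ≤ ((k:ℝ)^2 - 1/4) * 9 := by nlinarith
  have a5 : ((k:ℝ)^2 - 1/4) * 9 ≤ ((k:ℝ)^2 - 1/4) * π^2 := by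
    apply mul_le_mul_of_nonneg_left a3; nlinarith
  nlinarith

lemma abs_cos3 (a b c : ℝ) : |cos a * cos b * cos c| ≤ 1 := by
  rw [abs_mul, abs_mul]
  have h1 := abs_cos_le_one a
  have h2 := abs_cos_le_one b
  have h3 := abs_cos_le_one c
  exact mul_le_one₀ (mul_le_one₀ h1 (abs_nonneg _) h2) (abs_nonneg _) h3

lemma cf_bound {β : ℝ} (hβ : 0 < β) (k n m : ℕ) :
    |cf β hβ k n m| ≤ 2 * (β + 4 * π^2) / rt β hβ 0 ^ 2 * ((n+1)^2 * (m+1)^2 / ((k:ℝ)+1)^2) := by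
  have pn := rt_pos hβ n
  have pm := rt_pos hβ m
  have en := rt_eq hβ n
  have em := rt_eq hβ m
  have ln := rt_le hβ n
  have lm := rt_le hβ m
  have gk := rt_ge hβ k
  have p0 := rt_pos hβ 0
  have hN := NN_ge hβ k
  have h := green hβ k (g := fun y => cos (rt β hβ n * y) * cos (rt β hβ m * y))
    (g' := fun y => -(rt β hβ n * sin (rt β hβ n * y)) * cos (rt β hβ m * y)
      + cos (rt β hβ n * y) * -(rt β hβ m * sin (rt β hβ m * y)))
    (g'' := fun y => - (rt β hβ n ^ 2 + rt β hβ m ^ 2) * (cos (rt β hβ n * y) * cos (rt β hβ m * y))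
      + 2 * rt β hβ n * rt β hβ m * (sin (rt β hβ n * y) * sin (rt β hβ m * y)))
    (fun y => (cos_d _ y).mul (cos_d _ y))
    (fun y => by
      refine (((((sin_d (rt β hβ n) y).const_mul (rt β hβ n)).neg).mul (cos_d (rt β hβ m) y)).add
        ((cos_d (rt β hβ n) y).mul (((sin_d (rt β hβ m) y).const_mul (rt β hβ m)).neg))).congr_deriv ?_
      simp only [Pi.neg_apply]
      ring)
    (by fun_prop)
  rw [cf, abs_div, abs_of_pos (show 0 < NN β hβ k by linarith)]
  set I := ∫ y in (0:ℝ)..1, cos (rt β hβ n * y) * cos (rt β hβ m * y) * cos (rt β hβ k * y) with hI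
  have hJ : |∫ y in (0:ℝ)..1, (- (rt β hβ n ^ 2 + rt β hβ m ^ 2) * (cos (rt β hβ n * y) * cos (rt β hβ m * y))
      + 2 * rt β hβ n * rt β hβ m * (sin (rt β hβ n * y) * sin (rt β hβ m * y))) * cos (rt β hβ k * y)|
      ≤ (rt β hβ n + rt β hβ m)^2 := by
    have := intervalIntegral.norm_integral_le_of_norm_le_const (a := (0:ℝ)) (b := 1) (C := (rt β hβ n + rt β hβ m)^2)
      (f := fun y => (- (rt β hβ n ^ 2 + rt β hβ m ^ 2) * (cos (rt β hβ n * y) * cos (rt β hβ m * y))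
      + 2 * rt β hβ n * rt β hβ m * (sin (rt β hβ n * y) * sin (rt β hβ m * y))) * cos (rt β hβ k * y)) ?_
    · simpa using this
    · intro y _
      rw [norm_eq_abs, abs_mul]
      have b1 := abs_cos_le_one (rt β hβ k * y)
      have b2 : |cos (rt β hβ n * y) * cos (rt β hβ m * y)| ≤ 1 := by
        rw [abs_mul]; exact mul_le_one₀ (abs_cos_le_one _) (abs_nonneg _) (abs_cos_le_one _)
      have b3 : |sin (rt β hβ n * y) * sin (rt β hβ m * y)| ≤ 1 := by
        rw [abs_mul]; exact mul_le_one₀ (abs_sin_le_one _) (abs_nonneg _) (abs_sin_le_one _)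
      generalize cos (rt β hβ n * y) * cos (rt β hβ m * y) = X at *
      generalize sin (rt β hβ n * y) * sin (rt β hβ m * y) = Y at *
      have b4 : |-(rt β hβ n ^ 2 + rt β hβ m ^ 2) * X + 2 * rt β hβ n * rt β hβ m * Y| ≤ (rt β hβ n + rt β hβ m)^2 := by
        refine (abs_add_le _ _).trans ?_
        rw [abs_mul, abs_mul, abs_neg, abs_of_pos (by positivity : 0 < rt β hβ n ^ 2 + rt β hβ m ^ 2),
          abs_of_pos (by positivity : 0 < 2 * rt β hβ n * rt β hβ m)]
        have := mul_le_mul_of_nonneg_left b2 (by positivity : 0 ≤ rt β hβ n ^ 2 + rt β hβ m ^ 2)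
        have := mul_le_mul_of_nonneg_left b3 (by positivity : 0 ≤ 2 * rt β hβ n * rt β hβ m)
        linarith
      calc _ ≤ (rt β hβ n + rt β hβ m)^2 * 1 := mul_le_mul b4 b1 (abs_nonneg _) (by positivity)
        _ = _ := mul_one _
  generalize (∫ y in (0:ℝ)..1, (- (rt β hβ n ^ 2 + rt β hβ m ^ 2) * (cos (rt β hβ n * y) * cos (rt β hβ m * y))
      + 2 * rt β hβ n * rt β hβ m * (sin (rt β hβ n * y) * sin (rt β hβ m * y))) * cos (rt β hβ k * y)) = Jv at h hJ
  have hbd : rt β hβ k ^ 2 * I = -β * (cos (rt β hβ n) * cos (rt β hβ m) * cos (rt β hβ k)) - Jv := by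
    simp at h
    linear_combination h - cos (rt β hβ m) * cos (rt β hβ k) * en - cos (rt β hβ n) * cos (rt β hβ k) * em
  have hI1 : rt β hβ k ^ 2 * |I| ≤ β + (rt β hβ n + rt β hβ m)^2 := by
    have e : rt β hβ k ^ 2 * |I| = |rt β hβ k ^ 2 * I| := by rw [abs_mul, abs_of_nonneg (sq_nonneg (rt β hβ k))]
    rw [e, hbd]
    refine (abs_sub _ _).trans ?_
    rw [abs_mul, abs_neg, abs_of_pos hβ]
    have := mul_le_mul_of_nonneg_left (abs_cos3 (rt β hβ n) (rt β hβ m) (rt β hβ k)) hβ.le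
    linarith
  have hnm : (rt β hβ n + rt β hβ m)^2 ≤ 4 * π^2 * ((n+1)^2 * (m+1)^2) := by
    have a0 : (0:ℝ) ≤ n := Nat.cast_nonneg n
    have b0 : (0:ℝ) ≤ m := Nat.cast_nonneg m
    have : rt β hβ n + rt β hβ m ≤ 2 * π * ((n+1)*(m+1)) := by
      have : ((n:ℝ)+1)+(m+1) ≤ 2 * ((n+1)*(m+1)) := by nlinarith [mul_nonneg a0 b0]
      nlinarith [Real.pi_pos]
    calc _ ≤ (2 * π * ((n+1)*(m+1)))^2 := by gcongr
      _ = _ := by ring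
  have hβ1 : β ≤ β * (((n:ℝ)+1)^2 * (m+1)^2) := by
    have a0 : (1:ℝ) ≤ (n+1)^2 := one_le_pow₀ (by linarith [Nat.cast_nonneg (α := ℝ) n])
    have b0 : (1:ℝ) ≤ (m+1)^2 := one_le_pow₀ (by linarith [Nat.cast_nonneg (α := ℝ) m])
    have := one_le_mul_of_one_le_of_one_le a0 b0
    nlinarith
  have hk2 : (rt β hβ 0 * (k+1))^2 * |I| ≤ (β + 4 * π^2) * ((n+1)^2 * (m+1)^2) := by
    have : (rt β hβ 0 * (k+1))^2 ≤ rt β hβ k ^2 := by gcongr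
    have := mul_le_mul_of_nonneg_right this (abs_nonneg I)
    nlinarith
  calc |I| / NN β hβ k ≤ |I| / (1/2) := by gcongr
    _ = 2 * |I| := by ring
    _ = 2 * ((rt β hβ 0 * (k+1))^2 * |I|) / (rt β hβ 0 * (k+1))^2 := by field_simp
    _ ≤ 2 * ((β + 4 * π^2) * ((n+1)^2 * (m+1)^2)) / (rt β hβ 0 * (k+1))^2 := by gcongr
    _ = _ := by rw [mul_pow]; field_simp

lemma summable_sq : Summable (fun k : ℕ => 1 / ((k:ℝ)+1)^2) := by
  have h := (summable_nat_add_iff 1).2 (Real.summable_one_div_nat_pow.2 (by norm_num : 1 < 2))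
  simpa using h

lemma expansion {β : ℝ} (hβ : 0 < β) (n m : ℕ) : ∀ y ∈ Icc (0:ℝ) 1,
    HasSum (fun k => cf β hβ k n m * cos (rt β hβ k * y)) (cos (rt β hβ n * y) * cos (rt β hβ m * y)) := by
  set K := 2 * (β + 4 * π^2) / rt β hβ 0 ^ 2 * ((n+1)^2 * (m+1)^2) with hK
  have hb : ∀ k y, ‖cf β hβ k n m * cos (rt β hβ k * y)‖ ≤ K * (1 / ((k:ℝ)+1)^2) := by
    intro k y
    rw [norm_mul]
    have h1 := cf_bound hβ k n m
    have h2 := abs_cos_le_one (rt β hβ k * y)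
    rw [norm_eq_abs, norm_eq_abs]
    calc _ ≤ |cf β hβ k n m| * 1 := by gcongr
      _ ≤ _ := by rw [mul_one]; refine h1.trans (le_of_eq ?_); rw [hK]; ring
  have hs : Summable (fun k : ℕ => K * (1 / ((k:ℝ)+1)^2)) := summable_sq.mul_left K
  have hsum : ∀ y, Summable (fun k => cf β hβ k n m * cos (rt β hβ k * y)) :=
    fun y => Summable.of_norm_bounded hs (fun k => hb k y)
  have hcont : Continuous (fun y => ∑' k, cf β hβ k n m * cos (rt β hβ k * y)) :=
    continuous_tsum (fun k => by fun_prop) hs (fun k y => hb k y)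
  have hz := completeness hβ (h := fun y => cos (rt β hβ n * y) * cos (rt β hβ m * y)
      - ∑' k, cf β hβ k n m * cos (rt β hβ k * y)) (by fun_prop) ?_
  · intro y hy
    have := hz y hy
    rw [sub_eq_zero] at this
    rw [this]
    exact (hsum y).hasSum
  · intro j
    simp only [sub_mul]
    rw [intervalIntegral.integral_sub (Continuous.intervalIntegrable (by fun_prop) _ _)
      (Continuous.intervalIntegrable (by fun_prop) _ _), sub_eq_zero]
    have hN : NN β hβ j ≠ 0 := by have := NN_ge hβ j; linarith
    have e1 : ∫ y in (0:ℝ)..1, cos (rt β hβ n * y) * cos (rt β hβ m * y) * cos (rt β hβ j * y)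
        = cf β hβ j n m * NN β hβ j := by
      rw [cf, div_mul_cancel₀ _ hN]
    rw [e1]
    have e2 := intervalIntegral.hasSum_integral_of_dominated_convergence (a := (0:ℝ)) (b := 1) (μ := volume)
      (F := fun k y => cf β hβ k n m * cos (rt β hβ k * y) * cos (rt β hβ j * y))
      (f := fun y => (∑' k, cf β hβ k n m * cos (rt β hβ k * y)) * cos (rt β hβ j * y))
      (fun k _ => K * (1 / ((k:ℝ)+1)^2))
      (fun k => Continuous.aestronglyMeasurable (by fun_prop))
      (fun k => Eventually.of_forall fun y _ => by
        rw [norm_mul]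
        have h2 := abs_cos_le_one (rt β hβ j * y)
        calc _ ≤ ‖cf β hβ k n m * cos (rt β hβ k * y)‖ * 1 := by gcongr; exact h2
          _ ≤ _ := by rw [mul_one]; exact hb k y)
      (Eventually.of_forall fun y _ => hs)
      (Continuous.intervalIntegrable (by fun_prop) _ _)
      (Eventually.of_forall fun y _ => (hsum y).hasSum.mul_right _)
    have e3 : (fun k => ∫ y in (0:ℝ)..1, cf β hβ k n m * cos (rt β hβ k * y) * cos (rt β hβ j * y))
        = fun k => if k = j then cf β hβ j n m * NN β hβ j else 0 := by
      ext k
      simp only [mul_assoc, intervalIntegral.integral_const_mul]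
      split_ifs with hkj
      · subst hkj; rfl
      · rw [orth hβ (Ne.symm hkj), mul_zero]
    rw [e3] at e2
    exact (hasSum_ite_eq j _).unique e2

theorem spectral {β ρ₀ σ : ℝ} (hβ : 0 < β)
    (hρ₀ : ρ₀ ∈ Ioo (0 : ℝ) (π / 2)) (hρ₀β : ρ₀ * Real.tan ρ₀ = β)
    (hσ : σ = 4 * Real.sin ρ₀ * (3 - (Real.sin ρ₀) ^ 2) / (3 * (2 * ρ₀ + Real.sin (2 * ρ₀)))) :
    ∃ (ρ : ℕ → ℝ) (c : ℕ → ℕ → ℕ → ℝ) (C : ℝ), 0 ≤ C ∧ ρ 0 = ρ₀ ∧ c 0 0 0 = σ ∧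
      (∀ k, ρ k * sin (ρ k) = β * cos (ρ k)) ∧ (∀ k, 0 < ρ k) ∧ (∀ k, ρ k ≤ π * (k+1)) ∧
      (∀ k : ℕ, 1 ≤ k → ((k:ℝ)+1)^2 ≤ ρ k ^2 - ρ₀^2) ∧ (∀ k n m, c k n m = c k m n) ∧
      (∀ k n m, |c k n m| ≤ C * ((n+1)^2 * (m+1)^2 / ((k:ℝ)+1)^2)) ∧
      (∀ n m, ∀ y ∈ Icc (0:ℝ) 1, HasSum (fun k => c k n m * cos (ρ k * y)) (cos (ρ n * y) * cos (ρ m * y))) := by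
  have hcos : 0 < cos ρ₀ := Real.cos_pos_of_mem_Ioo ⟨by linarith [hρ₀.1, Real.pi_pos], hρ₀.2⟩
  have e0 : ρ₀ = rt β hβ 0 := by
    have h1 : ρ₀ * sin ρ₀ = β * cos ρ₀ := by
      rw [← hρ₀β, Real.tan_eq_sin_div_cos]; field_simp
    obtain ⟨k, hk⟩ := rt_all hβ hρ₀.1 h1
    rcases Nat.eq_zero_or_pos k with rfl | hk0
    · exact hk
    · have := rt_gt hβ k
      have h2 : (1:ℝ) ≤ k := by exact_mod_cast hk0
      have h3 := hρ₀.2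
      rw [hk] at h3
      nlinarith [Real.pi_pos]
  refine ⟨rt β hβ, cf β hβ, 2 * (β + 4 * π^2) / rt β hβ 0 ^ 2, ?_, e0.symm, ?_, rt_eq hβ, rt_pos hβ, rt_le hβ,
    ?_, ?_, cf_bound hβ, expansion hβ⟩
  · positivity
  · have hp := hρ₀.1
    have hs : 0 < sin ρ₀ := Real.sin_pos_of_pos_of_lt_pi hp (by linarith [hρ₀.2, Real.pi_pos])
    rw [cf, NN, ← e0, int_cos_sq hp, int_cos_cube hp, hσ, Real.sin_two_mul]
    have : 0 < ρ₀ + sin ρ₀ * cos ρ₀ := by positivity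
    have h2 : 1/2 + sin ρ₀ * cos ρ₀ / (2 * ρ₀) = (ρ₀ + sin ρ₀ * cos ρ₀) / (2 * ρ₀) := by field_simp
    rw [h2, show 2 * ρ₀ + 2 * sin ρ₀ * cos ρ₀ = 2 * (ρ₀ + sin ρ₀ * cos ρ₀) by ring]
    field_simp
    ring
  · intro k hk; rw [e0]; exact rt_gap hβ hk
  · intro k n m
    rw [cf, cf]; congr 2; ext y; ring

end FK

end

section

open Real Set Filter Topology MeasureTheory

namespace FK

/-- weights -/
noncomputable def wt (n : ℕ) : ℝ := 1 / ((n:ℝ)+1)^4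

lemma wt_pos (n : ℕ) : 0 < wt n := by unfold wt; positivity
lemma wt_zero : wt 0 = 1 := by simp [wt]
lemma wt_le (n : ℕ) : wt n ≤ 1 / ((n:ℝ)+1)^2 := by
  unfold wt
  have : (1:ℝ) ≤ n + 1 := by linarith [Nat.cast_nonneg (α := ℝ) n]
  gcongr; norm_num
lemma wt_summable : Summable wt := Summable.of_nonneg_of_le (fun n => (wt_pos n).le) wt_le summable_sq

/-- summable double weights -/
noncomputable def bd (x : ℕ × ℕ) : ℝ := 1 / ((x.1:ℝ)+1)^2 * (1 / ((x.2:ℝ)+1)^2)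

lemma bd_summable : Summable bd :=
  summable_sq.mul_of_nonneg summable_sq (fun n => by positivity) (fun n => by positivity)

lemma bd_nonneg (x) : 0 ≤ bd x := by unfold bd; positivity

/-- total weight -/
noncomputable def S2 : ℝ := ∑' x, bd x

lemma S2_nonneg : 0 ≤ S2 := tsum_nonneg bd_nonneg

/-- bilinear form -/
noncomputable def Bf (c : ℕ → ℕ → ℕ → ℝ) (k : ℕ) (v w : ℕ → ℝ) : ℝ :=
  ∑' x : ℕ × ℕ, c k x.1 x.2 * v x.1 * w x.2

/-- weighted bound -/
def WB (M : ℝ) (v : ℕ → ℝ) : Prop := ∀ n, |v n| ≤ M * wt n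

section
variable {c : ℕ → ℕ → ℕ → ℝ} {C : ℝ}

lemma Bf_term (hC : 0 ≤ C) (hc : ∀ k n m, |c k n m| ≤ C * ((n+1)^2 * (m+1)^2 / ((k:ℝ)+1)^2))
    (k : ℕ) {v w : ℕ → ℝ} {M N : ℝ} (hv : WB M v) (hw : WB N w) (x : ℕ × ℕ) :
    ‖c k x.1 x.2 * v x.1 * w x.2‖ ≤ C * M * N / ((k:ℝ)+1)^2 * bd x := by
  have h1 := hc k x.1 x.2
  have h2 := hv x.1
  have h3 := hw x.2
  rw [norm_mul, norm_mul, norm_eq_abs, norm_eq_abs, norm_eq_abs]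
  calc _ ≤ C * ((x.1+1)^2 * (x.2+1)^2 / ((k:ℝ)+1)^2) * (M * wt x.1) * (N * wt x.2) := by
        gcongr
        exact mul_nonneg (by positivity) ((abs_nonneg _).trans h2)
    _ = _ := by unfold wt bd; field_simp

lemma Bf_summable (hC : 0 ≤ C) (hc : ∀ k n m, |c k n m| ≤ C * ((n+1)^2 * (m+1)^2 / ((k:ℝ)+1)^2))
    (k : ℕ) {v w : ℕ → ℝ} {M N : ℝ} (hv : WB M v) (hw : WB N w) :
    Summable (fun x : ℕ × ℕ => c k x.1 x.2 * v x.1 * w x.2) :=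
  Summable.of_norm_bounded (bd_summable.mul_left _) (Bf_term hC hc k hv hw)

lemma Bf_le (hC : 0 ≤ C) (hc : ∀ k n m, |c k n m| ≤ C * ((n+1)^2 * (m+1)^2 / ((k:ℝ)+1)^2))
    (k : ℕ) {v w : ℕ → ℝ} {M N : ℝ} (hv : WB M v) (hw : WB N w) :
    |Bf c k v w| ≤ C * S2 * M * N / ((k:ℝ)+1)^2 := by
  have := tsum_of_norm_bounded ((bd_summable.hasSum).mul_left (C * M * N / ((k:ℝ)+1)^2)) (Bf_term hC hc k hv hw)
  refine this.trans (le_of_eq ?_)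
  show C * M * N / ((k:ℝ)+1)^2 * S2 = _
  ring

lemma Bf_add_left (hC : 0 ≤ C) (hc : ∀ k n m, |c k n m| ≤ C * ((n+1)^2 * (m+1)^2 / ((k:ℝ)+1)^2))
    (k : ℕ) {v v' w : ℕ → ℝ} {M M' N : ℝ} (hv : WB M v) (hv' : WB M' v') (hw : WB N w) :
    Bf c k (fun n => v n + v' n) w = Bf c k v w + Bf c k v' w := by
  unfold Bf
  rw [← (Bf_summable hC hc k hv hw).tsum_add (Bf_summable hC hc k hv' hw)]
  congr 1; ext x; ring

lemma Bf_add_right (hC : 0 ≤ C) (hc : ∀ k n m, |c k n m| ≤ C * ((n+1)^2 * (m+1)^2 / ((k:ℝ)+1)^2))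
    (k : ℕ) {v w w' : ℕ → ℝ} {M N N' : ℝ} (hv : WB M v) (hw : WB N w) (hw' : WB N' w') :
    Bf c k v (fun n => w n + w' n) = Bf c k v w + Bf c k v w' := by
  unfold Bf
  rw [← (Bf_summable hC hc k hv hw).tsum_add (Bf_summable hC hc k hv hw')]
  congr 1; ext x; ring

lemma Bf_sub (hC : 0 ≤ C) (hc : ∀ k n m, |c k n m| ≤ C * ((n+1)^2 * (m+1)^2 / ((k:ℝ)+1)^2))
    (k : ℕ) {v v' : ℕ → ℝ} {M M' : ℝ} (hv : WB M v) (hv' : WB M' v') :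
    Bf c k v v - Bf c k v' v' = Bf c k (fun n => v n - v' n) v + Bf c k v' (fun n => v n - v' n) := by
  have hd : WB (M + M') (fun n => v n - v' n) := fun n => by
    have := abs_sub (v n) (v' n)
    have h1 := hv n
    have h2 := hv' n
    rw [add_mul]; linarith
  unfold Bf
  rw [← (Bf_summable hC hc k hv hv).tsum_sub (Bf_summable hC hc k hv' hv'),
    ← (Bf_summable hC hc k hd hv).tsum_add (Bf_summable hC hc k hv' hd)]
  congr 1; ext x; ring

/-- unit vector -/
def dl (n : ℕ) : ℝ := if n = 0 then 1 else 0

lemma dl_WB : WB 1 dl := fun n => by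
  unfold dl
  split_ifs with h
  · subst h; simp [wt_zero]
  · simpa using (wt_pos n).le

lemma Bf_smul_left (k : ℕ) (s : ℝ) (v w : ℕ → ℝ) : Bf c k (fun n => s * v n) w = s * Bf c k v w := by
  unfold Bf; rw [← tsum_mul_left]; congr 1; ext x; ring

lemma Bf_smul_right (k : ℕ) (s : ℝ) (v w : ℕ → ℝ) : Bf c k v (fun n => s * w n) = s * Bf c k v w := by
  unfold Bf; rw [← tsum_mul_left]; congr 1; ext x; ring

lemma Bf_dl (k : ℕ) : Bf c k dl dl = c k 0 0 := by
  unfold Bf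
  rw [tsum_eq_single (0, 0)]
  · simp [dl]
  · rintro ⟨n, m⟩ h
    by_cases hn : n = 0
    · have hm : m ≠ 0 := by rintro rfl; exact h (by rw [hn])
      simp [dl, hm]
    · simp [dl, hn]

lemma WB_smul {M : ℝ} {v : ℕ → ℝ} (hv : WB M v) {s t : ℝ} (hs : |s| ≤ t) : WB (t * M) (fun n => s * v n) := by
  intro n
  rw [abs_mul, mul_assoc]
  exact mul_le_mul hs (hv n) (abs_nonneg _) ((abs_nonneg _).trans hs)

lemma WB_mono {M N : ℝ} {v : ℕ → ℝ} (hv : WB M v) (h : M ≤ N) : WB N v := fun n =>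
  (hv n).trans (mul_le_mul_of_nonneg_right h (wt_pos n).le)

lemma WB_add {M N : ℝ} {v w : ℕ → ℝ} (hv : WB M v) (hw : WB N w) : WB (M + N) (fun n => v n + w n) := fun n => by
  have := abs_add_le (v n) (w n)
  rw [add_mul]; linarith [hv n, hw n]

lemma WB_sub {M N : ℝ} {v w : ℕ → ℝ} (hv : WB M v) (hw : WB N w) : WB (M + N) (fun n => v n - w n) := fun n => by
  have := abs_sub (v n) (w n)
  rw [add_mul]; linarith [hv n, hw n]

/-- mode-zero quadratic remainder -/
lemma Bf_rem (hC : 0 ≤ C) (hc : ∀ k n m, |c k n m| ≤ C * ((n+1)^2 * (m+1)^2 / ((k:ℝ)+1)^2))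
    {A A0 η d : ℝ} (hA : |A| ≤ A0) (hη : 0 ≤ η) (hd : 0 ≤ d) {R R' : ℕ → ℝ} (hR : WB η R) (hR' : WB η R')
    (hD : WB d (fun n => R n - R' n)) (hD1 : ∀ n, n ≠ 0 → |R n - R' n| ≤ η * d * wt n) :
    |Bf c 0 (fun n => A * dl n + R n) (fun n => A * dl n + R n)
      - Bf c 0 (fun n => A * dl n + R' n) (fun n => A * dl n + R' n)
      - 2 * c 0 0 0 * A * (R 0 - R' 0)| ≤ 2 * C * S2 * (A0 + 1) * (η * d) := by
  have hAd : WB (A0 * 1) (fun n => A * dl n) := WB_smul dl_WB hA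
  have hV := WB_add hAd hR
  have hV' := WB_add hAd hR'
  have hA0 : 0 ≤ A0 := (abs_nonneg _).trans hA
  rw [Bf_sub hC hc 0 hV hV']
  have e1 : (fun n => A * dl n + R n - (A * dl n + R' n)) = fun n => R n - R' n := by ext n; ring
  rw [e1, Bf_add_right hC hc 0 hD hAd hR, Bf_add_left hC hc 0 hAd hR' hD, Bf_smul_left, Bf_smul_right]
  set D : ℕ → ℝ := fun n => if n = 0 then 0 else R n - R' n with hDdef
  have hDW : WB (η * d) D := by
    intro n
    by_cases hn : n = 0
    · simp only [hDdef, hn, if_true, abs_zero]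
      have := wt_pos 0
      positivity
    · simp only [hDdef, hn, if_false]; exact hD1 n hn
  have e2 : (fun n => R n - R' n) = fun n => (R 0 - R' 0) * dl n + D n := by
    ext n
    by_cases hn : n = 0
    · simp [hDdef, hn, dl]
    · simp [hDdef, hn, dl]
  have hB : WB (|R 0 - R' 0| * 1) (fun n => (R 0 - R' 0) * dl n) := WB_smul dl_WB le_rfl
  have e3 : Bf c 0 (fun n => R n - R' n) dl = (R 0 - R' 0) * c 0 0 0 + Bf c 0 D dl := by
    rw [e2, Bf_add_left hC hc 0 hB hDW dl_WB, Bf_smul_left, Bf_dl]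
  have e4 : Bf c 0 dl (fun n => R n - R' n) = (R 0 - R' 0) * c 0 0 0 + Bf c 0 dl D := by
    rw [e2, Bf_add_right hC hc 0 dl_WB hB hDW, Bf_smul_right, Bf_dl]
  rw [e3, e4]
  have b1 := Bf_le hC hc 0 hDW dl_WB
  have b2 := Bf_le hC hc 0 dl_WB hDW
  have b3 := Bf_le hC hc 0 hD hR
  have b4 := Bf_le hC hc 0 hR' hD
  simp only [Nat.cast_zero, zero_add, one_pow, div_one, mul_one] at b1 b2 b3 b4
  generalize Bf c 0 D dl = x1 at *
  generalize Bf c 0 dl D = x2 at *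
  generalize Bf c 0 (fun n => R n - R' n) R = x3 at *
  generalize Bf c 0 R' (fun n => R n - R' n) = x4 at *
  have e5 : A * ((R 0 - R' 0) * c 0 0 0 + x1) + x3 + (A * ((R 0 - R' 0) * c 0 0 0 + x2) + x4)
      - 2 * c 0 0 0 * A * (R 0 - R' 0) = (A * x1 + x3) + (A * x2 + x4) := by ring
  rw [e5]
  have hS := S2_nonneg
  have t1 : |A * x1| ≤ A0 * (C * S2 * (η * d)) := by
    rw [abs_mul]; exact mul_le_mul hA b1 (abs_nonneg _) hA0
  have t2 : |A * x2| ≤ A0 * (C * S2 * (η * d)) := by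
    rw [abs_mul]; exact mul_le_mul hA b2 (abs_nonneg _) hA0
  have := abs_add_le (A * x1 + x3) (A * x2 + x4)
  have := abs_add_le (A * x1) x3
  have := abs_add_le (A * x2) x4
  linarith

lemma Bf_cont (hC : 0 ≤ C) (hc : ∀ k n m, |c k n m| ≤ C * ((n+1)^2 * (m+1)^2 / ((k:ℝ)+1)^2))
    (k : ℕ) {V : ℕ → ℝ → ℝ} {M : ℝ} (hV : ∀ X, WB M (fun n => V n X)) (hVc : ∀ n, Continuous (V n)) :
    Continuous (fun X => Bf c k (fun n => V n X) (fun n => V n X)) := by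
  refine continuous_tsum (fun x => ?_) (bd_summable.mul_left (C * M * M / ((k:ℝ)+1)^2))
    (fun x X => Bf_term hC hc k (hV X) (hV X) x)
  have := hVc x.1
  have := hVc x.2
  fun_prop

lemma Bf_tendsto (hC : 0 ≤ C) (hc : ∀ k n m, |c k n m| ≤ C * ((n+1)^2 * (m+1)^2 / ((k:ℝ)+1)^2))
    (k : ℕ) {V : ℕ → ℝ → ℝ} {M : ℝ} (hV : ∀ X, WB M (fun n => V n X)) {l : Filter ℝ} {L : ℕ → ℝ}
    (hL : ∀ n, Tendsto (V n) l (𝓝 (L n))) :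
    Tendsto (fun X => Bf c k (fun n => V n X) (fun n => V n X)) l (𝓝 (Bf c k L L)) := by
  refine tendsto_tsum_of_dominated_convergence (bd_summable.mul_left (C * M * M / ((k:ℝ)+1)^2))
    (fun x => ?_) (Eventually.of_forall fun X x => Bf_term hC hc k (hV X) (hV X) x)
  exact ((hL x.1).const_mul _).mul (hL x.2)

end

/-- clamp -/
noncomputable def cl (η z : ℝ) : ℝ := max (-η) (min η z)

lemma cl_cont (η : ℝ) : Continuous (cl η) := by unfold cl; fun_prop
lemma cl_abs {η : ℝ} (h : 0 ≤ η) (z : ℝ) : |cl η z| ≤ η := by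
  unfold cl
  rw [abs_le]
  exact ⟨le_max_left _ _, max_le (by linarith) (min_le_left _ _)⟩
lemma cl_lip (η z w : ℝ) : |cl η z - cl η w| ≤ |z - w| := by
  unfold cl
  refine (abs_max_sub_max_le_max _ _ _ _).trans ?_
  simp only [sub_self, abs_zero]
  refine max_le (abs_nonneg _) ((abs_min_sub_min_le_max _ _ _ _).trans ?_)
  simp
lemma cl_id {η z : ℝ} (h : |z| ≤ η) : cl η z = z := by
  rw [abs_le] at h
  unfold cl
  rw [min_eq_right h.2, max_eq_right h.1]
lemma cl_zero {η : ℝ} (h : 0 ≤ η) : cl η 0 = 0 := cl_id (by simpa using h)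

end FK

end

section

open Real Set Filter Topology MeasureTheory BoundedContinuousFunction

namespace FK

/-- mode weights -/
noncomputable def wk (η : ℝ) (k : ℕ) : ℝ := if k = 0 then 1 else η * wt k
/-- remainder modes -/
noncomputable def RR (κ η : ℝ) (Z : ℕ × ℝ → ℝ) (k : ℕ) (X : ℝ) : ℝ := wk η k * (Ph κ X * cl η (Z (k, X)))
/-- full modes -/
noncomputable def VV (κ η : ℝ) (A : ℝ → ℝ) (Z : ℕ × ℝ → ℝ) (k : ℕ) (X : ℝ) : ℝ := A X * dl k + RR κ η Z k X
/-- right hand sides -/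
noncomputable def ff (c : ℕ → ℕ → ℕ → ℝ) (κ η : ℝ) (A : ℝ → ℝ) (Z : ℕ × ℝ → ℝ) (k : ℕ) (X : ℝ) : ℝ :=
  (if k = 0 then 2 * RR κ η Z 0 X + c 0 0 0 * A X ^ 2 else 0)
    - Bf c k (fun n => VV κ η A Z n X) (fun n => VV κ η A Z n X)

/-- standing hypotheses -/
structure Hyp (c : ℕ → ℕ → ℕ → ℝ) (C κ η M lam ε L : ℝ) (a : ℝ → ℝ) (P Q : ℕ → ℝ) : Prop where
  hC : 0 ≤ C
  hc : ∀ k n m, |c k n m| ≤ C * ((n+1)^2 * (m+1)^2 / ((k:ℝ)+1)^2)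
  hη0 : 0 < η
  hη1 : η ≤ 1
  ac : Continuous a
  a0 : ∀ x, 0 ≤ a x
  a1 : ∀ x, a x ≤ 1
  aw : ∀ x, (2 - 2 * a x) * Ph κ x ≤ 1/2
  aM : ∀ x, a x ^ 2 ≤ M * Ph κ x
  aB : Tendsto a atBot (𝓝 1)
  hM : 0 ≤ M
  hσ : 0 < c 0 0 0
  hκ : 0 < κ
  hκl : κ < lam
  hκ1 : 1 < lam * κ - κ^2
  hP : ∀ k, 0 < P k
  hQ : ∀ k, 0 < Q k
  hPQ : ∀ k, P k - Q k = lam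
  hm0 : P 0 * Q 0 = 1
  hε : 0 < ε
  hm : ∀ k : ℕ, k ≠ 0 → ((k:ℝ)+1)^2 / (2 * ε^2) ≤ P k * Q k
  s1 : th lam κ + 2 * C * S2 * (1 / c 0 0 0 + 1) * η ≤ L
  s2 : 2 * ε^2 / η * (2 * C * S2 * (1 / c 0 0 0 + 1)) ≤ L
  hL : L < 1
  s3 : 2 * ε^2 / η * (C * M / c 0 0 0 ^ 2) / (1 - L) ≤ η

lemma wk_pos {η : ℝ} (h : 0 < η) (k : ℕ) : 0 < wk η k := by
  unfold wk; split_ifs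
  · exact one_pos
  · exact mul_pos h (wt_pos k)
lemma wk_le {η : ℝ} (h : η ≤ 1) (k : ℕ) : wk η k ≤ wt k := by
  unfold wk; split_ifs with hk
  · subst hk; rw [wt_zero]
  · have := wt_pos k; nlinarith

section
variable {c : ℕ → ℕ → ℕ → ℝ} {C κ η M lam ε L : ℝ} {a : ℝ → ℝ} {P Q : ℕ → ℝ}

lemma RR_WB (H : Hyp c C κ η M lam ε L a P Q) (Z : ℕ × ℝ → ℝ) (X : ℝ) : WB η (fun k => RR κ η Z k X) := by
  intro k
  have h1 := wk_pos H.hη0 k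
  have h2 := wk_le H.hη1 k
  have h3 := Ph_pos κ X
  have h4 := Ph_le_one κ X
  have h5 := cl_abs H.hη0.le (Z (k, X))
  simp only [RR]
  rw [abs_mul, abs_mul, abs_of_pos h1, abs_of_pos h3]
  calc wk η k * (Ph κ X * |cl η (Z (k, X))|) ≤ wt k * (1 * η) := by
        have h6 := (wt_pos k).le
        gcongr
    _ = _ := by ring

lemma A_abs (H : Hyp c C κ η M lam ε L a P Q) (X : ℝ) : |a X / c 0 0 0| ≤ 1 / c 0 0 0 := by
  have := H.hσ
  rw [abs_div, abs_of_pos this, abs_of_nonneg (H.a0 X)]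
  gcongr; exact H.a1 X

lemma VV_WB (H : Hyp c C κ η M lam ε L a P Q) (Z : ℕ × ℝ → ℝ) (X : ℝ) :
    WB (1 / c 0 0 0 + 1) (fun k => VV κ η (fun x => a x / c 0 0 0) Z k X) := by
  have h := WB_add (WB_smul dl_WB (A_abs H X)) (RR_WB H Z X)
  refine WB_mono h ?_
  linarith [H.hη1]

lemma RR_cont (H : Hyp c C κ η M lam ε L a P Q) {Z : ℕ × ℝ → ℝ} (hZ : Continuous Z) (k : ℕ) : Continuous (RR κ η Z k) := by
  have h1 := Ph_cont κ
  have h2 := cl_cont η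
  unfold RR
  fun_prop

lemma VV_cont (H : Hyp c C κ η M lam ε L a P Q) {Z : ℕ × ℝ → ℝ} (hZ : Continuous Z) (k : ℕ) :
    Continuous (VV κ η (fun x => a x / c 0 0 0) Z k) := by
  have h1 := RR_cont H hZ k
  have h2 := H.ac
  have h3 := H.hσ
  unfold VV
  fun_prop

lemma Bf_CB (H : Hyp c C κ η M lam ε L a P Q) {Z : ℕ × ℝ → ℝ} (hZ : Continuous Z) (k : ℕ) :
    CB (fun X => Bf c k (fun n => VV κ η (fun x => a x / c 0 0 0) Z n X)
      (fun n => VV κ η (fun x => a x / c 0 0 0) Z n X)) :=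
  ⟨Bf_cont H.hC H.hc k (VV_WB H Z) (VV_cont H hZ), _, fun X => Bf_le H.hC H.hc k (VV_WB H Z X) (VV_WB H Z X)⟩

lemma RR_abs (H : Hyp c C κ η M lam ε L a P Q) (Z : ℕ × ℝ → ℝ) (k : ℕ) (X : ℝ) : |RR κ η Z k X| ≤ 1 := by
  have h := RR_WB H Z X k
  have : wt k ≤ 1 := by
    refine (wt_le k).trans ?_
    rw [div_le_one (by positivity)]
    exact one_le_pow₀ (by linarith [Nat.cast_nonneg (α := ℝ) k])
  have h2 := wt_pos k
  have h3 := H.hη0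
  have h4 := H.hη1
  simp only at h
  nlinarith

lemma ff_CB (H : Hyp c C κ η M lam ε L a P Q) {Z : ℕ × ℝ → ℝ} (hZ : Continuous Z) (k : ℕ) :
    CB (ff c κ η (fun x => a x / c 0 0 0) Z k) := by
  obtain ⟨h1, N, hN⟩ := Bf_CB H hZ k
  have hR := RR_cont H hZ 0
  have hac := H.ac
  have hσ := H.hσ
  refine ⟨?_, 2 + c 0 0 0 * (1 / c 0 0 0)^2 + N, fun X => ?_⟩
  · unfold ff
    split_ifs
    · fun_prop
    · fun_prop
  · unfold ff
    refine (abs_sub _ _).trans (add_le_add ?_ (hN X))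
    split_ifs
    · refine (abs_add_le _ _).trans (add_le_add ?_ ?_)
      · rw [abs_mul, abs_two]; linarith [RR_abs H Z 0 X]
      · rw [abs_mul, abs_of_pos hσ, abs_pow]
        gcongr
        exact A_abs H X
    · rw [abs_zero]; positivity

lemma RR_diff (H : Hyp c C κ η M lam ε L a P Q) {Z Z' : ℕ × ℝ → ℝ} {d : ℝ} (hd : ∀ x, |Z x - Z' x| ≤ d) (k : ℕ) (X : ℝ) :
    |RR κ η Z k X - RR κ η Z' k X| ≤ wk η k * (Ph κ X * d) := by
  have h1 := wk_pos H.hη0 k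
  have h3 := Ph_pos κ X
  unfold RR
  rw [← mul_sub, ← mul_sub, abs_mul, abs_mul, abs_of_pos h1, abs_of_pos h3]
  gcongr
  exact (cl_lip _ _ _).trans (hd _)

lemma RR_diff_WB (H : Hyp c C κ η M lam ε L a P Q) {Z Z' : ℕ × ℝ → ℝ} {d : ℝ} (hd0 : 0 ≤ d) (hd : ∀ x, |Z x - Z' x| ≤ d) (X : ℝ) :
    WB (Ph κ X * d) (fun k => RR κ η Z k X - RR κ η Z' k X) := fun k => by
  refine (RR_diff H hd k X).trans ?_
  rw [mul_comm]
  have h3 := Ph_pos κ X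
  gcongr
  exact wk_le H.hη1 k

lemma ff_diff (H : Hyp c C κ η M lam ε L a P Q) {Z Z' : ℕ × ℝ → ℝ} {d : ℝ} (hd0 : 0 ≤ d) (hd : ∀ x, |Z x - Z' x| ≤ d) {k : ℕ} (hk : k ≠ 0) (X : ℝ) :
    |ff c κ η (fun x => a x / c 0 0 0) Z k X - ff c κ η (fun x => a x / c 0 0 0) Z' k X|
      ≤ 2 * C * S2 * (1 / c 0 0 0 + 1) * d / ((k:ℝ)+1)^2 * Ph κ X := by
  simp only [ff, hk, if_false, zero_sub]
  rw [← abs_neg, neg_sub_neg, neg_sub, Bf_sub H.hC H.hc k (VV_WB H Z X) (VV_WB H Z' X)]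
  have e : (fun n => VV κ η (fun x => a x / c 0 0 0) Z n X - VV κ η (fun x => a x / c 0 0 0) Z' n X)
      = fun n => RR κ η Z n X - RR κ η Z' n X := by ext n; simp [VV]
  rw [e]
  have hD := RR_diff_WB H hd0 hd X
  have b1 := Bf_le H.hC H.hc k hD (VV_WB H Z X)
  have b2 := Bf_le H.hC H.hc k (VV_WB H Z' X) hD
  refine (abs_add_le _ _).trans ((add_le_add b1 b2).trans (le_of_eq ?_))
  ring

lemma ff_diff0 (H : Hyp c C κ η M lam ε L a P Q) {Z Z' : ℕ × ℝ → ℝ} {d : ℝ} (hd0 : 0 ≤ d) (hd : ∀ x, |Z x - Z' x| ≤ d) (X : ℝ) :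
    |(2 - 2 * a X) * (RR κ η Z 0 X - RR κ η Z' 0 X) -
      (ff c κ η (fun x => a x / c 0 0 0) Z 0 X - ff c κ η (fun x => a x / c 0 0 0) Z' 0 X)|
      ≤ 2 * C * S2 * (1 / c 0 0 0 + 1) * η * d * Ph κ X := by
  have h := Bf_rem H.hC H.hc (A_abs H X) H.hη0.le (mul_nonneg (Ph_pos κ X).le hd0) (RR_WB H Z X) (RR_WB H Z' X)
    (RR_diff_WB H hd0 hd X) (fun n hn => by
      have := RR_diff H hd n X
      simp only [wk, hn, if_false] at this
      refine this.trans (le_of_eq ?_); ring)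
  have hσ := H.hσ
  have e : (2 - 2 * a X) * (RR κ η Z 0 X - RR κ η Z' 0 X) -
      (ff c κ η (fun x => a x / c 0 0 0) Z 0 X - ff c κ η (fun x => a x / c 0 0 0) Z' 0 X)
      = Bf c 0 (fun n => a X / c 0 0 0 * dl n + RR κ η Z n X) (fun n => a X / c 0 0 0 * dl n + RR κ η Z n X)
      - Bf c 0 (fun n => a X / c 0 0 0 * dl n + RR κ η Z' n X) (fun n => a X / c 0 0 0 * dl n + RR κ η Z' n X)
      - 2 * c 0 0 0 * (a X / c 0 0 0) * (RR κ η Z 0 X - RR κ η Z' 0 X) := by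
    simp only [ff, if_true, VV]
    have : 2 * c 0 0 0 * (a X / c 0 0 0) = 2 * a X := by field_simp
    rw [this]; ring
  rw [e]
  refine h.trans (le_of_eq ?_)
  ring

lemma P_gt (H : Hyp c C κ η M lam ε L a P Q) (k : ℕ) : κ < P k := by
  have h1 := H.hPQ k
  have h2 := H.hQ k
  linarith [H.hκl]

lemma hk1' (H : Hyp c C κ η M lam ε L a P Q) (k : ℕ) : 0 ≤ (P k - Q k) * κ - κ^2 := by
  rw [H.hPQ k]; linarith [H.hκ1]

/-- the solution operator is Lipschitz -/
lemma T_lip (H : Hyp c C κ η M lam ε L a P Q) {Z Z' : ℕ × ℝ → ℝ} (hZ : Continuous Z) (hZ' : Continuous Z') {d : ℝ} (hd0 : 0 ≤ d)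
    (hd : ∀ x, |Z x - Z' x| ≤ d) (k : ℕ) (X : ℝ) :
    |G (P k) (Q k) (ff c κ η (fun x => a x / c 0 0 0) Z k) X / (wk η k * Ph κ X)
      - G (P k) (Q k) (ff c κ η (fun x => a x / c 0 0 0) Z' k) X / (wk η k * Ph κ X)| ≤ L * d := by
  have w1 := wk_pos H.hη0 k
  have w2 := Ph_pos κ X
  have hf := ff_CB H hZ k
  have hf' := ff_CB H hZ' k
  have hp := H.hP k
  have hq := H.hQ k
  have hC := H.hC
  have hσ := H.hσ
  have hη := H.hη0
  have hS := S2_nonneg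
  rw [← sub_div, abs_div, abs_of_pos (mul_pos w1 w2), div_le_iff₀ (mul_pos w1 w2), ← G_sub hp hq hf hf']
  have hfs : CB (fun x => ff c κ η (fun x => a x / c 0 0 0) Z k x - ff c κ η (fun x => a x / c 0 0 0) Z' k x) := by
    obtain ⟨c1, N1, h1⟩ := hf
    obtain ⟨c2, N2, h2⟩ := hf'
    exact ⟨by fun_prop, N1 + N2, fun x => (abs_sub _ _).trans (add_le_add (h1 x) (h2 x))⟩
  by_cases hk : k = 0
  · subst hk
    set g : ℝ → ℝ := fun x => (2 - 2 * a x) * (RR κ η Z 0 x - RR κ η Z' 0 x) with hg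
    set e : ℝ → ℝ := fun x => g x - (ff c κ η (fun x => a x / c 0 0 0) Z 0 x - ff c κ η (fun x => a x / c 0 0 0) Z' 0 x)
      with he
    have hgb : ∀ x, |g x| ≤ d * ((2 - 2 * a x) * Ph κ x) := by
      intro x
      have h1 := RR_diff H hd 0 x
      simp only [wk, if_true, one_mul] at h1
      have h2 : 0 ≤ 2 - 2 * a x := by linarith [H.a1 x]
      simp only [hg]
      rw [abs_mul, abs_of_nonneg h2]
      have := mul_le_mul_of_nonneg_left h1 h2
      linarith
    have hgCB : CB g := by
      have c1 := RR_cont H hZ 0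
      have c2 := RR_cont H hZ' 0
      have c3 := H.ac
      refine ⟨by fun_prop, d * (1/2), fun x => (hgb x).trans ?_⟩
      exact mul_le_mul_of_nonneg_left (H.aw x) hd0
    have heb : ∀ x, |e x| ≤ 2 * C * S2 * (1 / c 0 0 0 + 1) * η * d * Ph κ x := ff_diff0 H hd0 hd
    have heCB : CB e := by
      obtain ⟨c1, N1, h1⟩ := hgCB
      obtain ⟨c2, N2, h2⟩ := hfs
      exact ⟨by fun_prop, N1 + N2, fun x => (abs_sub _ _).trans (add_le_add (h1 x) (h2 x))⟩
    have es : (fun x => ff c κ η (fun x => a x / c 0 0 0) Z 0 x - ff c κ η (fun x => a x / c 0 0 0) Z' 0 x)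
        = fun x => g x - e x := by ext x; simp only [he]; ring
    rw [es, G_sub hp hq hgCB heCB]
    have b1 := G_contr hp hq (H.hPQ 0) H.hm0 (P_gt H 0) H.hκ.le H.hκ1 hgCB H.a0 H.aw hd0 hgb X
    have b2 := G_Ph hp hq (P_gt H 0) H.hκ.le (hk1' H 0) heCB (by positivity) heb X
    rw [H.hm0, div_one] at b2
    refine (abs_sub _ _).trans ((add_le_add b1 b2).trans ?_)
    simp only [wk, if_true, one_mul]
    have := mul_le_mul_of_nonneg_right H.s1 (mul_nonneg hd0 w2.le)
    linarith
  · have hb := ff_diff H hd0 hd hk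
    have b2 := G_Ph hp hq (P_gt H k) H.hκ.le (hk1' H k) hfs (by positivity) hb X
    refine b2.trans ?_
    rw [← mul_assoc (L * d)]
    refine mul_le_mul_of_nonneg_right ?_ w2.le
    have hε := H.hε
    have hm := H.hm k hk
    simp only [wk, hk, if_false]
    calc 2 * C * S2 * (1 / c 0 0 0 + 1) * d / ((k:ℝ)+1)^2 / (P k * Q k)
        ≤ 2 * C * S2 * (1 / c 0 0 0 + 1) * d / ((k:ℝ)+1)^2 / (((k:ℝ)+1)^2 / (2 * ε^2)) := by gcongr
      _ = 2 * ε^2 / η * (2 * C * S2 * (1 / c 0 0 0 + 1)) * d * (η * wt k) := by unfold wt; field_simp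
      _ ≤ L * d * (η * wt k) := by
        have := wt_pos k
        gcongr
        exact H.s2

lemma T_zero (H : Hyp c C κ η M lam ε L a P Q) (k : ℕ) (X : ℝ) :
    |G (P k) (Q k) (ff c κ η (fun x => a x / c 0 0 0) (fun _ => 0) k) X / (wk η k * Ph κ X)|
      ≤ 2 * ε^2 / η * (C * M / c 0 0 0 ^ 2) := by
  have w1 := wk_pos H.hη0 k
  have w2 := Ph_pos κ X
  have hf := ff_CB H (Z := fun _ => 0) continuous_const k
  have hp := H.hP k
  have hq := H.hQ k
  have hC := H.hC
  have hM := H.hM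
  have hσ := H.hσ
  have hη := H.hη0
  have hε := H.hε
  rw [abs_div, abs_of_pos (mul_pos w1 w2), div_le_iff₀ (mul_pos w1 w2)]
  have hR : ∀ n x, RR κ η (fun _ => 0) n x = 0 := fun n x => by simp [RR, cl_zero hη.le]
  have hB : ∀ x, Bf c k (fun n => VV κ η (fun x => a x / c 0 0 0) (fun _ => 0) n x)
      (fun n => VV κ η (fun x => a x / c 0 0 0) (fun _ => 0) n x) = (a x / c 0 0 0)^2 * c k 0 0 := by
    intro x
    simp only [VV, hR, add_zero]
    rw [Bf_smul_left, Bf_smul_right, Bf_dl]; ring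
  by_cases hk : k = 0
  · subst hk
    have hz : ∀ x, |ff c κ η (fun x => a x / c 0 0 0) (fun _ => 0) 0 x| ≤ 0 := by
      intro x
      simp only [ff, if_true, hB, hR]
      apply le_of_eq; rw [abs_eq_zero]; ring
    have := G_le hp hq hf hz X
    rw [zero_div] at this
    exact this.trans (by positivity)
  · have hz : ∀ x, |ff c κ η (fun x => a x / c 0 0 0) (fun _ => 0) k x| ≤ C * M / c 0 0 0 ^ 2 / ((k:ℝ)+1)^2 * Ph κ x := by
      intro x
      simp only [ff, hk, if_false, hB, zero_sub, abs_neg]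
      rw [abs_mul, abs_of_nonneg (sq_nonneg (a x / c 0 0 0)), div_pow]
      have h1 := H.hc k 0 0
      simp at h1
      have h2 := H.aM x
      calc a x ^ 2 / c 0 0 0 ^ 2 * |c k 0 0| ≤ M * Ph κ x / c 0 0 0 ^ 2 * (C * (((k:ℝ)+1)^2)⁻¹) := by
            have := Ph_pos κ x
            gcongr
        _ = _ := by field_simp
    have b2 := G_Ph hp hq (P_gt H k) H.hκ.le (hk1' H k) hf (by positivity) hz X
    refine b2.trans ?_
    rw [← mul_assoc (2 * ε^2 / η * _)]
    refine mul_le_mul_of_nonneg_right ?_ w2.le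
    have hm := H.hm k hk
    simp only [wk, hk, if_false]
    calc C * M / c 0 0 0 ^ 2 / ((k:ℝ)+1)^2 / (P k * Q k)
        ≤ C * M / c 0 0 0 ^ 2 / ((k:ℝ)+1)^2 / (((k:ℝ)+1)^2 / (2 * ε^2)) := by gcongr
      _ = _ := by unfold wt; field_simp

end

end FK

end

section

open Real Set Filter Topology MeasureTheory BoundedContinuousFunction

namespace FK

lemma closed_lim : IsClosed {Z : (ℕ × ℝ) →ᵇ ℝ | ∀ k, ∃ l, Tendsto (fun X => Z (k, X)) atBot (𝓝 l)} := by
  refine isClosed_of_closure_subset fun Z hZ k => ?_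
  rw [← cauchy_map_iff_exists_tendsto, Metric.cauchy_iff]
  refine ⟨inferInstance, fun δ hδ => ?_⟩
  obtain ⟨W, hW, hd⟩ := Metric.mem_closure_iff.1 hZ (δ/4) (by linarith)
  obtain ⟨l, hl⟩ := hW k
  have hev : ∀ᶠ X in atBot, dist (W (k, X)) l < δ/4 := (Metric.tendsto_nhds.1 hl) _ (by linarith)
  refine ⟨(fun X => Z (k, X)) '' {X | dist (W (k, X)) l < δ/4}, image_mem_map hev, ?_⟩
  rintro _ ⟨X, hX, rfl⟩ _ ⟨Y, hY, rfl⟩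
  have h1 := (BoundedContinuousFunction.dist_coe_le_dist (f := Z) (g := W) (k, X)).trans_lt hd
  have h2 := (BoundedContinuousFunction.dist_coe_le_dist (f := Z) (g := W) (k, Y)).trans_lt hd
  simp only [mem_ofPred_eq] at hX hY
  rw [Real.dist_eq] at *
  rw [abs_lt] at *
  constructor <;> linarith [h1.1, h1.2, h2.1, h2.2, hX.1, hX.2, hY.1, hY.2]

lemma Ph_atBot {κ : ℝ} (hκ : 0 < κ) : Tendsto (Ph κ) atBot (𝓝 1) := by
  refine tendsto_const_nhds.congr' ?_
  filter_upwards [eventually_le_atBot 0] with X hX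
  unfold Ph
  rw [min_eq_left]
  exact Real.one_le_exp (by nlinarith)

lemma Ph_atTop {κ : ℝ} (hκ : 0 < κ) : Tendsto (Ph κ) atTop (𝓝 0) := by
  refine squeeze_zero (fun X => (Ph_pos κ X).le) (Ph_le_exp κ) ?_
  refine Real.tendsto_exp_atBot.comp ?_
  exact tendsto_id.const_mul_atTop_of_neg (by linarith)

section
variable {c : ℕ → ℕ → ℕ → ℝ} {C κ η M lam ε L : ℝ} {a : ℝ → ℝ} {P Q : ℕ → ℝ}

lemma RR_lim (H : Hyp c C κ η M lam ε L a P Q) {Z : ℕ × ℝ → ℝ} {k : ℕ} {l : ℝ}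
    (h : Tendsto (fun X => Z (k, X)) atBot (𝓝 l)) :
    Tendsto (RR κ η Z k) atBot (𝓝 (wk η k * (1 * cl η l))) :=
  ((Ph_atBot H.hκ).mul (((cl_cont η).tendsto l).comp h)).const_mul _

lemma ff_lim (H : Hyp c C κ η M lam ε L a P Q) {Z : ℕ × ℝ → ℝ}
    (h : ∀ k, ∃ l, Tendsto (fun X => Z (k, X)) atBot (𝓝 l)) (k : ℕ) :
    ∃ l, Tendsto (ff c κ η (fun x => a x / c 0 0 0) Z k) atBot (𝓝 l) := by
  choose l hl using h
  have hR := fun k => RR_lim H (hl k)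
  have hA : Tendsto (fun x => a x / c 0 0 0) atBot (𝓝 (1 / c 0 0 0)) := H.aB.div_const _
  have hV : ∀ n, Tendsto (VV κ η (fun x => a x / c 0 0 0) Z n) atBot
      (𝓝 (1 / c 0 0 0 * dl n + wk η n * (1 * cl η (l n)))) := fun n => (hA.mul_const _).add (hR n)
  have hB := Bf_tendsto H.hC H.hc k (VV_WB H Z) hV
  by_cases hk : k = 0
  · subst hk
    have := ((((hR 0).const_mul 2).add ((hA.pow 2).const_mul (c 0 0 0)))).sub hB
    refine ⟨_, this.congr fun X => ?_⟩
    simp [ff]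
  · refine ⟨_, (hB.neg).congr fun X => ?_⟩
    simp [ff, hk]

theorem fixed (H : Hyp c C κ η M lam ε L a P Q) : ∃ Z : ℕ × ℝ → ℝ, Continuous Z ∧
    (∀ x, |Z x| ≤ 2 * ε^2 / η * (C * M / c 0 0 0 ^ 2) / (1 - L)) ∧
    (∀ k X, RR κ η Z k X = G (P k) (Q k) (ff c κ η (fun x => a x / c 0 0 0) Z k) X) ∧
    ∀ k, ∃ l, Tendsto (RR κ η Z k) atBot (𝓝 l) := by
  have hL0 : 0 ≤ L := by
    have h1 := H.s1
    have h2 : 0 < th lam κ := th_pos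
    have hC := H.hC
    have hσ := H.hσ
    have hη := H.hη0
    have hS := S2_nonneg
    have : 0 ≤ 2 * C * S2 * (1 / c 0 0 0 + 1) * η := by positivity
    linarith
  set T0 : ℝ := 2 * ε^2 / η * (C * M / c 0 0 0 ^ 2) with hT0
  set g : (ℕ × ℝ →ᵇ ℝ) → ℕ × ℝ → ℝ := fun Z x =>
    G (P x.1) (Q x.1) (ff c κ η (fun x => a x / c 0 0 0) Z x.1) x.2 / (wk η x.1 * Ph κ x.2) with hg
  have hgc : ∀ Z, Continuous (g Z) := by
    intro Z
    rw [continuous_prod_of_discrete_left]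
    intro k
    have h1 := (G_CB (H.hP k) (H.hQ k) (ff_CB H Z.continuous k)).1
    have h2 := Ph_cont κ
    simp only [hg]
    refine h1.div (by fun_prop) fun X => ?_
    exact (mul_pos (wk_pos H.hη0 k) (Ph_pos κ X)).ne'
  have hlip : ∀ Z Z' : ℕ × ℝ →ᵇ ℝ, ∀ x, |g Z x - g Z' x| ≤ L * dist Z Z' := by
    intro Z Z' x
    exact T_lip H Z.continuous Z'.continuous dist_nonneg
      (fun x => by rw [← Real.dist_eq]; exact BoundedContinuousFunction.dist_coe_le_dist x) x.1 x.2
  have hz : ∀ x, |g 0 x| ≤ T0 := by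
    intro x
    have := T_zero H x.1 x.2
    exact this
  have hgb : ∀ Z x, ‖g Z x‖ ≤ L * dist Z 0 + T0 := by
    intro Z x
    have h1 := hlip Z 0 x
    have h2 := hz x
    rw [norm_eq_abs]
    have := abs_sub_abs_le_abs_sub (g Z x) (g 0 x)
    linarith
  set T : (ℕ × ℝ →ᵇ ℝ) → (ℕ × ℝ →ᵇ ℝ) := fun Z =>
    BoundedContinuousFunction.ofNormedAddCommGroup (g Z) (hgc Z) _ (hgb Z) with hT
  have hTc : ContractingWith (Real.toNNReal L) T := by
    refine ⟨?_, LipschitzWith.of_dist_le_mul fun Z Z' => ?_⟩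
    · rw [Real.toNNReal_lt_one]; exact H.hL
    · rw [Real.coe_toNNReal L hL0, BoundedContinuousFunction.dist_le (mul_nonneg hL0 dist_nonneg)]
      intro x
      exact hlip Z Z' x
  set Z := ContractingWith.fixedPoint T hTc with hZ
  have hfix : T Z = Z := hTc.fixedPoint_isFixedPt
  have hpt : ∀ x, g Z x = Z x := fun x => by
    have := congrArg (fun W : ℕ × ℝ →ᵇ ℝ => W x) hfix
    exact this
  have hbound : ∀ x, |Z x| ≤ T0 / (1 - L) := by
    have h1 := hTc.dist_fixedPoint_le 0
    have h2 : dist 0 (T 0) ≤ T0 := by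
      rw [BoundedContinuousFunction.dist_le ((abs_nonneg _).trans (hz (0,0)))]
      intro x
      rw [Real.dist_eq]
      have : |(0:ℝ) - g 0 x| ≤ T0 := by rw [zero_sub, abs_neg]; exact hz x
      exact this
    intro x
    have h3 : dist (Z x) 0 ≤ dist Z 0 := by
      have := BoundedContinuousFunction.dist_coe_le_dist (f := Z) (g := 0) x
      simpa using this
    rw [Real.dist_0_eq_abs] at h3
    refine h3.trans ?_
    rw [dist_comm]
    refine h1.trans ?_
    have : 0 < 1 - L := by linarith [H.hL]
    rw [Real.coe_toNNReal L hL0]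
    gcongr
  have hlim : ∀ k, ∃ l, Tendsto (fun X => Z (k, X)) atBot (𝓝 l) := by
    have hinv : ∀ W : ℕ × ℝ →ᵇ ℝ, (∀ k, ∃ l, Tendsto (fun X => W (k, X)) atBot (𝓝 l)) →
        ∀ k, ∃ l, Tendsto (fun X => T W (k, X)) atBot (𝓝 l) := by
      intro W hW k
      obtain ⟨l, hl⟩ := ff_lim H hW k
      have h1 := G_tendsto (H.hP k) (H.hQ k) (ff_CB H W.continuous k) hl
      refine ⟨_, h1.div ((Ph_atBot H.hκ).const_mul (wk η k)) ?_⟩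
      rw [mul_one]; exact (wk_pos H.hη0 k).ne'
    have hit : ∀ n, ∀ k, ∃ l, Tendsto (fun X => (T^[n] 0) (k, X)) atBot (𝓝 l) := by
      intro n
      induction n with
      | zero => intro k; exact ⟨0, by simp⟩
      | succ n ih => rw [Function.iterate_succ_apply']; exact hinv _ ih
    exact closed_lim.mem_of_tendsto (hTc.tendsto_iterate_fixedPoint 0) (Eventually.of_forall hit)
  refine ⟨Z, Z.continuous, hbound, fun k X => ?_, fun k => ?_⟩
  · have h1 := hpt (k, X)
    have w1 := wk_pos H.hη0 k
    have w2 := Ph_pos κ X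
    simp only [RR]
    rw [cl_id ((hbound _).trans H.s3), ← h1]
    simp only [hg]
    field_simp
  · obtain ⟨l, hl⟩ := hlim k
    exact ⟨_, RR_lim H hl⟩

end

end FK

end

section

open Real Set Filter Topology MeasureTheory BoundedContinuousFunction

namespace FK

/-- description of a solution of the mode system -/
structure Sol (c : ℕ → ℕ → ℕ → ℝ) (lam N D K' : ℝ) (m : ℕ → ℝ) (V V1 V2 : ℕ → ℝ → ℝ) (l : ℕ → ℝ) : Prop where
  d1 : ∀ k X, HasDerivAt (V k) (V1 k X) X
  d2 : ∀ k X, HasDerivAt (V1 k) (V2 k X) X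
  c2 : ∀ k, Continuous (V2 k)
  ode : ∀ k X, V2 k X + lam * V1 k X - m k * V k X = Bf c k (fun n => V n X) (fun n => V n X)
  b0 : ∀ k X, |V k X| ≤ N * wt k
  b1 : ∀ k X, |V1 k X| ≤ K' / ((k:ℝ)+1)^3
  b2 : ∀ k X, |V2 k X| ≤ K' / ((k:ℝ)+1)^2
  top : ∀ k, Tendsto (V k) atTop (𝓝 0)
  bot : ∀ k, Tendsto (V k) atBot (𝓝 (l k))
  lim : ∀ k, |l k - 1 / c 0 0 0 * dl k| ≤ D * wt k

section
variable {c : ℕ → ℕ → ℕ → ℝ} {C κ η M lam ε L : ℝ} {a : ℝ → ℝ} {P Q : ℕ → ℝ}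

theorem sol_of_hyp (H : Hyp c C κ η M lam ε L a P Q) (hε1 : ε ≤ 1) (haT : Tendsto a atTop (𝓝 0))
    (haG : ∀ X, G (P 0) (Q 0) (fun x => 2 * a x - a x ^ 2) X = a X) (m : ℕ → ℝ) (hm0 : m 0 = -1)
    (hm : ∀ k, k ≠ 0 → P k * Q k = m k) :
    ∃ K' V V1 V2 l, Sol c lam (1 / c 0 0 0 + 1) (2 * ε^2 / η * (C * M / c 0 0 0 ^ 2) / (1 - L)) K' m V V1 V2 l := by
  obtain ⟨Z, hZ, hZb, hZG, hZl⟩ := fixed H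
  choose l hl using hZl
  have hσ := H.hσ
  have hη := H.hη0
  have hC := H.hC
  have hS := S2_nonneg
  have hε := H.hε
  set σ := c 0 0 0 with hσd
  set N := 1 / σ + 1 with hN
  have hN0 : 0 < N := by positivity
  set D := 2 * ε^2 / η * (C * M / σ ^ 2) / (1 - L) with hD
  have hD0 : 0 ≤ D := (abs_nonneg _).trans (hZb (0,0))
  set A : ℝ → ℝ := fun x => a x / σ with hA
  set f := ff c κ η A Z with hf
  set V := VV κ η A Z with hV
  have hVW : ∀ X, WB N (fun k => V k X) := VV_WB H Z
  set B : ℕ → ℝ → ℝ := fun k X => Bf c k (fun n => V n X) (fun n => V n X) with hB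
  have hBb : ∀ k X, |B k X| ≤ C * S2 * N * N / ((k:ℝ)+1)^2 := fun k X => Bf_le H.hC H.hc k (hVW X) (hVW X)
  have hBc : ∀ k, Continuous (B k) := fun k => (Bf_CB H hZ k).1
  have hfCB : ∀ k, CB (f k) := fun k => ff_CB H hZ k
  set R1 : ℕ → ℝ → ℝ := fun k X => Q k * G (P k) (Q k) (f k) X - J (P k) (f k) X with hR1
  set α : ℝ → ℝ := fun x => 2 * a x - a x ^ 2 with hα
  have hαCB : CB α := by
    have := H.ac
    refine ⟨by fun_prop, 1, fun x => ?_⟩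
    have h0 := H.a0 x
    have h1 := H.a1 x
    simp only [hα]
    rw [abs_le]; constructor <;> nlinarith
  set a1 : ℝ → ℝ := fun X => Q 0 * a X - J (P 0) α X with ha1
  have haG' : G (P 0) (Q 0) α = a := funext haG
  have da : ∀ X, HasDerivAt a (a1 X) X := by
    intro X
    have := G_deriv (H.hP 0) (H.hQ 0) hαCB X
    rwa [haG'] at this
  have da1 : ∀ X, HasDerivAt a1 (-a X - lam * a1 X + a X ^ 2) X := by
    intro X
    have := G_deriv2 (H.hP 0) (H.hQ 0) hαCB X
    rw [haG', H.hm0, H.hPQ] at this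
    refine this.congr_deriv ?_
    simp only [hα, ha1]; ring
  have hRG : ∀ k, RR κ η Z k = G (P k) (Q k) (f k) := fun k => funext (hZG k)
  have dR : ∀ k X, HasDerivAt (RR κ η Z k) (R1 k X) X := by
    intro k X
    rw [hRG k]
    exact G_deriv (H.hP k) (H.hQ k) (hfCB k) X
  have dR1 : ∀ k X, HasDerivAt (R1 k) (P k * Q k * RR κ η Z k X - lam * R1 k X - f k X) X := by
    intro k X
    have := G_deriv2 (H.hP k) (H.hQ k) (hfCB k) X
    rw [H.hPQ] at this
    rw [hRG k]
    exact this
  set V1 : ℕ → ℝ → ℝ := fun k X => a1 X / σ * dl k + R1 k X with hV1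
  have hd1 : ∀ k X, HasDerivAt (V k) (V1 k X) X := fun k X =>
    (((da X).div_const σ).mul_const (dl k)).add (dR k X)
  set V2 : ℕ → ℝ → ℝ := fun k X => B k X + m k * V k X - lam * V1 k X with hV2
  have hV0 : ∀ k, k ≠ 0 → ∀ X, V k X = RR κ η Z k X := fun k hk X => by simp [hV, VV, dl, hk]
  have hV10 : ∀ k, k ≠ 0 → ∀ X, V1 k X = R1 k X := fun k hk X => by simp [hV1, dl, hk]
  have hf0 : ∀ k, k ≠ 0 → ∀ X, f k X = - B k X := fun k hk X => by simp [hf, ff, hk, hB, hV]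
  have hd2 : ∀ k X, HasDerivAt (V1 k) (V2 k X) X := by
    intro k X
    have h := (((da1 X).div_const σ).mul_const (dl k)).add (dR1 k X)
    refine h.congr_deriv ?_
    by_cases hk : k = 0
    · subst hk
      have e1 : f 0 X = 2 * RR κ η Z 0 X + σ * A X ^ 2 - B 0 X := by simp [hf, ff, hB, hV, hσd]
      have e2 : V 0 X = A X + RR κ η Z 0 X := by simp [hV, VV, dl]
      simp only [hV2, hm0, hV1]
      rw [e1, e2, H.hm0]
      simp only [hA, dl, if_true]
      field_simp
      ring
    · simp only [hV2]
      rw [hV0 k hk, hV10 k hk, hf0 k hk, hm k hk]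
      simp only [dl, hk, if_false]; ring
  have hV1c : ∀ k, Continuous (V1 k) := fun k => continuous_iff_continuousAt.2 fun X => (hd2 k X).continuousAt
  have hVc : ∀ k, Continuous (V k) := fun k => continuous_iff_continuousAt.2 fun X => (hd1 k X).continuousAt
  -- bounds
  set F := C * S2 * N * N with hF
  have hF0 : 0 ≤ F := by positivity
  have hlam : 0 < lam := H.hκ.trans H.hκl
  have hkb1 : ∀ k, k ≠ 0 → ∀ X, |V1 k X| ≤ 4 * F / ((k:ℝ)+1)^3 := by
    intro k hk X
    have hp := H.hP k
    have hq := H.hQ k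
    have hfb : ∀ x, |f k x| ≤ F / ((k:ℝ)+1)^2 := fun x => by rw [hf0 k hk, abs_neg]; exact hBb k x
    have g1 := G_le hp hq (hfCB k) hfb X
    have g2 := J_le hp (hfCB k) hfb X
    have hP2 : ((k:ℝ)+1)/2 ≤ P k := by
      have h1 := H.hm k hk
      have h2 : ((k:ℝ)+1)^2 / 4 ≤ ((k:ℝ)+1)^2 / (2 * ε^2) := by
        gcongr; nlinarith
      have h3 : P k * Q k ≤ P k * P k := by
        have := H.hPQ k
        gcongr; linarith
      by_contra hcon
      push Not at hcon
      have := mul_self_lt_mul_self hp.le hcon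
      nlinarith
    rw [hV10 k hk]
    simp only [hR1]
    have e1 : |Q k * G (P k) (Q k) (f k) X| ≤ F / ((k:ℝ)+1)^2 / P k := by
      rw [abs_mul, abs_of_pos hq]
      calc _ ≤ Q k * (F / ((k:ℝ)+1)^2 / (P k * Q k)) := by gcongr
        _ = _ := by field_simp
    calc _ ≤ F / ((k:ℝ)+1)^2 / P k + F / ((k:ℝ)+1)^2 / P k := (abs_sub _ _).trans (add_le_add e1 g2)
      _ ≤ F / ((k:ℝ)+1)^2 / (((k:ℝ)+1)/2) + F / ((k:ℝ)+1)^2 / (((k:ℝ)+1)/2) := by gcongr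
      _ = _ := by field_simp; ring
  have hkb2 : ∀ k, k ≠ 0 → ∀ X, |V2 k X| ≤ (2 * F + lam * (4 * F)) / ((k:ℝ)+1)^2 := by
    intro k hk X
    have hp := H.hP k
    have hq := H.hQ k
    have hfb : ∀ x, |f k x| ≤ F / ((k:ℝ)+1)^2 := fun x => by rw [hf0 k hk, abs_neg]; exact hBb k x
    have g1 := G_le hp hq (hfCB k) hfb X
    have e1 : |m k * V k X| ≤ F / ((k:ℝ)+1)^2 := by
      rw [← hm k hk, hV0 k hk, hRG k, abs_mul, abs_of_pos (mul_pos hp hq)]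
      rw [le_div_iff₀ (mul_pos hp hq)] at g1
      linarith
    have e2 : |lam * V1 k X| ≤ lam * (4 * F) / ((k:ℝ)+1)^2 := by
      rw [abs_mul, abs_of_pos hlam, mul_div_assoc]
      gcongr
      refine (hkb1 k hk X).trans ?_
      gcongr
      · linarith [Nat.cast_nonneg (α := ℝ) k]
      · norm_num
    have e3 := hBb k X
    simp only [hV2]
    refine (abs_sub _ _).trans ((add_le_add ((abs_add_le _ _).trans (add_le_add e3 e1)) e2).trans (le_of_eq ?_))
    ring
  obtain ⟨K0, hK0⟩ : ∃ K, ∀ X, |V1 0 X| ≤ K := by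
    have b1 : ∀ X, |α X| ≤ hαCB.2.choose := hαCB.2.choose_spec
    have b2 : ∀ X, |f 0 X| ≤ (hfCB 0).2.choose := (hfCB 0).2.choose_spec
    refine ⟨(Q 0 * 1 + hαCB.2.choose / P 0) / σ * 1 + (Q 0 * ((hfCB 0).2.choose / (P 0 * Q 0)) + (hfCB 0).2.choose / P 0), fun X => ?_⟩
    have hq := H.hQ 0
    simp only [hV1, hR1, ha1, dl, if_true]
    refine (abs_add_le _ _).trans (add_le_add ?_ ?_)
    · rw [mul_one, mul_one, abs_div, abs_of_pos hσ]
      gcongr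
      refine (abs_sub _ _).trans (add_le_add ?_ (J_le (H.hP 0) hαCB b1 X))
      rw [abs_mul, abs_of_pos hq, abs_of_nonneg (H.a0 X)]
      gcongr; exact H.a1 X
    · refine (abs_sub _ _).trans (add_le_add ?_ (J_le (H.hP 0) (hfCB 0) b2 X))
      rw [abs_mul, abs_of_pos hq]
      gcongr
      exact G_le (H.hP 0) hq (hfCB 0) b2 X
  have hK0' : 0 ≤ K0 := (abs_nonneg _).trans (hK0 0)
  have hb0 : ∀ k X, |V k X| ≤ N * wt k := fun k X => hVW X k
  set K' := K0 + 4 * F + (F + N + lam * K0) + (2 * F + lam * (4 * F)) with hK'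
  have hZW : ∀ k X, |RR κ η Z k X| ≤ wt k * (Ph κ X * D) := by
    intro k X
    have h1 := wk_pos hη k
    have h3 := Ph_pos κ X
    simp only [RR]
    rw [cl_id ((hZb _).trans H.s3), abs_mul, abs_mul, abs_of_pos h1, abs_of_pos h3]
    have := wk_le H.hη1 k
    have := wt_pos k
    gcongr
    exact hZb _
  refine ⟨K', V, V1, V2, fun k => 1 / σ * dl k + l k, ⟨hd1, hd2, fun k => ?_, fun k X => ?_, hb0, fun k X => ?_, fun k X => ?_, fun k => ?_, fun k => ?_, fun k => ?_⟩⟩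
  · exact ((hBc k).add ((hVc k).const_mul _)).sub ((hV1c k).const_mul _)
  · simp only [hV2, hB]; ring
  · by_cases hk : k = 0
    · subst hk
      refine (hK0 X).trans ?_
      simp only [Nat.cast_zero, zero_add, one_pow, div_one, hK']
      linarith [mul_nonneg hlam.le hF0, mul_nonneg hlam.le hK0']
    · refine (hkb1 k hk X).trans ?_
      gcongr
      simp only [hK']
      linarith [mul_nonneg hlam.le hF0, mul_nonneg hlam.le hK0']
  · by_cases hk : k = 0
    · subst hk
      have e3 := hBb 0 X
      have e1 : |m 0 * V 0 X| ≤ N := by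
        rw [hm0, neg_one_mul, abs_neg]
        have := hb0 0 X
        rwa [wt_zero, mul_one] at this
      have e2 : |lam * V1 0 X| ≤ lam * K0 := by
        rw [abs_mul, abs_of_pos hlam]; gcongr; exact hK0 X
      simp only [hV2]
      simp only [Nat.cast_zero, zero_add, one_pow, div_one] at e3 ⊢
      refine (abs_sub _ _).trans ((add_le_add ((abs_add_le _ _).trans (add_le_add e3 e1)) e2).trans ?_)
      simp only [hK']
      linarith [mul_nonneg hlam.le hF0, mul_nonneg hlam.le hK0']
    · refine (hkb2 k hk X).trans ?_
      gcongr
      simp only [hK']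
      linarith [mul_nonneg hlam.le hF0, mul_nonneg hlam.le hK0']
  · have h1 : Tendsto (RR κ η Z k) atTop (𝓝 0) := by
      refine squeeze_zero_norm (a := fun X => wt k * (Ph κ X * D)) (fun X => hZW k X) ?_
      have := ((Ph_atTop H.hκ).mul_const D).const_mul (wt k)
      simpa using this
    have := ((haT.div_const σ).mul_const (dl k)).add h1
    rw [zero_div, zero_mul, zero_add] at this
    exact this
  · exact ((H.aB.div_const σ).mul_const (dl k)).add (hl k)
  · have : |l k| ≤ D * wt k := by
      refine le_of_tendsto (hl k).abs (Eventually.of_forall fun X => (hZW k X).trans ?_)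
      rw [mul_comm D]
      have := wt_pos k
      have h2 := Ph_le_one κ X
      gcongr
      nlinarith
    rwa [← hσd, add_sub_cancel_left]

end

theorem modes {c : ℕ → ℕ → ℕ → ℝ} {C lam : ℝ} (hC : 0 ≤ C)
    (hc : ∀ k n m, |c k n m| ≤ C * ((n+1)^2 * (m+1)^2 / ((k:ℝ)+1)^2)) (hσ : 0 < c 0 0 0) (hlam : 2 < lam) :
    ∃ ε₀ > (0:ℝ), ε₀ ≤ 1 ∧ ∃ D ≥ (0:ℝ), ∀ ε, 0 < ε → ε < ε₀ → ∀ m : ℕ → ℝ, m 0 = -1 →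
      (∀ k : ℕ, k ≠ 0 → ((k:ℝ)+1)^2 / (2 * ε^2) ≤ m k) →
      ∃ K' V V1 V2 l, Sol c lam (1 / c 0 0 0 + 1) (D * ε^2) K' m V V1 V2 l := by
  obtain ⟨κ, M, p, q, a, hp, hq, hpq, hpq1, hκ, hκl, hκ1, hM, ac, a0, a1, aB, aT, aM, aw, aG⟩ := front lam hlam
  have hth : th lam κ < 1 := th_lt hκ1
  have hth0 : 0 < th lam κ := th_pos
  have hS := S2_nonneg
  set t := th lam κ with ht
  set K1 := 2 * C * S2 * (1 / c 0 0 0 + 1) with hK1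
  have hK1n : 0 ≤ K1 := by positivity
  set L := (1 + t) / 2 with hL
  have hL1 : L < 1 := by linarith
  have hL0 : 0 < L := by linarith
  set η := min 1 ((1 - t) / 2 / (K1 + 1)) with hη
  have hη0 : 0 < η := lt_min one_pos (div_pos (by linarith) (by linarith))
  have hη1 : η ≤ 1 := min_le_left _ _
  have hηK : K1 * η ≤ (1 - t) / 2 := by
    have h1 : η ≤ (1 - t) / 2 / (K1 + 1) := min_le_right _ _
    rw [le_div_iff₀ (by linarith)] at h1
    linarith
  set K2 := C * M / c 0 0 0 ^ 2 with hK2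
  have hK2n : 0 ≤ K2 := by positivity
  have h1L : 0 < 1 - L := by linarith
  set W := 2 / η * K1 / L + 2 / η * K2 / (1 - L) / η + 1 with hW
  have w1 : 0 ≤ 2 / η * K1 / L := by positivity
  have w2 : 0 ≤ 2 / η * K2 / (1 - L) / η := by positivity
  have hW1 : 1 ≤ W := by linarith
  have hW0 : 0 < W := by linarith
  refine ⟨1 / W, by positivity, by rw [div_le_one hW0]; exact hW1, 2 / η * K2 / (1 - L), by positivity, ?_⟩
  intro ε hε hεW m hm0 hm
  have hεW1 : ε * W < 1 := by rwa [lt_div_iff₀ hW0] at hεW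
  have hε1 : ε ≤ 1 := by
    by_contra hcon
    push Not at hcon
    have : 1 * 1 ≤ ε * W := mul_le_mul hcon.le hW1 zero_le_one hε.le
    linarith
  have hε2W : ε^2 * W ≤ 1 := by
    have : ε^2 * W = ε * (ε * W) := by ring
    rw [this]
    calc ε * (ε * W) ≤ 1 * 1 := mul_le_mul hε1 hεW1.le (by positivity) zero_le_one
      _ = 1 := one_mul 1
  have s2 : ε^2 * (2 / η * K1 / L) ≤ 1 := by
    refine le_trans ?_ hε2W
    gcongr
    linarith
  have s3 : ε^2 * (2 / η * K2 / (1 - L) / η) ≤ 1 := by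
    refine le_trans ?_ hε2W
    gcongr
    linarith
  have hmpos : ∀ k : ℕ, k ≠ 0 → 0 < m k := fun k hk => lt_of_lt_of_le (by positivity) (hm k hk)
  have hex : ∀ k : ℕ, ∃ r : ℝ × ℝ, 0 < r.1 ∧ 0 < r.2 ∧ r.1 - r.2 = lam ∧ (k = 0 → r = (p, q)) ∧ (k ≠ 0 → r.1 * r.2 = m k) := by
    intro k
    by_cases hk : k = 0
    · exact ⟨(p, q), hp, hq, hpq, fun _ => rfl, fun h => absurd hk h⟩
    · obtain ⟨p', q', h1, h2, h3, h4⟩ := exists_pq (by linarith : 0 < lam) (hmpos k hk)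
      exact ⟨(p', q'), h1, h2, h3, fun h => absurd h hk, fun _ => h4⟩
  choose r hr1 hr2 hr3 hr4 hr5 using hex
  have hr0 := hr4 0 rfl
  have H : Hyp c C κ η M lam ε L a (fun k => (r k).1) (fun k => (r k).2) :=
    { hC := hC, hc := hc, hη0 := hη0, hη1 := hη1, ac := ac, a0 := a0, a1 := a1, aw := aw, aM := aM, aB := aB,
      hM := hM, hσ := hσ, hκ := hκ, hκl := hκl, hκ1 := hκ1, hP := hr1, hQ := hr2, hPQ := hr3,
      hm0 := by simp only [hr0]; exact hpq1
      hε := hε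
      hm := fun k hk => by rw [hr5 k hk]; exact hm k hk
      s1 := by rw [← ht, ← hK1]; linarith
      s2 := by
        rw [← hK1]
        have e : 2 * ε^2 / η * K1 = ε^2 * (2 / η * K1 / L) * L := by field_simp
        rw [e]
        exact mul_le_of_le_one_left hL0.le s2
      hL := hL1
      s3 := by
        rw [← hK2]
        have e : 2 * ε^2 / η * K2 / (1 - L) = ε^2 * (2 / η * K2 / (1 - L) / η) * η := by field_simp
        rw [e]
        exact mul_le_of_le_one_left hη0.le s3 }
  have := sol_of_hyp H hε1 aT (by simp only [hr0]; exact aG) m hm0 hr5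
  rw [← hK2] at this
  have e : 2 * ε^2 / η * K2 / (1 - L) = 2 / η * K2 / (1 - L) * ε^2 := by ring
  rw [e] at this
  exact this

end FK

end

section

open Real Set Filter Topology MeasureTheory

namespace FK

/-- separated series -/
noncomputable def ser (A φ : ℕ → ℝ → ℝ) (p : ℝ × ℝ) : ℝ := ∑' k, A k p.1 * φ k p.2

/-- domination of a separated series -/
def dom (A φ : ℕ → ℝ → ℝ) (B : ℝ) : Prop := ∀ k x y, |A k x * φ k y| ≤ B * (1 / ((k:ℝ)+1)^2)

lemma dom_summable {A φ : ℕ → ℝ → ℝ} {B : ℝ} (h : dom A φ B) (x y : ℝ) : Summable (fun k => A k x * φ k y) :=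
  Summable.of_norm_bounded (summable_sq.mul_left B) fun k => h k x y

lemma ser_le {A φ : ℕ → ℝ → ℝ} {B : ℝ} (h : dom A φ B) (p : ℝ × ℝ) :
    |ser A φ p| ≤ B * ∑' k : ℕ, 1 / ((k:ℝ)+1)^2 := by
  rw [← tsum_mul_left]
  exact tsum_of_norm_bounded (f := fun k => A k p.1 * φ k p.2) (summable_sq.mul_left B).hasSum fun k => h k p.1 p.2

lemma ser_cont {A φ : ℕ → ℝ → ℝ} {B : ℝ} (h : dom A φ B) (hA : ∀ k, Continuous (A k)) (hφ : ∀ k, Continuous (φ k)) :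
    Continuous (ser A φ) := by
  refine continuous_tsum (fun k => ?_) (summable_sq.mul_left B) (fun k p => h k p.1 p.2)
  have := hA k
  have := hφ k
  fun_prop

lemma ser_fd {A φ A1 φ1 : ℕ → ℝ → ℝ} {B B1 B2 : ℝ} (h : dom A φ B) (h1 : dom A1 φ B1) (h2 : dom A φ1 B2)
    (dA : ∀ k x, HasDerivAt (A k) (A1 k x) x) (dφ : ∀ k y, HasDerivAt (φ k) (φ1 k y) y) (p : ℝ × ℝ) :
    HasFDerivAt (ser A φ) (ser A1 φ p • ContinuousLinearMap.fst ℝ ℝ ℝ + ser A φ1 p • ContinuousLinearMap.snd ℝ ℝ ℝ) p := by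
  have hS : (∑' k, ((A1 k p.1 * φ k p.2) • ContinuousLinearMap.fst ℝ ℝ ℝ + (A k p.1 * φ1 k p.2) • ContinuousLinearMap.snd ℝ ℝ ℝ))
      = ser A1 φ p • ContinuousLinearMap.fst ℝ ℝ ℝ + ser A φ1 p • ContinuousLinearMap.snd ℝ ℝ ℝ := by
    refine HasSum.tsum_eq ?_
    exact ((dom_summable h1 p.1 p.2).hasSum.smul_const _).add ((dom_summable h2 p.1 p.2).hasSum.smul_const _)
  rw [← hS]
  refine hasFDerivAt_tsum (f := fun k (p : ℝ × ℝ) => A k p.1 * φ k p.2)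
    (f' := fun k p => (A1 k p.1 * φ k p.2) • ContinuousLinearMap.fst ℝ ℝ ℝ + (A k p.1 * φ1 k p.2) • ContinuousLinearMap.snd ℝ ℝ ℝ)
    (u := fun k : ℕ => (B1 + B2) * (1 / ((k:ℝ)+1)^2)) (x₀ := p) (summable_sq.mul_left _) ?_ ?_ (dom_summable h p.1 p.2) p
  · intro k x
    have e1 : HasFDerivAt (fun p : ℝ × ℝ => A k p.1) (A1 k x.1 • ContinuousLinearMap.fst ℝ ℝ ℝ) x :=
      (dA k x.1).comp_hasFDerivAt x (hasFDerivAt_fst)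
    have e2 : HasFDerivAt (fun p : ℝ × ℝ => φ k p.2) (φ1 k x.2 • ContinuousLinearMap.snd ℝ ℝ ℝ) x :=
      (dφ k x.2).comp_hasFDerivAt x (hasFDerivAt_snd)
    refine (e1.mul e2).congr_fderiv ?_
    rw [smul_smul, smul_smul, add_comm, mul_comm (φ k x.2)]
  · intro k x
    refine (norm_add_le _ _).trans ?_
    rw [norm_smul, norm_smul, add_mul]
    have n1 := ContinuousLinearMap.norm_fst_le ℝ ℝ ℝ
    have n2 := ContinuousLinearMap.norm_snd_le ℝ ℝ ℝ
    have m1 := h1 k x.1 x.2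
    have m2 := h2 k x.1 x.2
    rw [norm_eq_abs, norm_eq_abs]
    exact add_le_add ((mul_le_of_le_one_right (abs_nonneg _) n1).trans m1) ((mul_le_of_le_one_right (abs_nonneg _) n2).trans m2)

lemma cd_succ {n : ℕ} {u ux uy : ℝ × ℝ → ℝ}
    (h : ∀ p, HasFDerivAt u (ux p • ContinuousLinearMap.fst ℝ ℝ ℝ + uy p • ContinuousLinearMap.snd ℝ ℝ ℝ) p)
    (hx : ContDiff ℝ n ux) (hy : ContDiff ℝ n uy) : ContDiff ℝ (n + 1) u := by
  rw [contDiff_succ_iff_hasFDerivAt]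
  exact ⟨_, (hx.smul contDiff_const).add (hy.smul contDiff_const), h⟩

lemma pdx_eq {u ux uy : ℝ × ℝ → ℝ}
    (h : ∀ p, HasFDerivAt u (ux p • ContinuousLinearMap.fst ℝ ℝ ℝ + uy p • ContinuousLinearMap.snd ℝ ℝ ℝ) p) :
    pdx u = ux := by
  ext p
  have h1 : HasDerivAt (fun t : ℝ => (t, p.2)) ((1:ℝ), (0:ℝ)) p.1 := (hasDerivAt_id p.1).prodMk (hasDerivAt_const _ _)
  have := (HasFDerivAt.comp_hasDerivAt (l := u) p.1 (h (p.1, p.2)) h1).deriv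
  simp at this
  exact this

lemma pdy_eq {u ux uy : ℝ × ℝ → ℝ}
    (h : ∀ p, HasFDerivAt u (ux p • ContinuousLinearMap.fst ℝ ℝ ℝ + uy p • ContinuousLinearMap.snd ℝ ℝ ℝ) p) :
    pdy u = uy := by
  ext p
  have h1 : HasDerivAt (fun t : ℝ => (p.1, t)) ((0:ℝ), (1:ℝ)) p.2 := (hasDerivAt_const _ _).prodMk (hasDerivAt_id p.2)
  have := (HasFDerivAt.comp_hasDerivAt (l := u) p.2 (h (p.1, p.2)) h1).deriv
  simp at this
  exact this

lemma quad {c : ℕ → ℕ → ℕ → ℝ} {C N y : ℝ} {ρ : ℕ → ℝ} (hC : 0 ≤ C)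
    (hc : ∀ k n m, |c k n m| ≤ C * ((n+1)^2 * (m+1)^2 / ((k:ℝ)+1)^2))
    (hs : ∀ n m, HasSum (fun k => c k n m * cos (ρ k * y)) (cos (ρ n * y) * cos (ρ m * y)))
    {v : ℕ → ℝ} (hv : WB N v) :
    ∑' k, Bf c k v v * cos (ρ k * y) = (∑' n, v n * cos (ρ n * y))^2 := by
  have hsum : Summable (Function.uncurry fun (k : ℕ) (x : ℕ × ℕ) => c k x.1 x.2 * v x.1 * v x.2 * cos (ρ k * y)) := by
    have hb := (summable_sq.mul_of_nonneg bd_summable (fun k => by simp only [Pi.zero_apply]; positivity) bd_nonneg).mul_left (C * N * N)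
    refine Summable.of_norm_bounded hb fun z => ?_
    have h1 := Bf_term hC hc z.1 hv hv z.2
    simp only [Function.uncurry]
    rw [norm_mul]
    refine (mul_le_of_le_one_right (norm_nonneg _) (abs_cos_le_one _)).trans (h1.trans (le_of_eq ?_))
    ring
  have h1 := hsum.tsum_comm
  have e1 : ∀ k, Bf c k v v * cos (ρ k * y) = ∑' x : ℕ × ℕ, c k x.1 x.2 * v x.1 * v x.2 * cos (ρ k * y) := fun k => by
    rw [tsum_mul_right]; rfl
  simp_rw [e1]
  rw [← h1]
  have hn : Summable fun n => ‖v n * cos (ρ n * y)‖ := by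
    refine Summable.of_nonneg_of_le (fun _ => norm_nonneg _) (fun n => ?_) (wt_summable.mul_left N)
    rw [norm_mul]
    exact (mul_le_of_le_one_right (norm_nonneg _) (abs_cos_le_one _)).trans (hv n)
  rw [sq, tsum_mul_tsum_of_summable_norm hn hn]
  refine tsum_congr fun x => ?_
  have h2 := ((hs x.1 x.2).mul_left (v x.1 * v x.2)).tsum_eq
  calc _ = ∑' k, v x.1 * v x.2 * (c k x.1 x.2 * cos (ρ k * y)) := tsum_congr fun k => by ring
    _ = _ := by rw [h2]; ring

lemma unif_lim {V : ℕ → ℝ → ℝ} {l : ℕ → ℝ} {N : ℝ} {F : Filter ℝ} [F.NeBot] (hb : ∀ k X, |V k X| ≤ N * wt k)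
    (hl : ∀ k, Tendsto (V k) F (𝓝 (l k))) :
    (∀ k, |l k| ≤ N * wt k) ∧ Tendsto (fun X => ∑' k, |V k X - l k|) F (𝓝 0) := by
  have h1 : ∀ k, |l k| ≤ N * wt k := fun k => le_of_tendsto (hl k).abs (Eventually.of_forall (hb k))
  refine ⟨h1, ?_⟩
  have := tendsto_tsum_of_dominated_convergence (𝓕 := F) (f := fun X k => |V k X - l k|) (g := fun _ => (0:ℝ))
    (bound := fun k => (2 * N) * wt k) (wt_summable.mul_left _) ?_ ?_
  · simpa using this
  · intro k
    have := ((hl k).sub_const (l k)).abs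
    simpa using this
  · refine Eventually.of_forall fun X k => ?_
    rw [norm_eq_abs, abs_abs]
    have := (abs_sub (V k X) (l k)).trans (add_le_add (hb k X) (h1 k))
    linarith

/-- comparison of cosine series -/
lemma cos_diff {v w : ℕ → ℝ} {N : ℝ} (hv : WB N v) (hw : WB N w) (ρ : ℕ → ℝ) (y : ℝ) :
    |∑' k, v k * cos (ρ k * y) - ∑' k, w k * cos (ρ k * y)| ≤ ∑' k, |v k - w k| := by
  have hs : ∀ {v : ℕ → ℝ}, WB N v → Summable fun k => v k * cos (ρ k * y) := fun {v} hv => by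
    refine Summable.of_norm_bounded (wt_summable.mul_left N) fun k => ?_
    rw [norm_mul]
    exact (mul_le_of_le_one_right (norm_nonneg _) (abs_cos_le_one _)).trans (hv k)
  rw [← (hs hv).tsum_sub (hs hw)]
  have hsum : Summable fun k => |v k - w k| := by
    refine Summable.of_nonneg_of_le (fun _ => abs_nonneg _) (fun k => ?_) (wt_summable.mul_left (2 * N))
    have := (abs_sub (v k) (w k)).trans (add_le_add (hv k) (hw k))
    linarith
  refine tsum_of_norm_bounded (f := fun k => v k * cos (ρ k * y) - w k * cos (ρ k * y)) hsum.hasSum fun k => ?_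
  rw [← sub_mul, norm_mul]
  exact mul_le_of_le_one_right (norm_nonneg _) (abs_cos_le_one _)

end FK

end

/-- Slow invasion fronts in the two-dimensional Fisher--KPP equation. -/
theorem fkpp_slow_fronts (β lam₁ ρ₀ σ : ℝ) (hβ : 0 < β) (hlam₁ : 2 < lam₁)
    (hρ₀ : ρ₀ ∈ Ioo (0 : ℝ) (π / 2)) (hρ₀β : ρ₀ * Real.tan ρ₀ = β)
    (hσ : σ = 4 * Real.sin ρ₀ * (3 - (Real.sin ρ₀) ^ 2) / (3 * (2 * ρ₀ + Real.sin (2 * ρ₀)))) :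
    ∃ ε₀ > (0 : ℝ), ∃ C > (0 : ℝ), ∀ ε : ℝ, 0 < ε → ε < ε₀ →
      ∃ u : ℝ × ℝ → ℝ,
        -- twice continuously differentiable (up to the boundary of the strip)
        ContDiff ℝ 2 u ∧
        -- bounded together with its derivatives up to order two on the closed strip
        (∃ K : ℝ, ∀ x : ℝ, ∀ y ∈ Icc (0 : ℝ) 1,
          |u (x, y)| ≤ K ∧ |pdx u (x, y)| ≤ K ∧ |pdy u (x, y)| ≤ K ∧
          |pdx (pdx u) (x, y)| ≤ K ∧ |pdy (pdx u) (x, y)| ≤ K ∧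
          |pdx (pdy u) (x, y)| ≤ K ∧ |pdy (pdy u) (x, y)| ≤ K) ∧
        -- the PDE Δu + lam₁ε u_x + u(ρ₀² + ε² − u) = 0 in Ω = ℝ × (0,1)
        (∀ x : ℝ, ∀ y ∈ Ioo (0 : ℝ) 1,
          pdx (pdx u) (x, y) + pdy (pdy u) (x, y) + lam₁ * ε * pdx u (x, y)
            + u (x, y) * (ρ₀ ^ 2 + ε ^ 2 - u (x, y)) = 0) ∧
        -- boundary conditions: u_y = 0 at y = 0 and u_y + βu = 0 at y = 1
        (∀ x : ℝ, pdy u (x, 0) = 0 ∧ pdy u (x, 1) + β * u (x, 1) = 0) ∧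
        -- (i) smallness
        (∀ x : ℝ, ∀ y ∈ Icc (0 : ℝ) 1, |u (x, y)| ≤ C * ε ^ 2) ∧
        -- (ii) decay to 0, uniformly in y, as x → +∞
        (∀ δ > (0 : ℝ), ∃ X : ℝ, ∀ x ≥ X, ∀ y ∈ Icc (0 : ℝ) 1, |u (x, y)| ≤ δ) ∧
        -- (iii) nontrivial uniform limit as x → −∞
        (∃ uminus : ℝ → ℝ,
          (∀ δ > (0 : ℝ), ∃ X : ℝ, ∀ x ≤ X, ∀ y ∈ Icc (0 : ℝ) 1,
            |u (x, y) - uminus y| ≤ δ) ∧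
          (∀ y ∈ Icc (0 : ℝ) 1,
            |uminus y - (ε ^ 2 / σ) * Real.cos (ρ₀ * y)| ≤ C * ε ^ 3) ∧
          (∃ y ∈ Icc (0 : ℝ) 1, uminus y ≠ 0)) := by
  obtain ⟨ρ, c, C0, hC0, hρ0, hc0, hbc, hρpos, hρle, hρgap, hcs, hcb, hexp⟩ := FK.spectral hβ hρ₀ hρ₀β hσ
  have hσ0 : 0 < σ := by
    have h1 : 0 < Real.sin ρ₀ := Real.sin_pos_of_pos_of_lt_pi hρ₀.1 (by linarith [hρ₀.2, Real.pi_pos])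
    have h2 : 0 < Real.sin (2 * ρ₀) := Real.sin_pos_of_pos_of_lt_pi (by linarith [hρ₀.1]) (by linarith [hρ₀.2])
    have h3 := Real.sin_sq_le_one ρ₀
    have h4 := hρ₀.1
    have h5 : 0 < 3 - Real.sin ρ₀ ^ 2 := by linarith
    rw [hσ]; positivity
  have hc0' : 0 < c 0 0 0 := by rw [hc0]; exact hσ0
  obtain ⟨ε₀, hε₀, hε₀1, D, hD, hmain⟩ := FK.modes hC0 hcb hc0' hlam₁
  rw [hc0] at hmain
  obtain ⟨S, hS⟩ : ∃ S, S = ∑' k, FK.wt k := ⟨_, rfl⟩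
  have hS0 : 0 ≤ S := by rw [hS]; exact tsum_nonneg fun k => (FK.wt_pos k).le
  have hWs : ∀ {v : ℕ → ℝ} {B : ℝ}, (∀ k, |v k| ≤ B * FK.wt k) → (∑' k, |v k|) ≤ B * S := by
    intro v B hv
    rw [hS, ← tsum_mul_left]
    have hs := FK.wt_summable.mul_left B
    exact (Summable.of_nonneg_of_le (fun _ => abs_nonneg _) hv hs).tsum_le_tsum hv hs
  obtain ⟨N, hN⟩ : ∃ N, N = 1 / σ + 1 := ⟨_, rfl⟩
  have hN0 : 0 < N := by rw [hN]; positivity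
  rw [← hN] at hmain
  refine ⟨min ε₀ (1 / (D * S * σ + 1)), lt_min hε₀ (by positivity), N * S + D * S + 1, by positivity, ?_⟩
  intro ε hε hεlt
  have hεε₀ : ε < ε₀ := lt_of_lt_of_le hεlt (min_le_left _ _)
  have hεD : ε * (D * S * σ + 1) < 1 := by
    have := lt_of_lt_of_le hεlt (min_le_right _ _)
    rwa [lt_div_iff₀ (by positivity)] at this
  have hε1 : ε ≤ 1 := by linarith
  obtain ⟨m, hm⟩ : ∃ m : ℕ → ℝ, m = fun k => (ρ k ^ 2 - ρ₀ ^ 2) / ε ^ 2 - 1 := ⟨_, rfl⟩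
  have hm0 : m 0 = -1 := by rw [hm]; simp [hρ0]
  have hmk : ∀ k : ℕ, k ≠ 0 → ((k:ℝ)+1)^2 / (2 * ε^2) ≤ m k := by
    intro k hk
    have h1 : (1:ℝ) ≤ k := by exact_mod_cast Nat.one_le_iff_ne_zero.2 hk
    have h2 := hρgap k (Nat.one_le_iff_ne_zero.2 hk)
    rw [hm]
    have h3 : ((k:ℝ)+1)^2 / ε^2 ≤ (ρ k ^ 2 - ρ₀ ^ 2) / ε ^ 2 := by gcongr
    have h4 : 1 ≤ ((k:ℝ)+1)^2 / (2 * ε^2) := by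
      rw [one_le_div (by positivity)]
      have : ε^2 ≤ 1 := pow_le_one₀ hε.le hε1
      nlinarith
    have h5 : ((k:ℝ)+1)^2 / ε^2 = 2 * (((k:ℝ)+1)^2 / (2 * ε^2)) := by field_simp
    linarith
  obtain ⟨K', V, V1, V2, l, hV⟩ := hmain ε hε hεε₀ m hm0 hmk
  have hK' : 0 ≤ K' := by
    have := (abs_nonneg _).trans (hV.b1 0 0)
    simpa using this
  have hN1 : FK.WB N (fun k => l k) := (FK.unif_lim hV.b0 hV.bot).1
  obtain ⟨A, hA⟩ : ∃ A : ℕ → ℝ → ℝ, A = fun k x => ε^2 * V k (ε * x) := ⟨_, rfl⟩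
  obtain ⟨A1, hA1⟩ : ∃ A : ℕ → ℝ → ℝ, A = fun k x => ε^3 * V1 k (ε * x) := ⟨_, rfl⟩
  obtain ⟨A2, hA2⟩ : ∃ A : ℕ → ℝ → ℝ, A = fun k x => ε^4 * V2 k (ε * x) := ⟨_, rfl⟩
  obtain ⟨f, hf⟩ : ∃ f : ℕ → ℝ → ℝ, f = fun k y => Real.cos (ρ k * y) := ⟨_, rfl⟩
  obtain ⟨f1, hf1⟩ : ∃ f : ℕ → ℝ → ℝ, f = fun k y => -(ρ k * Real.sin (ρ k * y)) := ⟨_, rfl⟩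
  obtain ⟨f2, hf2⟩ : ∃ f : ℕ → ℝ → ℝ, f = fun k y => -(ρ k * (ρ k * Real.cos (ρ k * y))) := ⟨_, rfl⟩
  have hlin : ∀ x : ℝ, HasDerivAt (fun x => ε * x) ε x := fun x => by
    simpa using (hasDerivAt_id x).const_mul ε
  have dA : ∀ k x, HasDerivAt (A k) (A1 k x) x := by
    intro k x
    rw [hA, hA1]
    have := ((hV.d1 k (ε * x)).comp x (hlin x)).const_mul (ε^2)
    refine this.congr_deriv ?_
    ring
  have dA1 : ∀ k x, HasDerivAt (A1 k) (A2 k x) x := by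
    intro k x
    rw [hA1, hA2]
    have := ((hV.d2 k (ε * x)).comp x (hlin x)).const_mul (ε^3)
    refine this.congr_deriv ?_
    ring
  have df : ∀ k y, HasDerivAt (f k) (f1 k y) y := by
    intro k y
    rw [hf, hf1]
    exact FK.cos_d _ _
  have df1 : ∀ k y, HasDerivAt (f1 k) (f2 k y) y := by
    intro k y
    rw [hf1, hf2]
    exact ((FK.sin_d _ _).const_mul _).neg
  have cA : ∀ k, Continuous (A k) := fun k => continuous_iff_continuousAt.2 fun X => (dA k X).continuousAt
  have cA1 : ∀ k, Continuous (A1 k) := fun k => continuous_iff_continuousAt.2 fun X => (dA1 k X).continuousAt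
  have cA2 : ∀ k, Continuous (A2 k) := fun k => by
    rw [hA2]
    have := hV.c2 k
    fun_prop
  have cf : ∀ k, Continuous (f k) := fun k => continuous_iff_continuousAt.2 fun X => (df k X).continuousAt
  have cf1 : ∀ k, Continuous (f1 k) := fun k => continuous_iff_continuousAt.2 fun X => (df1 k X).continuousAt
  have cf2 : ∀ k, Continuous (f2 k) := fun k => by rw [hf2]; fun_prop
  have hk1 : ∀ k : ℕ, (1:ℝ) ≤ (k:ℝ) + 1 := fun k => by linarith [Nat.cast_nonneg (α := ℝ) k]
  have bA : ∀ k x, |A k x| ≤ N / ((k:ℝ)+1)^4 := by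
    intro k x
    rw [hA]
    simp only
    rw [abs_mul, abs_of_nonneg (by positivity : 0 ≤ ε^2)]
    refine (mul_le_of_le_one_left (abs_nonneg _) (pow_le_one₀ hε.le hε1)).trans ((hV.b0 k _).trans (le_of_eq ?_))
    unfold FK.wt; ring
  have bA1 : ∀ k x, |A1 k x| ≤ K' / ((k:ℝ)+1)^3 := by
    intro k x
    rw [hA1]
    simp only
    rw [abs_mul, abs_of_nonneg (by positivity : 0 ≤ ε^3)]
    exact (mul_le_of_le_one_left (abs_nonneg _) (pow_le_one₀ hε.le hε1)).trans (hV.b1 k _)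
  have bA2 : ∀ k x, |A2 k x| ≤ K' / ((k:ℝ)+1)^2 := by
    intro k x
    rw [hA2]
    simp only
    rw [abs_mul, abs_of_nonneg (by positivity : 0 ≤ ε^4)]
    exact (mul_le_of_le_one_left (abs_nonneg _) (pow_le_one₀ hε.le hε1)).trans (hV.b2 k _)
  have bf : ∀ k y, |f k y| ≤ 1 := by
    intro k y; rw [hf]; exact Real.abs_cos_le_one _
  have bf1 : ∀ k y, |f1 k y| ≤ π * ((k:ℝ)+1) := by
    intro k y; rw [hf1]
    simp only
    rw [abs_neg, abs_mul, abs_of_pos (hρpos k)]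
    exact (mul_le_of_le_one_right (hρpos k).le (Real.abs_sin_le_one _)).trans (hρle k)
  have bf2 : ∀ k y, |f2 k y| ≤ (π * ((k:ℝ)+1))^2 := by
    intro k y; rw [hf2]
    simp only
    rw [abs_neg, abs_mul, abs_mul, abs_of_pos (hρpos k), sq]
    have h1 := hρle k
    have h2 := hρpos k
    exact mul_le_mul h1 ((mul_le_of_le_one_right (hρpos k).le (Real.abs_cos_le_one _)).trans h1) (by positivity) (by positivity)
  have hpi := Real.pi_pos
  have D00 : FK.dom A f N := by
    intro k x y
    have h := hk1 k
    rw [abs_mul]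
    calc _ ≤ N / ((k:ℝ)+1)^4 * 1 := mul_le_mul (bA k x) (bf k y) (abs_nonneg _) (by positivity)
      _ ≤ N / ((k:ℝ)+1)^2 * 1 := by gcongr; norm_num
      _ = _ := by ring
  have D10 : FK.dom A1 f K' := by
    intro k x y
    have h := hk1 k
    rw [abs_mul]
    calc _ ≤ K' / ((k:ℝ)+1)^3 * 1 := mul_le_mul (bA1 k x) (bf k y) (abs_nonneg _) (by positivity)
      _ ≤ K' / ((k:ℝ)+1)^2 * 1 := by gcongr; norm_num
      _ = _ := by ring
  have D20 : FK.dom A2 f K' := by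
    intro k x y
    rw [abs_mul]
    calc _ ≤ K' / ((k:ℝ)+1)^2 * 1 := mul_le_mul (bA2 k x) (bf k y) (abs_nonneg _) (by positivity)
      _ = _ := by ring
  have D01 : FK.dom A f1 (N * π) := by
    intro k x y
    have h := hk1 k
    rw [abs_mul]
    calc _ ≤ N / ((k:ℝ)+1)^4 * (π * ((k:ℝ)+1)) := mul_le_mul (bA k x) (bf1 k y) (abs_nonneg _) (by positivity)
      _ = N * π / ((k:ℝ)+1)^3 := by field_simp
      _ ≤ N * π / ((k:ℝ)+1)^2 := by gcongr; norm_num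
      _ = _ := by ring
  have D11 : FK.dom A1 f1 (K' * π) := by
    intro k x y
    rw [abs_mul]
    calc _ ≤ K' / ((k:ℝ)+1)^3 * (π * ((k:ℝ)+1)) := mul_le_mul (bA1 k x) (bf1 k y) (abs_nonneg _) (by positivity)
      _ = _ := by field_simp
  have D02 : FK.dom A f2 (N * π^2) := by
    intro k x y
    rw [abs_mul]
    calc _ ≤ N / ((k:ℝ)+1)^4 * (π * ((k:ℝ)+1))^2 := mul_le_mul (bA k x) (bf2 k y) (abs_nonneg _) (by positivity)
      _ = _ := by field_simp
  have F00 := FK.ser_fd D00 D10 D01 dA df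
  have F10 := FK.ser_fd D10 D20 D11 dA1 df
  have F01 := FK.ser_fd D01 D11 D02 dA df1
  have ex := FK.pdx_eq F00
  have ey := FK.pdy_eq F00
  have exx := FK.pdx_eq F10
  have exy := FK.pdy_eq F10
  have eyx := FK.pdx_eq F01
  have eyy := FK.pdy_eq F01
  have hu : ∀ x y, FK.ser A f (x, y) = ε^2 * ∑' k, V k (ε * x) * Real.cos (ρ k * y) := by
    intro x y
    rw [← tsum_mul_left]
    refine tsum_congr fun k => ?_
    rw [hA, hf]; simp only; ring
  have hWB : ∀ X, FK.WB N (fun k => V k X) := fun X k => hV.b0 k X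
  have hWB0 : FK.WB N (fun _ => 0) := fun k => by
    rw [abs_zero]; exact mul_nonneg hN0.le (FK.wt_pos k).le
  have habs : ∀ x y, |FK.ser A f (x, y)| ≤ ε^2 * ∑' k, |V k (ε * x)| := by
    intro x y
    rw [hu, abs_mul, abs_of_nonneg (by positivity : 0 ≤ ε^2)]
    have := FK.cos_diff (hWB (ε * x)) hWB0 ρ y
    simp only [zero_mul, tsum_zero, sub_zero] at this
    gcongr
  have hε2 : ε^2 ≤ 1 := pow_le_one₀ hε.le hε1
  have hm1 : ∀ y, |(∑' k, l k * Real.cos (ρ k * y)) - 1 / σ * Real.cos (ρ₀ * y)| ≤ D * ε^2 * S := by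
    intro y
    have hW2 : FK.WB N (fun k => 1 / σ * FK.dl k) := by
      intro k
      have := FK.wt_pos k
      by_cases hk : k = 0
      · subst hk
        rw [FK.wt_zero]
        simp only [FK.dl, if_true]
        rw [abs_of_pos (by positivity), hN]; linarith
      · simp only [FK.dl, hk, if_false, mul_zero, abs_zero]
        positivity
    have h1 := FK.cos_diff hN1 hW2 ρ y
    have h2 : ∑' k, 1 / σ * FK.dl k * Real.cos (ρ k * y) = 1 / σ * Real.cos (ρ₀ * y) := by
      rw [tsum_eq_single 0]
      · simp [FK.dl, hρ0]
      · intro k hk; simp [FK.dl, hk]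
    rw [h2] at h1
    refine h1.trans (hWs fun k => ?_)
    have := hV.lim k
    rwa [hc0] at this
  refine ⟨FK.ser A f, ?_, ?_, ?_, ?_, ?_, ?_, ?_⟩
  · have c10 : ContDiff ℝ ((0:ℕ) + 1) (FK.ser A1 f) := FK.cd_succ F10
      (by simpa using FK.ser_cont D20 cA2 cf) (by simpa using FK.ser_cont D11 cA1 cf1)
    have c01 : ContDiff ℝ ((0:ℕ) + 1) (FK.ser A f1) := FK.cd_succ F01
      (by simpa using FK.ser_cont D11 cA1 cf1) (by simpa using FK.ser_cont D02 cA cf2)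
    have : ContDiff ℝ ((1:ℕ) + 1) (FK.ser A f) := FK.cd_succ F00 (by simpa using c10) (by simpa using c01)
    have e : (((1:ℕ) : WithTop ℕ∞) + 1) = 2 := by norm_num
    rwa [e] at this
  · rw [ex, ey, exx, exy, eyx, eyy]
    obtain ⟨T, hT⟩ : ∃ T, T = ∑' k : ℕ, 1 / ((k:ℝ)+1)^2 := ⟨_, rfl⟩
    have hT0 : 0 ≤ T := by rw [hT]; exact tsum_nonneg fun k => by positivity
    have t1 : 0 ≤ N * T := by positivity
    have t2 : 0 ≤ K' * T := by positivity
    have t3 : 0 ≤ N * π * T := by positivity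
    have t4 : 0 ≤ K' * π * T := by positivity
    have t5 : 0 ≤ N * π^2 * T := by positivity
    refine ⟨N * T + K' * T + N * π * T + K' * π * T + N * π^2 * T, fun x y _ => ?_⟩
    have q1 := FK.ser_le D00 (x, y)
    have q2 := FK.ser_le D10 (x, y)
    have q3 := FK.ser_le D20 (x, y)
    have q4 := FK.ser_le D01 (x, y)
    have q5 := FK.ser_le D11 (x, y)
    have q6 := FK.ser_le D02 (x, y)
    rw [← hT] at q1 q2 q3 q4 q5 q6
    refine ⟨?_, ?_, ?_, ?_, ?_, ?_, ?_⟩ <;> linarith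
  · intro x y hy
    have hyI : y ∈ Icc (0:ℝ) 1 := ⟨hy.1.le, hy.2.le⟩
    rw [ex, ey, exx, eyy]
    have hq := FK.quad hC0 hcb (fun n m => hexp n m y hyI) (hWB (ε * x))
    have hsq : FK.ser A f (x, y) * FK.ser A f (x, y) = ε^4 * ∑' k, FK.Bf c k (fun n => V n (ε * x)) (fun n => V n (ε * x)) * Real.cos (ρ k * y) := by
      rw [hq, hu]; ring
    have s20 := FK.dom_summable D20 x y
    have s02 := FK.dom_summable D02 x y
    have s10 := FK.dom_summable D10 x y
    have s00 := FK.dom_summable D00 x y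
    have key : FK.ser A2 f (x, y) + FK.ser A f2 (x, y) + lam₁ * ε * FK.ser A1 f (x, y)
        + FK.ser A f (x, y) * (ρ₀ ^ 2 + ε ^ 2) = FK.ser A f (x, y) * FK.ser A f (x, y) := by
      rw [hsq, ← tsum_mul_left]
      have := ((s20.hasSum.add s02.hasSum).add (s10.hasSum.mul_left (lam₁ * ε))).add (s00.hasSum.mul_right (ρ₀^2 + ε^2))
      unfold FK.ser
      simp only
      rw [← this.tsum_eq]
      refine tsum_congr fun k => ?_
      rw [← hV.ode k (ε * x), hm, hA, hA1, hA2, hf, hf2]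
      simp only
      field_simp
      ring
    linarith
  · intro x
    rw [ey]
    constructor
    · unfold FK.ser
      simp [hf1]
    · have s01 := FK.dom_summable D01 x 1
      have s00 := FK.dom_summable D00 x 1
      have := s01.hasSum.add (s00.hasSum.mul_left β)
      unfold FK.ser
      simp only
      rw [← this.tsum_eq]
      refine (tsum_congr fun k => ?_).trans tsum_zero
      have h := hbc k
      rw [hf, hf1]
      simp only [mul_one]
      linear_combination (-(A k x)) * h
  · intro x y _
    refine (habs x y).trans ?_
    have := hWs (hWB (ε * x))
    rw [mul_comm]
    have h0 : 0 ≤ D * S := by positivity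
    gcongr
    linarith
  · intro δ hδ
    have h1 := (FK.unif_lim hV.b0 hV.top).2
    simp only [sub_zero] at h1
    have h2 : Tendsto (fun x => ε * x) atTop atTop := tendsto_id.const_mul_atTop hε
    have h3 := (h1.comp h2).eventually (gt_mem_nhds hδ)
    obtain ⟨X, hX⟩ := eventually_atTop.1 h3
    refine ⟨X, fun x hx y _ => (habs x y).trans ?_⟩
    have h4 := hX x hx
    simp only [Function.comp] at h4
    exact (mul_le_of_le_one_left (tsum_nonneg fun k => abs_nonneg _) hε2).trans h4.le
  · refine ⟨fun y => ε^2 * ∑' k, l k * Real.cos (ρ k * y), ?_, ?_, ?_⟩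
    · intro δ hδ
      have h1 := (FK.unif_lim hV.b0 hV.bot).2
      have h2 : Tendsto (fun x => ε * x) atBot atBot := tendsto_id.const_mul_atBot hε
      have h3 := (h1.comp h2).eventually (gt_mem_nhds hδ)
      obtain ⟨X, hX⟩ := eventually_atBot.1 h3
      refine ⟨X, fun x hx y _ => ?_⟩
      have h4 := hX x hx
      simp only [Function.comp] at h4
      rw [hu, ← mul_sub, abs_mul, abs_of_nonneg (by positivity : 0 ≤ ε^2)]
      have h5 := FK.cos_diff (hWB (ε * x)) hN1 ρ y
      exact (mul_le_of_le_one_left (abs_nonneg _) hε2).trans (h5.trans h4.le)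
    · intro y _
      have h := hm1 y
      have e : ε^2 * (∑' k, l k * Real.cos (ρ k * y)) - ε^2 / σ * Real.cos (ρ₀ * y)
          = ε^2 * ((∑' k, l k * Real.cos (ρ k * y)) - 1 / σ * Real.cos (ρ₀ * y)) := by ring
      simp only
      rw [e, abs_mul, abs_of_nonneg (by positivity : 0 ≤ ε^2)]
      have h1 : 0 ≤ N * S := by positivity
      have h2 : 0 ≤ D * S := by positivity
      calc _ ≤ ε^2 * (D * ε^2 * S) := by gcongr
        _ = D * S * ε^3 * ε := by ring
        _ ≤ D * S * ε^3 * 1 := by gcongr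
        _ = D * S * ε^3 := mul_one _
        _ ≤ (N * S + D * S + 1) * ε^3 := by gcongr; linarith
    · refine ⟨0, ⟨le_rfl, zero_le_one⟩, ?_⟩
      have h := hm1 0
      have h0 : 0 ≤ D * S := by positivity
      simp only [mul_zero, Real.cos_zero, mul_one] at h ⊢
      intro hz
      have hz' : ∑' k, l k = 0 := by
        rcases mul_eq_zero.1 hz with h' | h'
        · exact absurd h' (by positivity)
        · exact h'
      rw [hz', zero_sub, abs_neg, abs_of_pos (by positivity), div_le_iff₀ hσ0] at h
      have h6 : D * ε^2 * S * σ = (D * S * σ) * (ε * ε) := by ring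
      have h7 : (D * S * σ) * (ε * ε) ≤ (D * S * σ) * (ε * 1) := by gcongr
      linarith
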